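/- arXiv:2006.06089 — 3 statements merged into one kernel-verified Lean document; each statement's English description precedes it below -/
import Mathlib

section
/- Let $1<s<2$ and $n>2s$, and assume the strict inequality $\Gamma(\tfrac{n+2s}{4})^2/\Gamma(\tfrac{n-2s}{4})^2 < \Gamma(\tfrac n2)\Gamma(1+s)/\Gamma(\tfrac{n-2s}{2})$. Then there is no continuous function $\tau:\mathbb{S}^{n-1}\to\mathbb{R}$ such that the homogeneous function $u(x):=\tau(x/|x|)-2s\log|x|$ satisfies both: (i) $\int_{\mathbb{R}^n} u(x)\,(-\Delta)^{s-1}(-\Delta\varphi)(x)\,dx = \int_{\mathbb{R}^n} e^{u(x)}\varphi(x)\,dx$ for every $\varphi\in C_c^\infty(\mathbb{R}^n)$ (distributional solution of $(-\Delta)^s u=e^u$), and (ii) the stability inequality $\int_{\mathbb{R}^n} e^{u}\phi^2\,dx \le \int_{\mathbb{R}^n}|(-\Delta)^{s/2}\phi|^2\,dx$ for every $\phi\in C_c^\infty(\mathbb{R}^n)$. -/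
open MeasureTheory Metric Filter Set

noncomputable section

/-- Euclidean space `ℝ^n`. -/
abbrev En (n : ℕ) : Type := EuclideanSpace ℝ (Fin n)

/-- The Laplacian of `f` at `x`: the trace of the Hessian,
`Δ f (x) = ∑ i ∂²f/∂xᵢ² (x)`. -/
def lap {m : ℕ} (f : EuclideanSpace ℝ (Fin m) → ℝ) (x : EuclideanSpace ℝ (Fin m)) : ℝ :=
  ∑ i, fderiv ℝ (fun y => fderiv ℝ f y (EuclideanSpace.single i (1:ℝ))) x
      (EuclideanSpace.single i (1:ℝ))

/-- The normalizing constant `c_{n,σ} = 4^σ Γ(n/2+σ) / (π^{n/2} |Γ(-σ)|)` of the fractional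
Laplacian `(-Δ)^σ`. -/
def cFrac (n : ℕ) (σ : ℝ) : ℝ :=
  (4:ℝ) ^ σ * Real.Gamma ((n : ℝ) / 2 + σ) / (Real.pi ^ ((n : ℝ) / 2) * |Real.Gamma (-σ)|)

/-- The truncated singular integral `∫_{|x-z| ≥ ε} (w(x)-w(z))/|x-z|^{n+2σ} dz`. -/
def truncInt (n : ℕ) (σ : ℝ) (w : En n → ℝ) (x : En n) (ε : ℝ) : ℝ :=
  ∫ z in {z : En n | ε ≤ dist x z}, (w x - w z) / dist x z ^ ((n : ℝ) + 2 * σ)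

/-- The fractional Laplacian `(-Δ)^σ w (x)`, defined as the principal value
`c_{n,σ} p.v.∫ (w(x)-w(z))/|x-z|^{n+2σ} dz` (via the limit of truncated integrals as ε → 0⁺). -/
def fracLap (n : ℕ) (σ : ℝ) (w : En n → ℝ) (x : En n) : ℝ :=
  cFrac n σ * limUnder (nhdsWithin 0 (Set.Ioi 0)) (truncInt n σ w x)

/-- `HasFracLap n σ w g` means: for every `x` the principal value defining `(-Δ)^σ w (x)`
converges, with value `g x`. -/
def HasFracLap (n : ℕ) (σ : ℝ) (w g : En n → ℝ) : Prop :=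
  ∀ x, Filter.Tendsto (fun ε => cFrac n σ * truncInt n σ w x ε)
    (nhdsWithin 0 (Set.Ioi 0)) (nhds (g x))

/-- `φ ∈ C_c^∞(S)`: smooth, compactly supported, with (closed) support contained in `S`. -/
def TestOn (n : ℕ) (S : Set (En n)) (φ : En n → ℝ) : Prop :=
  ContDiff ℝ (⊤ : ℕ∞) φ ∧ HasCompactSupport φ ∧ tsupport φ ⊆ S

/-- Membership in the Hölder space `C^γ(ℝ^n)` (for non-integer `γ`): `u` is `⌊γ⌋` times
continuously differentiable and its `⌊γ⌋`-th derivative is Hölder continuous of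
exponent `γ - ⌊γ⌋`. -/
def CHolder {n : ℕ} (γ : ℝ) (u : En n → ℝ) : Prop :=
  ContDiff ℝ (⌊γ⌋₊ : ℕ) u ∧
    ∃ C : NNReal, HolderWith C (γ - (⌊γ⌋₊ : ℝ)).toNNReal (iteratedFDeriv ℝ ⌊γ⌋₊ u)

/-- `u` is stable outside the ball `B_R`:
`∫ e^u φ² ≤ ∫ |(-Δ)^{s/2} φ|²` for all `φ ∈ C_c^∞(ℝ^n \ closure B_R)`. -/
def StableOutsideBall (n : ℕ) (s : ℝ) (u : En n → ℝ) (R : ℝ) : Prop :=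
  ∀ φ : En n → ℝ, TestOn n (Metric.closedBall (0 : En n) R)ᶜ φ →
    ∫ x, Real.exp (u x) * φ x ^ 2 ≤ ∫ x, (fracLap n (s / 2) φ x) ^ 2

open scoped FourierTransform RealInnerProductSpace

/-- Tonelli's theorem for a nonnegative kernel whose two families of sections have explicit
integrals. -/
theorem integrable_and_integral_eq_of_sections {α β : Type*} [MeasurableSpace α]
    [MeasurableSpace β] {μ : Measure α} {ν : Measure β} [SFinite μ] [SFinite ν]
    {K : α → β → ℝ} (hK : AEStronglyMeasurable (Function.uncurry K) (μ.prod ν))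
    (hK0 : ∀ᵐ b ∂ν, ∀ a, 0 ≤ K a b) {f : α → ℝ} {g : β → ℝ} {c : ℝ}
    (hf : ∀ᵐ a ∂μ, ∫ b, K a b ∂ν = f a)
    (hg : ∀ᵐ b ∂ν, Integrable (fun a => K a b) μ ∧ ∫ a, K a b ∂μ = g b)
    (hgi : Integrable g ν) (hgc : ∫ b, g b ∂ν = c) :
    Integrable f μ ∧ ∫ a, f a ∂μ = c := by
  have hInt : Integrable (Function.uncurry K) (μ.prod ν) := by
    rw [integrable_prod_iff' hK]
    refine ⟨hg.mono fun b hb => hb.1, hgi.congr ?_⟩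
    filter_upwards [hg, hK0] with b hb hb0
    rw [← hb.2]
    exact integral_congr_ae (Eventually.of_forall fun a =>
      (Real.norm_of_nonneg (hb0 a)).symm)
  constructor
  · exact hInt.integral_prod_left.congr hf
  · rw [← hgc, ← integral_congr_ae hf, integral_integral_swap hInt]
    exact integral_congr_ae (hg.mono fun b hb => hb.2)

theorem integrableOn_rpow_mul_exp_neg_mul {a b : ℝ} (ha : 0 < a) (hb : 0 < b) :
    IntegrableOn (fun t : ℝ => t ^ (a - 1) * Real.exp (-(b * t))) (Ioi 0) := by
  have := integrableOn_rpow_mul_exp_neg_mul_rpow (p := 1) (s := a - 1) (b := b)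
    (by linarith) one_pos hb
  simpa using this

theorem integral_rpow_mul_exp_neg_mul {a b : ℝ} (ha : 0 < a) (hb : 0 < b) :
    ∫ t in Ioi (0 : ℝ), t ^ (a - 1) * Real.exp (-(b * t)) = Real.Gamma a * b ^ (-a) := by
  rw [Real.integral_rpow_mul_exp_neg_mul_Ioi ha hb, one_div, Real.inv_rpow hb.le,
    Real.rpow_neg hb.le, mul_comm]

theorem rpow_neg_one_comp_eq {a b t : ℝ} (ht : 0 < t) :
    (|(-1 : ℝ)| * t ^ ((-1 : ℝ) - 1)) • ((t ^ (-1 : ℝ)) ^ (a - 1) *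
      Real.exp (-(b * t ^ (-1 : ℝ)))) = t ^ (-a - 1) * Real.exp (-(b / t)) := by
  rw [← Real.rpow_mul ht.le, Real.rpow_neg_one t, abs_neg, abs_one, one_mul, smul_eq_mul,
    ← mul_assoc, ← Real.rpow_add ht, ← div_eq_mul_inv]
  congr 2
  ring

theorem integrableOn_rpow_mul_exp_neg_div {a b : ℝ} (ha : 0 < a) (hb : 0 < b) :
    IntegrableOn (fun t : ℝ => t ^ (-a - 1) * Real.exp (-(b / t))) (Ioi 0) := by
  have := (integrableOn_Ioi_comp_rpow_iff (fun t : ℝ => t ^ (a - 1) * Real.exp (-(b * t)))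
    (p := -1) (by norm_num)).2 (integrableOn_rpow_mul_exp_neg_mul ha hb)
  exact this.congr_fun (fun t ht => rpow_neg_one_comp_eq ht) measurableSet_Ioi

theorem integral_rpow_mul_exp_neg_div {a b : ℝ} (ha : 0 < a) (hb : 0 < b) :
    ∫ t in Ioi (0 : ℝ), t ^ (-a - 1) * Real.exp (-(b / t)) = Real.Gamma a * b ^ (-a) := by
  rw [← integral_rpow_mul_exp_neg_mul ha hb, ← integral_comp_rpow_Ioi
    (fun t : ℝ => t ^ (a - 1) * Real.exp (-(b * t))) (p := -1) (by norm_num)]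
  exact setIntegral_congr_fun measurableSet_Ioi (fun t ht => (rpow_neg_one_comp_eq ht).symm)

theorem integral_exp_neg_mul_Ioc {b x : ℝ} (hx : 0 ≤ x) :
    ∫ r in Ioc 0 x, b * Real.exp (-(b * r)) = 1 - Real.exp (-(b * x)) := by
  rw [← intervalIntegral.integral_of_le hx]
  have h : ∀ r ∈ uIcc 0 x, HasDerivAt (fun r => -Real.exp (-(b * r)))
      (b * Real.exp (-(b * r))) r := by
    intro r _
    have : HasDerivAt (fun r => -Real.exp (-(b * r))) (-(Real.exp (-(b * r)) * -(b * 1))) r :=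
      ((hasDerivAt_id r).const_mul b).neg.exp.neg
    convert this using 1
    ring
  rw [intervalIntegral.integral_eq_sub_of_hasDerivAt h
    (Continuous.intervalIntegrable (by fun_prop) _ _)]
  simp
  ring

/-- The Mellin-type integral `∫₀^∞ t^(σ-1) (1 - e^(-b/t)) dt = Γ(1-σ) b^σ / σ`. -/
theorem rpow_mul_one_sub_exp_neg_div {σ b : ℝ} (h0 : 0 < σ) (h1 : σ < 1) (hb : 0 < b) :
    IntegrableOn (fun t : ℝ => t ^ (σ - 1) * (1 - Real.exp (-(b / t)))) (Ioi 0) ∧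
    ∫ t in Ioi (0 : ℝ), t ^ (σ - 1) * (1 - Real.exp (-(b / t))) =
      Real.Gamma (1 - σ) * b ^ σ / σ := by
  have hset : MeasurableSet {p : ℝ × ℝ | 0 < p.1 ∧ 0 < p.2 ∧ p.2 ≤ 1 / p.1} :=
    (measurableSet_lt measurable_const measurable_fst).inter
      ((measurableSet_lt measurable_const measurable_snd).inter
        (measurableSet_le measurable_snd (measurable_const.div measurable_fst)))
  refine integrable_and_integral_eq_of_sections (ν := volume.restrict (Ioi (0 : ℝ)))
    (K := fun t r => {p : ℝ × ℝ | 0 < p.1 ∧ 0 < p.2 ∧ p.2 ≤ 1 / p.1}.indicator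
      (fun p => p.1 ^ (σ - 1) * (b * Real.exp (-(b * p.2)))) (t, r))
    (g := fun r => σ⁻¹ * b * (r ^ ((1 - σ) - 1) * Real.exp (-(b * r)))) ?_ ?_ ?_ ?_ ?_ ?_
  · refine (Measurable.indicator ?_ hset).aestronglyMeasurable
    fun_prop
  · refine Eventually.of_forall fun r t => indicator_nonneg (fun p hp => ?_) _
    have := hp.1
    positivity
  · refine (ae_restrict_iff' measurableSet_Ioi).2 (Eventually.of_forall fun t ht => ?_)
    have ht' : (0 : ℝ) < t := ht
    have : ∀ r : ℝ, {p : ℝ × ℝ | 0 < p.1 ∧ 0 < p.2 ∧ p.2 ≤ 1 / p.1}.indicator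
        (fun p => p.1 ^ (σ - 1) * (b * Real.exp (-(b * p.2)))) (t, r) =
        (Ioc 0 (1 / t)).indicator (fun r => t ^ (σ - 1) * (b * Real.exp (-(b * r)))) r := by
      intro r
      simp only [indicator_apply, mem_ofPred_eq, mem_Ioc, ht', true_and]
    simp_rw [this]
    rw [setIntegral_indicator measurableSet_Ioc, inter_eq_right.2 (fun r hr => hr.1),
      integral_const_mul, integral_exp_neg_mul_Ioc (by positivity), mul_one_div]
  · refine (ae_restrict_iff' measurableSet_Ioi).2 (Eventually.of_forall fun r hr => ?_)
    have hr' : (0 : ℝ) < r := hr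
    have : ∀ t : ℝ, {p : ℝ × ℝ | 0 < p.1 ∧ 0 < p.2 ∧ p.2 ≤ 1 / p.1}.indicator
        (fun p => p.1 ^ (σ - 1) * (b * Real.exp (-(b * p.2)))) (t, r) =
        (Ioc 0 (1 / r)).indicator (fun t => t ^ (σ - 1) * (b * Real.exp (-(b * r)))) t := by
      intro t
      simp only [indicator_apply, mem_ofPred_eq, mem_Ioc, hr', true_and]
      congr 1
      refine propext (and_congr_right fun ht => ?_)
      rw [le_div_iff₀ ht, le_div_iff₀ hr', mul_comm]
    simp_rw [this]
    have hInt : IntegrableOn (fun t : ℝ => t ^ (σ - 1)) (Ioc 0 (1 / r)) := by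
      have := intervalIntegral.intervalIntegrable_rpow' (r := σ - 1) (a := 0) (b := 1 / r)
        (by linarith)
      rwa [intervalIntegrable_iff_integrableOn_Ioc_of_le (by positivity)] at this
    constructor
    · exact ((integrable_indicator_iff measurableSet_Ioc).2 (hInt.mul_const _)).restrict
    · rw [setIntegral_indicator measurableSet_Ioc, inter_eq_right.2 (fun r hr => hr.1),
        integral_mul_const, ← intervalIntegral.integral_of_le (by positivity),
        integral_rpow (Or.inl (by linarith)), sub_add_cancel, Real.zero_rpow h0.ne',
        one_div, Real.inv_rpow hr'.le, ← Real.rpow_neg hr'.le,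
        show 1 - σ - 1 = -σ by ring]
      ring
  · exact (integrableOn_rpow_mul_exp_neg_mul (by linarith) hb).const_mul _
  · rw [integral_const_mul, integral_rpow_mul_exp_neg_mul (by linarith) hb,
      show -(1 - σ) = σ - 1 by ring, Real.rpow_sub_one hb.ne']
    field_simp

theorem integral_exp_neg_div_div_sq {v : ℝ} (hv : 0 < v) :
    ∫ t in Ioi (0 : ℝ), Real.exp (-(v / t)) / t ^ 2 = 1 / v := by
  have := integral_rpow_mul_exp_neg_div one_pos hv
  rw [Real.Gamma_one, one_mul, Real.rpow_neg_one] at this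
  rw [one_div, ← this]
  refine setIntegral_congr_fun measurableSet_Ioi fun t ht => ?_
  have ht' : (0 : ℝ) < t := ht
  have e : (t : ℝ) ^ (-1 - 1 : ℝ) = (t ^ 2)⁻¹ := by
    rw [show (-1 - 1 : ℝ) = -((2 : ℕ) : ℝ) by norm_num, Real.rpow_neg ht'.le, Real.rpow_natCast]
  simp only [e]
  ring

theorem frullani_of_le {a b : ℝ} (ha : 0 < a) (hab : a ≤ b) :
    IntegrableOn (fun t : ℝ => (Real.exp (-(a / t)) - Real.exp (-(b / t))) / t) (Ioi 0) ∧
    ∫ t in Ioi (0 : ℝ), (Real.exp (-(a / t)) - Real.exp (-(b / t))) / t =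
      Real.log b - Real.log a := by
  have hne : (0 : ℝ) ∉ uIcc a b := by
    rw [uIcc_of_le hab]
    exact fun h => absurd h.1 (not_le.2 ha)
  refine integrable_and_integral_eq_of_sections (ν := volume.restrict (Ioc a b))
    (K := fun t v => Real.exp (-(v / t)) / t ^ 2)
    (g := fun v => 1 / v) ?_ ?_ ?_ ?_ ?_ ?_
  · refine Measurable.aestronglyMeasurable ?_
    unfold Function.uncurry
    fun_prop
  · exact Eventually.of_forall fun v t => by positivity
  · refine (ae_restrict_iff' measurableSet_Ioi).2 (Eventually.of_forall fun t ht => ?_)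
    have ht' : (0 : ℝ) < t := ht
    rw [← intervalIntegral.integral_of_le hab]
    have h : ∀ v ∈ uIcc a b, HasDerivAt (fun v => -Real.exp (-(v / t)) / t)
        (Real.exp (-(v / t)) / t ^ 2) v := by
      intro v _
      have : HasDerivAt (fun v => -Real.exp (-(v / t)) / t)
          (-(Real.exp (-(v / t)) * -(1 / t)) / t) v :=
        (((hasDerivAt_id v).div_const t).neg.exp.neg).div_const t
      convert this using 1
      field_simp
    rw [intervalIntegral.integral_eq_sub_of_hasDerivAt h
      (Continuous.intervalIntegrable (by fun_prop) _ _)]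
    ring
  · refine (ae_restrict_iff' measurableSet_Ioc).2 (Eventually.of_forall fun v hv => ?_)
    have hv' : 0 < v := ha.trans hv.1
    refine ⟨Integrable.of_integral_ne_zero ?_, integral_exp_neg_div_div_sq hv'⟩
    rw [integral_exp_neg_div_div_sq hv']
    positivity
  · rw [← IntegrableOn, ← intervalIntegrable_iff_integrableOn_Ioc_of_le hab]
    exact intervalIntegral.intervalIntegrable_one_div (fun x hx h => hne (h ▸ hx)) continuousOn_id
  · rw [← intervalIntegral.integral_of_le hab, integral_one_div hne,
      Real.log_div (ha.trans_le hab).ne' ha.ne']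

/-- Frullani's integral, together with the integral of the absolute value. -/
theorem frullani {a b : ℝ} (ha : 0 < a) (hb : 0 < b) :
    IntegrableOn (fun t : ℝ => (Real.exp (-(a / t)) - Real.exp (-(b / t))) / t) (Ioi 0) ∧
    ∫ t in Ioi (0 : ℝ), (Real.exp (-(a / t)) - Real.exp (-(b / t))) / t =
      Real.log b - Real.log a ∧
    ∫ t in Ioi (0 : ℝ), |(Real.exp (-(a / t)) - Real.exp (-(b / t))) / t| =
      |Real.log b - Real.log a| := by
  have key : ∀ {a b : ℝ}, 0 < a → a ≤ b →
      ∫ t in Ioi (0 : ℝ), |(Real.exp (-(a / t)) - Real.exp (-(b / t))) / t| =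
        |Real.log b - Real.log a| := by
    intro a b ha hab
    rw [abs_of_nonneg (sub_nonneg.2 (Real.log_le_log ha hab)), ← (frullani_of_le ha hab).2]
    refine setIntegral_congr_fun measurableSet_Ioi fun t ht => abs_of_nonneg ?_
    have ht' : (0 : ℝ) < t := ht
    refine div_nonneg (sub_nonneg.2 (Real.exp_le_exp.2 (neg_le_neg ?_))) ht'.le
    gcongr
  rcases le_total a b with hab | hab
  · exact ⟨(frullani_of_le ha hab).1, (frullani_of_le ha hab).2, key ha hab⟩
  · have e : (fun t : ℝ => (Real.exp (-(a / t)) - Real.exp (-(b / t))) / t) =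
        fun t => -((Real.exp (-(b / t)) - Real.exp (-(a / t))) / t) := by
      ext t; ring
    have h := frullani_of_le hb hab
    refine ⟨e ▸ h.1.neg, ?_, ?_⟩
    · rw [e, integral_neg, h.2, neg_sub]
    · rw [abs_sub_comm, ← key hb hab]
      congr 1 with t
      rw [congr_fun e t, abs_neg]

/-- The kernel `(e^(p/2) + e^(-p/2))^(-2c)`. -/
def coshKernel (c p : ℝ) : ℝ := (Real.exp (p / 2) + Real.exp (-p / 2)) ^ (-2 * c)

theorem coshKernel_eq_sigmoid (c p : ℝ) :
    coshKernel c p = (Real.sigmoid p * (1 - Real.sigmoid p)) *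
      (Real.sigmoid p ^ (c - 1) * (1 - Real.sigmoid p) ^ (c - 1)) := by
  have h0 := Real.sigmoid_pos p
  have h1 : 0 < 1 - Real.sigmoid p := sub_pos.2 (Real.sigmoid_lt_one p)
  have hE : 0 < Real.exp (p / 2) + Real.exp (-p / 2) := by positivity
  have key : Real.sigmoid p * (1 - Real.sigmoid p) =
      (Real.exp (p / 2) + Real.exp (-p / 2)) ^ (-2 : ℝ) := by
    rw [Real.rpow_neg hE.le, ← Real.sigmoid_neg, Real.sigmoid_def, Real.sigmoid_def, ← mul_inv]
    congr 1
    rw [show (2 : ℝ) = ((2 : ℕ) : ℝ) by norm_num, Real.rpow_natCast]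
    have e1 : Real.exp (-p) = Real.exp (-p / 2) ^ 2 := by
      rw [← Real.exp_nat_mul]; congr 1; push_cast; ring
    have e2 : Real.exp (- -p) = Real.exp (p / 2) ^ 2 := by
      rw [← Real.exp_nat_mul]; congr 1; push_cast; ring
    have e3 : Real.exp (p / 2) * Real.exp (-p / 2) = 1 := by
      rw [← Real.exp_add]; simp [neg_div]
    push_cast
    rw [e1, e2]
    linear_combination (Real.exp (p / 2) * Real.exp (-p / 2) - 1) * e3
  rw [← Real.mul_rpow h0.le h1.le, coshKernel, Real.rpow_mul hE.le, ← key,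
    Real.rpow_sub_one (mul_pos h0 h1).ne', mul_div_cancel₀ _ (mul_pos h0 h1).ne']

theorem coshKernel_integral {c : ℝ} (hc : 0 < c) :
    Integrable (coshKernel c) ∧
      ∫ p, coshKernel c p = Real.Gamma c ^ 2 / Real.Gamma (2 * c) := by
  have hbeta : ∫ x in Ioo (0 : ℝ) 1, x ^ (c - 1) * (1 - x) ^ (c - 1) =
      Real.Gamma c ^ 2 / Real.Gamma (2 * c) := by
    have h := Complex.betaIntegral_eq_Gamma_mul_div c c (by simpa using hc) (by simpa using hc)
    rw [Complex.betaIntegral, intervalIntegral.integral_of_le zero_le_one,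
      integral_Ioc_eq_integral_Ioo, ← Complex.ofReal_add, Complex.Gamma_ofReal,
      Complex.Gamma_ofReal] at h
    have e : ∀ x ∈ Ioo (0 : ℝ) 1, (x : ℂ) ^ ((c : ℂ) - 1) * (1 - (x : ℂ)) ^ ((c : ℂ) - 1) =
        ((x ^ (c - 1) * (1 - x) ^ (c - 1) : ℝ) : ℂ) := by
      intro x hx
      push_cast
      rw [Complex.ofReal_cpow hx.1.le, Complex.ofReal_cpow (sub_pos.2 hx.2).le]
      push_cast
      rfl
    rw [setIntegral_congr_fun measurableSet_Ioo e, integral_complex_ofReal] at h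
    rw [sq, two_mul]
    exact_mod_cast h
  have h := integral_image_eq_integral_abs_deriv_smul (s := univ) (f := Real.sigmoid)
    MeasurableSet.univ (fun x _ => (Real.hasDerivAt_sigmoid x).hasDerivWithinAt)
    Real.sigmoid_injective.injOn (fun x => x ^ (c - 1) * (1 - x) ^ (c - 1))
  rw [image_univ, Real.range_sigmoid, hbeta, setIntegral_univ] at h
  have h2 : ∫ p, coshKernel c p = Real.Gamma c ^ 2 / Real.Gamma (2 * c) := by
    rw [h]
    congr 1 with p
    rw [coshKernel_eq_sigmoid, abs_of_pos, smul_eq_mul]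
    exact mul_pos (Real.sigmoid_pos p) (sub_pos.2 (Real.sigmoid_lt_one p))
  refine ⟨Integrable.of_integral_ne_zero ?_, h2⟩
  rw [h2]
  have := Real.Gamma_pos_of_pos hc
  have := Real.Gamma_pos_of_pos (mul_pos two_pos hc)
  positivity

theorem integral_angular_mul_radial {n : ℕ} (hn : 0 < n)
    (a : Metric.sphere (0 : En n) 1 → ℝ) (A : En n → ℝ)
    (hA : ∀ (x : En n) (_ : x ≠ 0) (h : ‖x‖⁻¹ • x ∈ Metric.sphere (0 : En n) 1),
      A x = a ⟨‖x‖⁻¹ • x, h⟩) (f : ℝ → ℝ) :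
    ∫ x, A x * f ‖x‖ = (⨍ θ, a θ ∂(volume : Measure (En n)).toSphere) * ∫ x : En n, f ‖x‖ := by
  have : Nonempty (Fin n) := ⟨⟨0, hn⟩⟩
  have key : ∀ (a : Metric.sphere (0 : En n) 1 → ℝ) (A : En n → ℝ)
      (hA : ∀ (x : En n) (_ : x ≠ 0) (h : ‖x‖⁻¹ • x ∈ Metric.sphere (0 : En n) 1),
        A x = a ⟨‖x‖⁻¹ • x, h⟩),
      ∫ x, A x * f ‖x‖ = (∫ θ, a θ ∂(volume : Measure (En n)).toSphere) *
        ∫ r : Ioi (0 : ℝ), f r ∂(Measure.volumeIoiPow (Module.finrank ℝ (En n) - 1)) := by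
    intro a A hA
    calc
      ∫ x, A x * f ‖x‖ = ∫ x : ({(0)}ᶜ : Set (En n)), A x * f ‖x.1‖
          ∂((volume : Measure (En n)).comap (↑)) := by
        rw [integral_subtype_comap (measurableSet_singleton _).compl fun x => A x * f ‖x‖,
          restrict_compl_singleton]
      _ = ∫ p, a p.1 * f p.2 ∂(volume : Measure (En n)).toSphere.prod
          (.volumeIoiPow (Module.finrank ℝ (En n) - 1)) := by
        rw [← (volume : Measure (En n)).measurePreserving_homeomorphUnitSphereProd.integral_comp
          (Homeomorph.measurableEmbedding _) (fun p => a p.1 * f p.2)]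
        congr 1 with x
        rw [hA x x.2 (by
          have : ‖(x : En n)‖ ≠ 0 := norm_ne_zero_iff.2 x.2
          simp [norm_smul, inv_mul_cancel₀ this])]
        congr 2
        · exact Subtype.ext (by simp)
        · simp
      _ = _ := integral_prod_mul a (fun r : Ioi (0 : ℝ) => f r)
  rw [key a A hA]
  have h1 := key (fun _ => 1) (fun _ => 1) (fun _ _ _ => rfl)
  simp only [one_mul, integral_const, smul_eq_mul, mul_one] at h1
  have hne : (volume : Measure (En n)).toSphere.real univ ≠ 0 := by
    rw [Measure.real, ENNReal.toReal_ne_zero]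
    exact ⟨Measure.measure_univ_ne_zero.2 (Measure.toSphere_ne_zero (volume : Measure (En n))),
      measure_ne_top _ _⟩
  rw [h1, average_eq, smul_eq_mul]
  field_simp

/-- Half the surface measure of the unit sphere. -/
def halfSphere (n : ℕ) : ℝ := n * (volume : Measure (En n)).real (ball 0 1) / 2

theorem halfSphere_pos {n : ℕ} (hn : 0 < n) : 0 < halfSphere n := by
  have : 0 < (volume : Measure (En n)).real (ball 0 1) :=
    ENNReal.toReal_pos (measure_ball_pos _ _ one_pos).ne' measure_ball_lt_top.ne
  unfold halfSphere
  positivity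

theorem integral_norm_rpow_mul_gaussian {n : ℕ} (hn : 0 < n) {p b : ℝ} (hp : -(n : ℝ) < p)
    (hb : 0 < b) :
    Integrable (fun x : En n => ‖x‖ ^ p * Real.exp (-(b * ‖x‖ ^ 2))) ∧
    ∫ x : En n, ‖x‖ ^ p * Real.exp (-(b * ‖x‖ ^ 2)) =
      halfSphere n * Real.Gamma ((n + p) / 2) * b ^ (-((n + p) / 2)) := by
  have : Nonempty (Fin n) := ⟨⟨0, hn⟩⟩
  have h : ∫ x : En n, ‖x‖ ^ p * Real.exp (-(b * ‖x‖ ^ 2)) =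
      halfSphere n * Real.Gamma ((n + p) / 2) * b ^ (-((n + p) / 2)) := by
    rw [integral_fun_norm_addHaar volume (fun r : ℝ => r ^ p * Real.exp (-(b * r ^ 2)))]
    have e : ∀ r ∈ Ioi (0 : ℝ), r ^ (Module.finrank ℝ (En n) - 1) •
        (r ^ p * Real.exp (-(b * r ^ 2))) = r ^ (n + p - 1) * Real.exp (-b * r ^ (2 : ℝ)) := by
      intro r hr
      have hr' : (0 : ℝ) < r := hr
      rw [finrank_euclideanSpace_fin, smul_eq_mul, ← mul_assoc, ← Real.rpow_natCast,
        ← Real.rpow_add hr', Nat.cast_sub hn, Real.rpow_two, neg_mul]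
      congr 2
      push_cast
      ring
    rw [setIntegral_congr_fun measurableSet_Ioi e, integral_rpow_mul_exp_neg_mul_rpow two_pos
      (by linarith) hb, halfSphere, finrank_euclideanSpace_fin]
    simp only [smul_eq_mul, nsmul_eq_mul, sub_add_cancel, neg_div]
    ring
  refine ⟨Integrable.of_integral_ne_zero ?_, h⟩
  rw [h]
  have := halfSphere_pos hn
  have := Real.Gamma_pos_of_pos (show 0 < (n + p) / 2 by linarith)
  positivity

theorem integrable_gaussian {n : ℕ} {b : ℝ} (hb : 0 < b) :
    Integrable (fun x : En n => Real.exp (-(b * ‖x‖ ^ 2))) := by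
  refine Integrable.of_integral_ne_zero ?_
  have := GaussianFourier.integral_rexp_neg_mul_sq_norm (V := En n) hb
  simp only [neg_mul] at this
  rw [this]
  have := Real.pi_pos
  positivity

theorem fourier_gaussian {n : ℕ} {b : ℝ} (hb : 0 < b) (ξ : En n) :
    𝓕 (fun x : En n => ((Real.exp (-(b * ‖x‖ ^ 2)) : ℝ) : ℂ)) ξ =
      (((Real.pi / b) ^ ((n : ℝ) / 2) * Real.exp (-(Real.pi ^ 2 * ‖ξ‖ ^ 2 / b)) : ℝ) : ℂ) := by
  have h := fourier_gaussian_innerProductSpace (V := En n) (b := b) (by simpa using hb) ξ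
  have e : (fun x : En n => ((Real.exp (-(b * ‖x‖ ^ 2)) : ℝ) : ℂ)) =
      fun x => Complex.exp (-b * ‖x‖ ^ 2) := by
    ext x; push_cast; ring_nf
  rw [e, h, finrank_euclideanSpace_fin]
  push_cast
  rw [Complex.ofReal_cpow (by have := Real.pi_pos; positivity)]
  push_cast
  ring_nf

theorem integral_gaussian_mul_cos {n : ℕ} {b : ℝ} (hb : 0 < b) (ξ : En n) :
    ∫ x : En n, Real.exp (-(b * ‖x‖ ^ 2)) * Real.cos (2 * Real.pi * ⟪x, ξ⟫) =
      (Real.pi / b) ^ ((n : ℝ) / 2) * Real.exp (-(Real.pi ^ 2 * ‖ξ‖ ^ 2 / b)) := by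
  have h := congrArg Complex.re (fourier_gaussian hb ξ)
  rw [Complex.ofReal_re, Real.fourier_eq'] at h
  rw [← h, ← Complex.reCLM_apply, ← ContinuousLinearMap.integral_comp_comm]
  · congr 1 with x
    rw [Complex.reCLM_apply, smul_eq_mul, Complex.re_mul_ofReal, Complex.exp_ofReal_mul_I_re]
    rw [show -2 * Real.pi * ⟪x, ξ⟫ = -(2 * Real.pi * ⟪x, ξ⟫) by ring, Real.cos_neg, mul_comm]
  · have hi : Integrable (fun x : En n => ((Real.exp (-(b * ‖x‖ ^ 2)) : ℝ) : ℂ)) :=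
      (integrable_gaussian hb).ofReal
    have := (Real.fourierIntegral_convergent_iff ξ).2 hi
    simpa [Circle.smul_def, Real.fourierChar_apply] using this

/-- The symbol of the truncation-free singular integral:
`∫ (1 - cos (2π ⟪y, ξ⟫)) / |y|^(n+2σ) dy = (2π|ξ|)^(2σ) / c_{n,σ}`. -/
theorem integral_one_sub_cos_div {n : ℕ} (hn : 0 < n) {σ : ℝ} (h0 : 0 < σ) (h1 : σ < 1)
    (ξ : En n) :
    Integrable (fun y : En n => (1 - Real.cos (2 * Real.pi * ⟪y, ξ⟫)) / ‖y‖ ^ (n + 2 * σ)) ∧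
    cFrac n σ * ∫ y : En n, (1 - Real.cos (2 * Real.pi * ⟪y, ξ⟫)) / ‖y‖ ^ (n + 2 * σ) =
      (2 * Real.pi * ‖ξ‖) ^ (2 * σ) := by
  have : Nonempty (Fin n) := ⟨⟨0, hn⟩⟩
  rcases eq_or_ne ξ 0 with rfl | hξ
  · simp [Real.zero_rpow (show 2 * σ ≠ 0 by positivity)]
  have hn' : (0 : ℝ) < n := Nat.cast_pos.2 hn
  have hπ := Real.pi_pos
  set d : ℝ := n / 2 + σ with hd
  have hdpos : 0 < d := by positivity
  have hG := Real.Gamma_pos_of_pos hdpos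
  have hb : 0 < Real.pi ^ 2 * ‖ξ‖ ^ 2 := by have := norm_pos_iff.2 hξ; positivity
  have hM := rpow_mul_one_sub_exp_neg_div h0 h1 hb
  have key := integrable_and_integral_eq_of_sections (α := En n) (β := ℝ) (μ := volume)
    (ν := volume.restrict (Ioi (0 : ℝ)))
    (K := fun y t => (1 - Real.cos (2 * Real.pi * ⟪y, ξ⟫)) *
      (t ^ (d - 1) * Real.exp (-(‖y‖ ^ 2 * t))))
    (f := fun y => Real.Gamma d * ((1 - Real.cos (2 * Real.pi * ⟪y, ξ⟫)) / ‖y‖ ^ (n + 2 * σ)))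
    (g := fun t => Real.pi ^ ((n : ℝ) / 2) *
      (t ^ (σ - 1) * (1 - Real.exp (-(Real.pi ^ 2 * ‖ξ‖ ^ 2 / t)))))
    (c := Real.pi ^ ((n : ℝ) / 2) *
      (Real.Gamma (1 - σ) * (Real.pi ^ 2 * ‖ξ‖ ^ 2) ^ σ / σ)) ?_ ?_ ?_ ?_ ?_ ?_
  · constructor
    · have := key.1.const_mul (Real.Gamma d)⁻¹
      simpa [← mul_assoc, inv_mul_cancel₀ hG.ne'] using this
    · have h2 := key.2
      rw [integral_const_mul] at h2
      have hσ : |Real.Gamma (-σ)| = Real.Gamma (1 - σ) / σ := by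
        have := Real.Gamma_add_one (s := -σ) (by linarith)
        rw [show -σ + 1 = 1 - σ by ring] at this
        have hp := Real.Gamma_pos_of_pos (show 0 < 1 - σ by linarith)
        have : Real.Gamma (-σ) = -(Real.Gamma (1 - σ) / σ) := by
          rw [this]; field_simp
        rw [this, abs_neg, abs_of_pos (by positivity)]
      have hp := Real.Gamma_pos_of_pos (show 0 < 1 - σ by linarith)
      have hI : ∫ y : En n, (1 - Real.cos (2 * Real.pi * ⟪y, ξ⟫)) / ‖y‖ ^ (n + 2 * σ) =
          Real.pi ^ ((n : ℝ) / 2) *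
            (Real.Gamma (1 - σ) * (Real.pi ^ 2 * ‖ξ‖ ^ 2) ^ σ / σ) / Real.Gamma d := by
        rw [eq_div_iff hG.ne', mul_comm, h2]
      rw [hI, cFrac, hσ, ← hd]
      have e : (2 * Real.pi * ‖ξ‖) ^ (2 * σ) = 4 ^ σ * (Real.pi ^ 2 * ‖ξ‖ ^ 2) ^ σ := by
        rw [← Real.mul_rpow (by positivity) hb.le, Real.rpow_mul (by positivity)]
        congr 1
        rw [Real.rpow_two]
        ring
      rw [e]
      have : 0 < Real.pi ^ ((n : ℝ) / 2) := by positivity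
      field_simp
  · refine Measurable.aestronglyMeasurable ?_
    unfold Function.uncurry
    fun_prop
  · refine (ae_restrict_iff' measurableSet_Ioi).2 (Eventually.of_forall fun t ht y => ?_)
    have ht' : (0 : ℝ) < t := ht
    exact mul_nonneg (sub_nonneg.2 (Real.cos_le_one _)) (by positivity)
  · filter_upwards [Measure.ae_ne volume (0 : En n)] with y hy
    have hy' := norm_pos_iff.2 hy
    rw [integral_const_mul, integral_rpow_mul_exp_neg_mul hdpos (by positivity),
      ← Real.rpow_natCast, ← Real.rpow_mul hy'.le, hd,
      show ((2 : ℕ) : ℝ) * -((n : ℝ) / 2 + σ) = -(n + 2 * σ) by push_cast; ring,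
      Real.rpow_neg hy'.le]
    ring
  · refine (ae_restrict_iff' measurableSet_Ioi).2 (Eventually.of_forall fun t ht => ?_)
    have ht' : (0 : ℝ) < t := ht
    have e : (fun y : En n => (1 - Real.cos (2 * Real.pi * ⟪y, ξ⟫)) *
        (t ^ (d - 1) * Real.exp (-(‖y‖ ^ 2 * t)))) = fun y : En n => t ^ (d - 1) *
        (Real.exp (-(t * ‖y‖ ^ 2)) - Real.exp (-(t * ‖y‖ ^ 2)) *
          Real.cos (2 * Real.pi * ⟪y, ξ⟫)) := by
      ext y
      rw [mul_comm t]
      ring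
    have hi1 := integrable_gaussian (n := n) ht'
    have hi2 : Integrable fun y : En n => Real.exp (-(t * ‖y‖ ^ 2)) *
        Real.cos (2 * Real.pi * ⟪y, ξ⟫) :=
      hi1.mul_bdd (c := 1) (by fun_prop) (Eventually.of_forall fun y => Real.abs_cos_le_one _)
    rw [e]
    refine ⟨(hi1.sub hi2).const_mul _, ?_⟩
    rw [integral_const_mul, integral_sub hi1 hi2, integral_gaussian_mul_cos ht']
    have h3 := GaussianFourier.integral_rexp_neg_mul_sq_norm (V := En n) ht'
    simp only [neg_mul] at h3
    rw [h3, finrank_euclideanSpace_fin, Real.div_rpow hπ.le ht'.le, hd,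
      show (n : ℝ) / 2 + σ - 1 = (n : ℝ) / 2 + (σ - 1) by ring, Real.rpow_add ht']
    have : 0 < t ^ ((n : ℝ) / 2) := by positivity
    field_simp
  · exact hM.1.const_mul _
  · rw [integral_const_mul, hM.2]

theorem integrable_norm_rpow_mul_norm_schwartz {n : ℕ} (hn : 0 < n) {q : ℝ} (hq : -(n : ℝ) < q)
    (f : SchwartzMap (En n) ℂ) : Integrable (fun ξ : En n => ‖ξ‖ ^ q * ‖f ξ‖) := by
  set C := SchwartzMap.seminorm ℝ 0 0 f
  have hC : ∀ x, ‖f x‖ ≤ C := SchwartzMap.norm_le_seminorm ℝ f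
  have hC0 : 0 ≤ C := (norm_nonneg _).trans (hC 0)
  have h1 := ((integral_norm_rpow_mul_gaussian hn hq one_pos).1).const_mul (C * Real.exp 1)
  have h2 := f.integrable_pow_mul volume ⌈|q|⌉₊
  refine (h1.add h2).mono'
    (Measurable.aestronglyMeasurable (by have := f.continuous.measurable; fun_prop))
    (Eventually.of_forall fun ξ => ?_)
  rw [Real.norm_of_nonneg (by positivity), Pi.add_apply]
  rcases le_total ‖ξ‖ 1 with h | h
  · have e : 1 ≤ Real.exp 1 * Real.exp (-(1 * ‖ξ‖ ^ 2)) := by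
      rw [← Real.exp_add]
      refine Real.one_le_exp ?_
      nlinarith [norm_nonneg ξ]
    have h3 : ‖ξ‖ ^ q * ‖f ξ‖ ≤ ‖ξ‖ ^ q * C := by gcongr; exact hC ξ
    have h4 : ‖ξ‖ ^ q * C * 1 ≤ ‖ξ‖ ^ q * C * (Real.exp 1 * Real.exp (-(1 * ‖ξ‖ ^ 2))) := by gcongr
    have h5 : 0 ≤ ‖ξ‖ ^ ⌈|q|⌉₊ * ‖f ξ‖ := by positivity
    nlinarith
  · have h3 : ‖ξ‖ ^ q ≤ ‖ξ‖ ^ ⌈|q|⌉₊ := by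
      rw [← Real.rpow_natCast]
      exact Real.rpow_le_rpow_of_exponent_le h ((le_abs_self q).trans (Nat.le_ceil _))
    have h4 : ‖ξ‖ ^ q * ‖f ξ‖ ≤ ‖ξ‖ ^ ⌈|q|⌉₊ * ‖f ξ‖ := by gcongr
    have h5 : 0 ≤ C * Real.exp 1 * (‖ξ‖ ^ q * Real.exp (-(1 * ‖ξ‖ ^ 2))) := by positivity
    linarith

/-- The symbol `(2π|ξ|)^p` of `(-Δ)^(p/2)` times a Schwartz function. -/
def symbolMul {n : ℕ} (p : ℝ) (f : SchwartzMap (En n) ℂ) (ξ : En n) : ℂ :=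
  (((2 * Real.pi * ‖ξ‖) ^ p : ℝ) : ℂ) * f ξ

theorem integrable_symbolMul {n : ℕ} (hn : 0 < n) {p : ℝ} (hp : -(n : ℝ) < p)
    (f : SchwartzMap (En n) ℂ) : Integrable (symbolMul p f) := by
  refine ((integrable_norm_rpow_mul_norm_schwartz hn hp f).const_mul ((2 * Real.pi) ^ p)).mono'
    ?_ (Eventually.of_forall fun ξ => ?_)
  · have := f.continuous
    unfold symbolMul
    exact Measurable.aestronglyMeasurable (by fun_prop)
  · have hπ := Real.pi_pos
    rw [symbolMul, norm_mul, Complex.norm_real, Real.norm_of_nonneg (by positivity),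
      Real.mul_rpow (by positivity) (by positivity), mul_assoc]

theorem cFrac_pos {n : ℕ} {σ : ℝ} (h0 : 0 < σ) (h1 : σ < 1) : 0 < cFrac n σ := by
  have h2 := Real.Gamma_pos_of_pos (show 0 < (n : ℝ) / 2 + σ by positivity)
  have h3 : Real.Gamma (-σ) ≠ 0 := by
    refine Real.Gamma_ne_zero fun m hm => ?_
    rcases Nat.eq_zero_or_pos m with rfl | hm'
    · simp at hm; linarith
    · have : (1 : ℝ) ≤ m := by exact_mod_cast hm'
      linarith
  have := abs_pos.2 h3
  have := Real.pi_pos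
  unfold cFrac
  positivity

theorem integrableOn_norm_rpow_neg {n : ℕ} {p ε : ℝ} (hp : (n : ℝ) < p) (hε : 0 < ε) :
    IntegrableOn (fun y : En n => ‖y‖ ^ (-p)) {y : En n | ε ≤ ‖y‖} := by
  have hp0 : 0 < p := (Nat.cast_nonneg n).trans_lt hp
  have h := (integrable_one_add_norm (E := En n) (μ := volume) (r := p)
    (by simpa using hp)).const_mul ((1 + 1 / ε) ^ p)
  refine h.integrableOn.mono' (Measurable.aestronglyMeasurable (by fun_prop)) ?_
  refine (ae_restrict_iff' (measurableSet_le measurable_const measurable_norm)).2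
    (Eventually.of_forall fun y hy => ?_)
  have hy' : ε ≤ ‖y‖ := hy
  have hy0 : 0 < ‖y‖ := hε.trans_le hy'
  rw [Real.norm_of_nonneg (by positivity), Real.rpow_neg hy0.le, Real.rpow_neg (by positivity),
    ← div_eq_mul_inv, inv_eq_one_div, div_le_div_iff₀ (by positivity) (by positivity), one_mul,
    ← Real.mul_rpow (by positivity) hy0.le]
  refine Real.rpow_le_rpow (by positivity) ?_ hp0.le
  have : 1 ≤ 1 / ε * ‖y‖ := by
    rw [one_div, inv_mul_eq_div, le_div_iff₀ hε]; linarith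
  nlinarith

/-- The truncated singular integral in terms of symmetric second differences. -/
theorem truncInt_eq_second_difference {n : ℕ} {σ ε : ℝ} (hσ : 0 < σ) (hε : 0 < ε)
    {w : En n → ℝ} (hw : Continuous w) {C : ℝ} (hC : ∀ x, |w x| ≤ C) (x : En n) :
    truncInt n σ w x ε = ∫ y in {y : En n | ε ≤ ‖y‖},
      (2 * w x - w (x + y) - w (x - y)) / 2 / ‖y‖ ^ (n + 2 * σ) := by
  set F : En n → ℝ := fun y => (w x - w (x + y)) / ‖y‖ ^ (n + 2 * σ) with hF
  set S : Set (En n) := {y : En n | ε ≤ ‖y‖} with hS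
  have hSm : MeasurableSet S := measurableSet_le measurable_const measurable_norm
  have hFi : IntegrableOn F S := by
    refine ((integrableOn_norm_rpow_neg (n := n) (p := n + 2 * σ) (by linarith) hε).const_mul
      (2 * C)).mono' (Measurable.aestronglyMeasurable (by have := hw.measurable; fun_prop)) ?_
    refine Eventually.of_forall fun y => ?_
    rw [hF, Real.norm_eq_abs, abs_div, Real.rpow_neg (norm_nonneg _), ← div_eq_mul_inv,
      abs_of_nonneg (show (0 : ℝ) ≤ ‖y‖ ^ (n + 2 * σ) by positivity)]
    gcongr
    exact (abs_sub _ _).trans (by linarith [hC x, hC (x + y)])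
  have h1 : truncInt n σ w x ε = ∫ y in S, F y := by
    rw [truncInt, ← integral_indicator hSm, ← integral_indicator
      (measurableSet_le measurable_const (by fun_prop)),
      ← integral_add_left_eq_self _ x]
    congr 1 with y
    simp [indicator, hS, hF, dist_eq_norm]
  have hind : ∀ y, S.indicator (fun y => F (-y)) y = S.indicator F (-y) := by
    intro y; simp [indicator, hS]
  have h2 : ∫ y in S, F y = ∫ y in S, F (-y) := by
    rw [← integral_indicator hSm, ← integral_indicator hSm]
    simp_rw [hind]
    rw [integral_neg_eq_self (S.indicator F)]
  have hFi' : IntegrableOn (fun y => F (-y)) S := by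
    rw [← integrable_indicator_iff hSm] at hFi ⊢
    rw [show S.indicator (fun y => F (-y)) = fun y => S.indicator F (-y) from funext hind]
    exact hFi.comp_neg
  have h3 : ∫ y in S, F y = ∫ y in S, (F y + F (-y)) / 2 := by
    rw [integral_div, integral_add hFi hFi', ← h2]; ring
  rw [h1, h3]
  congr 1 with y
  simp only [hF, norm_neg, ← sub_eq_add_neg]
  ring

theorem second_difference_eq_integral {n : ℕ} (f : SchwartzMap (En n) ℂ) (x y : En n) :
    (2 * f x - f (x + y) - f (x - y)) / 2 = ∫ ξ, (1 - Real.cos (2 * Real.pi * ⟪y, ξ⟫) : ℝ) *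
      (Complex.exp (((2 * Real.pi * ⟪ξ, x⟫ : ℝ) : ℂ) * Complex.I) * 𝓕 f ξ) := by
  have inv : ∀ z, f z = ∫ ξ, Complex.exp (((2 * Real.pi * ⟪ξ, z⟫ : ℝ) : ℂ) * Complex.I) * 𝓕 f ξ := by
    intro z
    have h := congrArg (fun g : SchwartzMap (En n) ℂ => g z)
      (FourierTransform.fourierInv_fourier_eq (F := SchwartzMap (En n) ℂ) f)
    simp only [SchwartzMap.fourierInv_coe] at h
    rw [Real.fourierInv_eq'] at h
    exact h.symm
  have hi : ∀ z, Integrable fun ξ => Complex.exp (((2 * Real.pi * ⟪ξ, z⟫ : ℝ) : ℂ) * Complex.I) *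
      𝓕 f ξ := by
    intro z
    refine (𝓕 f).integrable.bdd_mul (c := 1) (by fun_prop) (Eventually.of_forall fun ξ => ?_)
    rw [Complex.norm_exp_ofReal_mul_I]
  rw [inv x, inv (x + y), inv (x - y), ← integral_const_mul, ← integral_sub, ← integral_sub,
    ← integral_div]
  · congr 1 with ξ
    have h1 : (2 * Real.pi * ⟪ξ, x + y⟫ : ℝ) = 2 * Real.pi * ⟪ξ, x⟫ + 2 * Real.pi * ⟪y, ξ⟫ := by
      rw [inner_add_right, real_inner_comm y ξ]; ring
    have h2 : (2 * Real.pi * ⟪ξ, x - y⟫ : ℝ) = 2 * Real.pi * ⟪ξ, x⟫ - 2 * Real.pi * ⟪y, ξ⟫ := by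
      rw [inner_sub_right, real_inner_comm y ξ]; ring
    rw [h1, h2]
    set a := 2 * Real.pi * ⟪ξ, x⟫
    set b := 2 * Real.pi * ⟪y, ξ⟫
    push_cast
    rw [Complex.cos, add_mul, sub_mul, Complex.exp_add, Complex.exp_sub, neg_mul, Complex.exp_neg]
    ring
  · exact ((hi x).const_mul 2).sub (hi _)
  · exact hi _
  · exact (hi x).const_mul 2
  · exact hi _

/-- The singular integral fractional Laplacian of a Schwartz function is the Fourier multiplier
with symbol `(2π|ξ|)^(2σ)`. -/
theorem ofReal_fracLap_eq {n : ℕ} (hn : 0 < n) {σ : ℝ} (h0 : 0 < σ) (h1 : σ < 1) {w : En n → ℝ}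
    (f : SchwartzMap (En n) ℂ) (hf : ∀ x, f x = w x) (x : En n) :
    ((fracLap n σ w x : ℝ) : ℂ) = 𝓕⁻ (symbolMul (2 * σ) (𝓕 f)) x := by
  have hc := cFrac_pos (n := n) h0 h1
  have hw : Continuous w := by
    have : w = fun x => (f x).re := by ext x; simp [hf]
    rw [this]
    have := f.continuous
    fun_prop
  have hC : ∀ x, |w x| ≤ SchwartzMap.seminorm ℝ 0 0 f := by
    intro x
    have := SchwartzMap.norm_le_seminorm ℝ f x
    rwa [hf, Complex.norm_real] at this
  set p : ℝ := n + 2 * σ with hp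
  set E : En n → ℂ := fun ξ => Complex.exp (((2 * Real.pi * ⟪ξ, x⟫ : ℝ) : ℂ) * Complex.I) * 𝓕 f ξ
    with hE
  set k : En n → En n → ℝ := fun y ξ => (1 - Real.cos (2 * Real.pi * ⟪y, ξ⟫)) / ‖y‖ ^ p with hk
  have hk0 : ∀ y ξ, 0 ≤ k y ξ := fun y ξ =>
    div_nonneg (sub_nonneg.2 (Real.cos_le_one _)) (by positivity)
  have hkI : ∀ ξ, ∫ y, k y ξ = (2 * Real.pi * ‖ξ‖) ^ (2 * σ) / cFrac n σ := by
    intro ξ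
    rw [← (integral_one_sub_cos_div hn h0 h1 ξ).2, mul_div_cancel_left₀ _ hc.ne']
  have hEnorm : ∀ ξ, ‖E ξ‖ = ‖𝓕 f ξ‖ := by
    intro ξ
    rw [hE, norm_mul, Complex.norm_exp_ofReal_mul_I, one_mul]
  have hsym := integrable_symbolMul hn (p := 2 * σ)
    (by have : (0 : ℝ) < n := by exact_mod_cast hn
        linarith) (𝓕 f)
  have hInt : Integrable (fun q : En n × En n => (k q.1 q.2 : ℂ) * E q.2)
      ((volume : Measure (En n)).prod volume) := by
    refine (integrable_prod_iff' ?_).2 ⟨Eventually.of_forall fun ξ => ?_, ?_⟩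
    · have := (𝓕 f).continuous.measurable
      refine Measurable.aestronglyMeasurable ?_
      simp only [hk, hE]
      fun_prop
    · have h : Integrable fun y => (k y ξ : ℂ) := (integral_one_sub_cos_div hn h0 h1 ξ).1.ofReal
      exact h.mul_const (E ξ)
    · refine (hsym.norm.div_const (cFrac n σ)).congr (Eventually.of_forall fun ξ => ?_)
      simp only [norm_mul, hEnorm, Complex.norm_real]
      rw [integral_mul_const, integral_congr_ae
        (Eventually.of_forall fun y => Real.norm_of_nonneg (hk0 y ξ)), hkI, symbolMul, norm_mul,
        Complex.norm_real, Real.norm_of_nonneg (by have := Real.pi_pos; positivity)]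
      ring
  set G : En n → ℝ := fun y => (2 * w x - w (x + y) - w (x - y)) / 2 / ‖y‖ ^ p with hG
  have hGk : ∀ y, (G y : ℂ) = ∫ ξ, (k y ξ : ℂ) * E ξ := by
    intro y
    have := second_difference_eq_integral f x y
    simp only [hf] at this
    simp only [hG, hk, hE]
    push_cast at this ⊢
    rw [this, ← integral_div]
    congr 1 with ξ
    ring
  have hGi : Integrable G := by
    have h := hInt.integral_prod_left
    refine (Complex.reCLM.integrable_comp h).congr (Eventually.of_forall fun y => ?_)
    simp only [← hGk]
    simp
  have hGint : ((∫ y, G y : ℝ) : ℂ) = 𝓕⁻ (symbolMul (2 * σ) (𝓕 f)) x / cFrac n σ := by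
    rw [← integral_complex_ofReal]
    simp_rw [hGk]
    rw [integral_integral_swap hInt, Real.fourierInv_eq', ← integral_div]
    congr 1 with ξ
    rw [integral_mul_const, integral_complex_ofReal, hkI, symbolMul, hE, smul_eq_mul]
    push_cast
    ring
  have hlim : Tendsto (truncInt n σ w x) (nhdsWithin 0 (Ioi 0)) (nhds (∫ y, G y)) := by
    have h2 : Tendsto (fun ε : ℝ => ∫ y, {y : En n | ε ≤ ‖y‖}.indicator G y)
        (nhdsWithin 0 (Ioi 0)) (nhds (∫ y, G y)) := by
      refine tendsto_integral_filter_of_dominated_convergence (fun y => ‖G y‖)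
        (Eventually.of_forall fun ε => ?_) (Eventually.of_forall fun ε => ?_) hGi.norm
        (Eventually.of_forall fun y => ?_)
      · exact hGi.aestronglyMeasurable.indicator (measurableSet_le measurable_const measurable_norm)
      · exact Eventually.of_forall fun y => norm_indicator_le_norm_self _ _
      · rcases eq_or_ne y 0 with rfl | hy
        · have : G 0 = 0 := by simp [hG]; left; ring
          simp [indicator, this]
        · refine tendsto_const_nhds.congr' ?_
          have : ∀ᶠ ε : ℝ in nhdsWithin 0 (Ioi 0), ε ≤ ‖y‖ :=
            nhdsWithin_le_nhds (eventually_le_nhds (norm_pos_iff.2 hy))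
          filter_upwards [this] with ε hε
          rw [indicator_of_mem (by exact hε)]
    refine h2.congr' ?_
    filter_upwards [self_mem_nhdsWithin] with ε hε
    rw [truncInt_eq_second_difference h0 hε hw hC,
      integral_indicator (measurableSet_le measurable_const measurable_norm)]
  rw [fracLap, hlim.limUnder_eq, Complex.ofReal_mul, hGint, mul_div_cancel₀]
  exact_mod_cast hc.ne'

theorem integral_fourierInv_mul_eq {n : ℕ} {h g : En n → ℂ} (hh : Integrable h)
    (hg : Integrable g) : ∫ x, 𝓕⁻ h x * g x = ∫ ξ, h ξ * 𝓕⁻ g ξ := by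
  have := VectorFourier.integral_fourierIntegral_smul_eq_flip (e := Real.fourierChar)
    (L := -innerₗ (En n)) (μ := volume) (ν := volume) (f := h) (g := g)
    Real.continuous_fourierChar (by simp only [LinearMap.neg_apply, innerₗ_apply_apply]; fun_prop)
    hh hg
  have hflip : (-innerₗ (En n)).flip = -innerₗ (En n) := by
    ext x y
    simp [real_inner_comm]
  rw [hflip] at this
  exact this

theorem continuous_fourierInv {n : ℕ} {h : En n → ℂ} (hh : Integrable h) :
    Continuous (𝓕⁻ h) :=
  VectorFourier.fourierIntegral_continuous (L := -innerₗ (En n)) Real.continuous_fourierChar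
    (by simp only [LinearMap.neg_apply, innerₗ_apply_apply]; fun_prop) hh

theorem norm_fourierInv_le {n : ℕ} (h : En n → ℂ) (x : En n) : ‖𝓕⁻ h x‖ ≤ ∫ ξ, ‖h ξ‖ :=
  VectorFourier.norm_fourierIntegral_le_integral_norm _ _ _ _ _

theorem L2_norm_sq {n : ℕ} (G : Lp ℂ 2 (volume : Measure (En n))) : ‖G‖ ^ 2 = ∫ x, ‖G x‖ ^ 2 := by
  have h := L2.inner_def (𝕜 := ℂ) G G
  simp_rw [inner_self_eq_norm_sq_to_K] at h
  apply Complex.ofReal_injective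
  rw [← integral_complex_ofReal]
  simpa using h

/-- Plancherel's theorem for `L¹ ∩ L²` functions. -/
theorem integral_norm_sq_fourierInv {n : ℕ} {h : En n → ℂ} (hh : Integrable h)
    (hh2 : MemLp h 2 volume) : ∫ x, ‖𝓕⁻ h x‖ ^ 2 = ∫ ξ, ‖h ξ‖ ^ 2 := by
  set H : Lp ℂ 2 (volume : Measure (En n)) := MemLp.toLp h hh2 with hH
  obtain ⟨G, hG⟩ : ∃ G : Lp ℂ 2 (volume : Measure (En n)), G = 𝓕⁻ H := ⟨_, rfl⟩
  have hHh : H =ᵐ[volume] h := MemLp.coeFn_toLp hh2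
  have hae : ∀ᵐ x, 𝓕⁻ h x = G x := by
    refine ae_eq_of_integral_contDiff_smul_eq (continuous_fourierInv hh).locallyIntegrable
      ((Lp.memLp G).locallyIntegrable one_le_two) fun g hg hgc => ?_
    have hg₁ : HasCompactSupport (Complex.ofRealCLM ∘ g) := hgc.comp_left rfl
    have hg₂ : ContDiff ℝ (⊤ : ℕ∞) (Complex.ofRealCLM ∘ g) := by fun_prop
    set ψ : SchwartzMap (En n) ℂ := hg₁.toSchwartzMap hg₂ with hψ
    have hψx : ∀ x, ψ x = (g x : ℂ) := fun x => rfl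
    have h1 := congrArg (fun T : TemperedDistribution (En n) ℂ => T ψ)
      (Lp.fourierInv_toTemperedDistribution_eq H)
    simp only [TemperedDistribution.fourierInv_apply, Lp.toTemperedDistribution_apply] at h1
    have h2 := integral_fourierInv_mul_eq hh ψ.integrable
    calc ∫ x, g x • 𝓕⁻ h x = ∫ x, 𝓕⁻ h x * ψ x := by
          congr 1 with x
          rw [hψx, Complex.real_smul, mul_comm]
      _ = ∫ x, 𝓕⁻ ψ x • H x := by
          rw [h2]
          refine integral_congr_ae ?_
          filter_upwards [hHh] with x hx
          rw [hx, smul_eq_mul, mul_comm, SchwartzMap.fourierInv_coe]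
      _ = ∫ x, g x • G x := by
          rw [h1, ← hG]
          congr 1 with x
  have h3 : ‖G‖ = ‖H‖ := by
    rw [← Lp.norm_fourier_eq G, hG, FourierTransform.fourier_fourierInv_eq]
  calc ∫ x, ‖𝓕⁻ h x‖ ^ 2 = ∫ x, ‖G x‖ ^ 2 := by
        refine integral_congr_ae ?_
        filter_upwards [hae] with x hx
        rw [hx]
    _ = ∫ x, ‖H x‖ ^ 2 := by rw [← L2_norm_sq, ← L2_norm_sq, h3]
    _ = _ := by
        refine integral_congr_ae ?_
        filter_upwards [hHh] with x hx
        rw [hx]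

/-- The homogeneous Sobolev energy `∫ (2π|ξ|)^p |f(ξ)|²` on the Fourier side. -/
def energy {n : ℕ} (p : ℝ) (f : SchwartzMap (En n) ℂ) : ℝ :=
  ∫ ξ, (2 * Real.pi * ‖ξ‖) ^ p * ‖f ξ‖ ^ 2

theorem integrable_energy {n : ℕ} (hn : 0 < n) {p : ℝ} (hp : -(n : ℝ) < p)
    (f : SchwartzMap (En n) ℂ) :
    Integrable fun ξ => (2 * Real.pi * ‖ξ‖) ^ p * ‖f ξ‖ ^ 2 := by
  set C := SchwartzMap.seminorm ℝ 0 0 f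
  have hC : ∀ x, ‖f x‖ ≤ C := SchwartzMap.norm_le_seminorm ℝ f
  refine ((integrable_symbolMul hn hp f).norm.mul_const C).mono'
    (Measurable.aestronglyMeasurable (by have := f.continuous.measurable; fun_prop))
    (Eventually.of_forall fun ξ => ?_)
  have := Real.pi_pos
  rw [Real.norm_of_nonneg (by positivity), symbolMul, norm_mul, Complex.norm_real,
    Real.norm_of_nonneg (by positivity), sq, ← mul_assoc]
  gcongr
  exact hC ξ

/-- Plancherel's theorem for the fractional Laplacian. -/
theorem integral_fracLap_sq {n : ℕ} (hn : 0 < n) {s : ℝ} (h0 : 0 < s) (h1 : s < 2)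
    {w : En n → ℝ} (f : SchwartzMap (En n) ℂ) (hf : ∀ x, f x = w x) :
    ∫ x, fracLap n (s / 2) w x ^ 2 = energy (2 * s) (𝓕 f) := by
  have hn' : (0 : ℝ) < n := by exact_mod_cast hn
  have hπ := Real.pi_pos
  have hsq : ∀ ξ, ‖symbolMul s (𝓕 f) ξ‖ ^ 2 = (2 * Real.pi * ‖ξ‖) ^ (2 * s) * ‖𝓕 f ξ‖ ^ 2 := by
    intro ξ
    rw [symbolMul, norm_mul, Complex.norm_real, Real.norm_of_nonneg (by positivity), mul_pow,
      ← Real.rpow_natCast (_ ^ s), ← Real.rpow_mul (by positivity)]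
    congr 2
    push_cast
    ring
  have hi := integrable_symbolMul hn (p := s) (by linarith) (𝓕 f)
  have hi2 : MemLp (symbolMul s (𝓕 f)) 2 := by
    rw [memLp_two_iff_integrable_sq_norm hi.aestronglyMeasurable]
    simp_rw [hsq]
    exact integrable_energy hn (by linarith) _
  have h := integral_norm_sq_fourierInv hi hi2
  simp_rw [hsq] at h
  rw [energy, ← h]
  congr 1 with x
  have := ofReal_fracLap_eq hn (σ := s / 2) (by linarith) (by linarith) f hf x
  rw [show 2 * (s / 2) = s by ring] at this
  rw [← this, Complex.norm_real, Real.norm_eq_abs, sq_abs]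

/-- The radial profile of a standard smooth cutoff function. -/
def bumpProfile (r : ℝ) : ℝ := Real.smoothTransition (2 - r ^ 2)

theorem bumpProfile_nonneg (r : ℝ) : 0 ≤ bumpProfile r := Real.smoothTransition.nonneg _

theorem bumpProfile_le_one (r : ℝ) : bumpProfile r ≤ 1 := Real.smoothTransition.le_one _

theorem bumpProfile_eq_one {r : ℝ} (h : |r| ≤ 1) : bumpProfile r = 1 :=
  Real.smoothTransition.one_of_one_le (by nlinarith [sq_abs r, abs_nonneg r])

theorem contDiff_bumpProfile_norm {n : ℕ} :
    ContDiff ℝ (⊤ : ℕ∞) fun x : En n => bumpProfile ‖x‖ :=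
  Real.smoothTransition.contDiff.comp (contDiff_const.sub (contDiff_norm_sq ℝ))

theorem hasCompactSupport_bumpProfile_norm {n : ℕ} :
    HasCompactSupport fun x : En n => bumpProfile ‖x‖ := by
  refine HasCompactSupport.intro (isCompact_closedBall (0 : En n) 2) fun x hx => ?_
  rw [mem_closedBall_zero_iff, not_le] at hx
  exact Real.smoothTransition.zero_of_nonpos (by nlinarith)

theorem exists_bound_iteratedFDeriv_bump (n i : ℕ) : ∃ C : ℝ, 0 ≤ C ∧ ∀ ε : ℝ, 0 ≤ ε → ε ≤ 1 →
    ∀ x : En n, ‖iteratedFDeriv ℝ i (fun x : En n => bumpProfile ‖ε • x‖) x‖ ≤ C := by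
  obtain ⟨C, hC⟩ := (hasCompactSupport_bumpProfile_norm (n := n)).iteratedFDeriv (𝕜 := ℝ) i
    |>.exists_bound_of_continuous (contDiff_bumpProfile_norm.continuous_iteratedFDeriv
      (m := i) (by exact_mod_cast le_top))
  refine ⟨C, (norm_nonneg _).trans (hC 0), fun ε h0 h1 x => ?_⟩
  set L : En n →L[ℝ] En n := ε • ContinuousLinearMap.id ℝ (En n) with hL
  have hLn : ‖L‖ ≤ 1 := by
    rw [hL, norm_smul, Real.norm_of_nonneg h0]
    exact mul_le_one₀ h1 (norm_nonneg _) ContinuousLinearMap.norm_id_le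
  have h := L.iteratedFDeriv_comp_right (contDiff_bumpProfile_norm (n := n)) x (i := i)
    (by exact_mod_cast le_top)
  change ‖iteratedFDeriv ℝ i ((fun x : En n => bumpProfile ‖x‖) ∘ L) x‖ ≤ C
  rw [h]
  refine (ContinuousMultilinearMap.norm_compContinuousLinearMap_le _ _).trans ?_
  refine (mul_le_of_le_one_right (norm_nonneg _) ?_).trans (hC _)
  exact Finset.prod_le_one (fun _ _ => norm_nonneg _) fun _ _ => hLn

theorem exists_seminorm_bound_cutoff {n : ℕ} (f : SchwartzMap (En n) ℂ) (k l : ℕ) :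
    ∃ C : ℝ, 0 ≤ C ∧ ∀ ε : ℝ, 0 ≤ ε → ε ≤ 1 → ∀ F : SchwartzMap (En n) ℂ,
      (∀ x, F x = bumpProfile ‖ε • x‖ • f x) → SchwartzMap.seminorm ℂ k l F ≤ C := by
  choose D hD0 hD using exists_bound_iteratedFDeriv_bump n
  have hC0 : 0 ≤ ∑ i ∈ Finset.range (l + 1), (l.choose i : ℝ) * D i *
      SchwartzMap.seminorm ℂ k (l - i) f :=
    Finset.sum_nonneg fun i _ => mul_nonneg (mul_nonneg (by positivity) (hD0 i)) (apply_nonneg _ _)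
  refine ⟨∑ i ∈ Finset.range (l + 1), (l.choose i : ℝ) * D i *
    SchwartzMap.seminorm ℂ k (l - i) f, hC0, fun ε h0 h1 F hF => ?_⟩
  refine SchwartzMap.seminorm_le_bound ℂ k l F hC0 fun x => ?_
  have hb : ContDiff ℝ (⊤ : ℕ∞) fun x : En n => bumpProfile ‖ε • x‖ :=
    contDiff_bumpProfile_norm.comp (contDiff_id.const_smul ε)
  have h := norm_iteratedFDeriv_smul_le hb (f.smooth ⊤) x (n := l) (by exact_mod_cast le_top)
  rw [show (F : En n → ℂ) = fun x => bumpProfile ‖ε • x‖ • f x from funext hF]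
  refine (mul_le_mul_of_nonneg_left h (by positivity)).trans ?_
  rw [Finset.mul_sum]
  refine Finset.sum_le_sum fun i _ => ?_
  have h2 := SchwartzMap.le_seminorm ℂ k (l - i) f x
  calc _ = (l.choose i : ℝ) * ‖iteratedFDeriv ℝ i (fun x : En n => bumpProfile ‖ε • x‖) x‖ *
        (‖x‖ ^ k * ‖iteratedFDeriv ℝ (l - i) f x‖) := by ring
    _ ≤ _ := by
        have := hD0 i
        gcongr
        exact hD i ε h0 h1 x

theorem exists_seminorm_bound_fourier_cutoff {n : ℕ} (f : SchwartzMap (En n) ℂ) (k l : ℕ) :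
    ∃ C : ℝ, 0 ≤ C ∧ ∀ ε : ℝ, 0 ≤ ε → ε ≤ 1 → ∀ F : SchwartzMap (En n) ℂ,
      (∀ x, F x = bumpProfile ‖ε • x‖ • f x) → SchwartzMap.seminorm ℂ k l (𝓕 F) ≤ C := by
  have hW := schwartz_withSeminorms ℂ (En n) ℂ
  set T := FourierTransform.fourierCLM ℂ (SchwartzMap (En n) ℂ)
  set q := (SchwartzMap.seminorm ℂ k l : Seminorm ℂ (SchwartzMap (En n) ℂ)).comp T.toLinearMap
  have hq : Continuous q := (hW.continuous_seminorm (k, l)).comp T.continuous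
  obtain ⟨t, C, -, hC⟩ := Seminorm.bound_of_continuous hW q hq
  choose M hM0 hM using fun p : ℕ × ℕ => exists_seminorm_bound_cutoff f p.1 p.2
  have hS : 0 ≤ ∑ p ∈ t, M p := Finset.sum_nonneg fun p _ => hM0 p
  refine ⟨C * ∑ p ∈ t, M p, by positivity, fun ε h0 h1 F hF => (hC F).trans ?_⟩
  change (C : ℝ) * (t.sup (schwartzSeminormFamily ℂ (En n) ℂ)) F ≤ _
  gcongr
  refine Seminorm.finset_sup_apply_le hS fun p hp => ?_
  exact (hM p ε h0 h1 F hF).trans (Finset.single_le_sum (fun p _ => hM0 p) hp)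

theorem exists_decay_fourier_cutoff {n : ℕ} (f : SchwartzMap (En n) ℂ) (N : ℕ) :
    ∃ C : ℝ, 0 ≤ C ∧ ∀ ε : ℝ, 0 ≤ ε → ε ≤ 1 → ∀ F : SchwartzMap (En n) ℂ,
      (∀ x, F x = bumpProfile ‖ε • x‖ • f x) → ∀ ξ, (1 + ‖ξ‖) ^ N * ‖𝓕 F ξ‖ ≤ C := by
  obtain ⟨A, hA0, hA⟩ := exists_seminorm_bound_fourier_cutoff f 0 0
  obtain ⟨B, hB0, hB⟩ := exists_seminorm_bound_fourier_cutoff f N 0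
  refine ⟨2 ^ (N - 1) * (A + B), by positivity, fun ε h0 h1 F hF ξ => ?_⟩
  have h2 := (SchwartzMap.norm_le_seminorm ℂ (𝓕 F) ξ).trans (hA ε h0 h1 F hF)
  have h3 := (SchwartzMap.norm_pow_mul_le_seminorm ℂ (𝓕 F) N ξ).trans (hB ε h0 h1 F hF)
  calc (1 + ‖ξ‖) ^ N * ‖𝓕 F ξ‖ ≤ (2 ^ (N - 1) * (1 ^ N + ‖ξ‖ ^ N)) * ‖𝓕 F ξ‖ := by
        gcongr
        exact add_pow_le zero_le_one (norm_nonneg _) N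
    _ = 2 ^ (N - 1) * (‖𝓕 F ξ‖ + ‖ξ‖ ^ N * ‖𝓕 F ξ‖) := by ring
    _ ≤ _ := by gcongr

theorem hardy_extend {n : ℕ} (hn : 0 < n) {s B : ℝ} (h0 : 0 < s) (h2 : s < 2)
    (hsn : 2 * s < n)
    (H : ∀ W : ℝ → ℝ, TestOn n Set.univ (fun x => W ‖x‖) →
      B * ∫ x : En n, ‖x‖ ^ (-(2 * s)) * W ‖x‖ ^ 2 ≤
        ∫ x : En n, fracLap n (s / 2) (fun x => W ‖x‖) x ^ 2)
    {W : ℝ → ℝ} (f : SchwartzMap (En n) ℂ) (hf : ∀ x, f x = (W ‖x‖ : ℝ)) :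
    B * ∫ x : En n, ‖x‖ ^ (-(2 * s)) * W ‖x‖ ^ 2 ≤ energy (2 * s) (𝓕 f) := by
  have hπ := Real.pi_pos
  set ε : ℕ → ℝ := fun k => 1 / ((k : ℝ) + 1) with hε
  have hε0 : ∀ k, 0 ≤ ε k := fun k => by positivity
  have hε1 : ∀ k, ε k ≤ 1 := fun k => by
    rw [hε, div_le_one (by positivity)]
    exact le_add_of_nonneg_left (by positivity)
  have hεt : Tendsto ε atTop (nhds 0) := tendsto_one_div_add_atTop_nhds_zero_nat
  have hcut : ∀ x : En n, ∀ᶠ k in atTop, bumpProfile ‖ε k • x‖ = 1 := fun x => by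
    have h := (hεt.smul_const x).norm
    rw [zero_smul, norm_zero] at h
    filter_upwards [h.eventually_le_const one_pos] with k hk
    exact bumpProfile_eq_one (by rwa [abs_norm])
  have hW : ContDiff ℝ (⊤ : ℕ∞) fun x : En n => W ‖x‖ := by
    have := Complex.reCLM.contDiff.comp (f.smooth ⊤)
    exact (funext fun x => by simp [hf] : Complex.reCLM ∘ f = fun x : En n => W ‖x‖) ▸ this
  set V : ℕ → ℝ → ℝ := fun k r => bumpProfile (ε k * r) * W r with hV
  have hVx : ∀ k (x : En n), V k ‖x‖ = bumpProfile ‖ε k • x‖ * W ‖x‖ := fun k x => by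
    simp only [hV, norm_smul, Real.norm_of_nonneg (hε0 k)]
  have hT : ∀ k, TestOn n Set.univ fun x => V k ‖x‖ := fun k => by
    have hp : 0 < ε k := by positivity
    simp_rw [hVx]
    refine ⟨(contDiff_bumpProfile_norm.comp (contDiff_id.const_smul (ε k))).mul hW, ?_,
      subset_univ _⟩
    exact (hasCompactSupport_bumpProfile_norm.comp_smul hp.ne').mul_right
  have hF : ∀ k, ∃ F : SchwartzMap (En n) ℂ, ∀ x, F x = ((V k ‖x‖ : ℝ) : ℂ) := fun k => by
    have hg₁ : HasCompactSupport (Complex.ofRealCLM ∘ fun x : En n => V k ‖x‖) :=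
      (hT k).2.1.comp_left rfl
    have hg₂ : ContDiff ℝ (⊤ : ℕ∞) (Complex.ofRealCLM ∘ fun x : En n => V k ‖x‖) :=
      Complex.ofRealCLM.contDiff.comp (hT k).1
    exact ⟨hg₁.toSchwartzMap hg₂, fun x => rfl⟩
  choose F hF using hF
  have hFf : ∀ k x, F k x = bumpProfile ‖ε k • x‖ • f x := fun k x => by
    rw [hF, hVx, hf, Complex.real_smul, Complex.ofReal_mul]
  have hb : ∀ r, |bumpProfile r| ≤ 1 := fun r => by
    rw [abs_of_nonneg (bumpProfile_nonneg r)]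
    exact bumpProfile_le_one r
  have hFt : ∀ ξ, Tendsto (fun k => 𝓕 (F k) ξ) atTop (nhds (𝓕 f ξ)) := fun ξ => by
    simp_rw [SchwartzMap.fourier_coe, Real.fourier_eq]
    refine tendsto_integral_of_dominated_convergence (fun x => ‖f x‖) (fun k => ?_)
      f.integrable.norm (fun k => Eventually.of_forall fun x => ?_)
      (Eventually.of_forall fun x => ?_)
    · have := (F k).continuous
      exact Continuous.aestronglyMeasurable (by fun_prop)
    · rw [Circle.norm_smul, hFf, norm_smul]
      exact mul_le_of_le_one_left (norm_nonneg _) (hb _)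
    · refine tendsto_const_nhds.congr' ?_
      filter_upwards [hcut x] with k hk
      rw [hFf, hk, one_smul]
  have hE : Tendsto (fun k => energy (2 * s) (𝓕 (F k))) atTop (nhds (energy (2 * s) (𝓕 f))) := by
    obtain ⟨C, hC0, hC⟩ := exists_decay_fourier_cutoff f (n + 4)
    have hdom := (integrable_one_add_norm (E := En n) (μ := volume) (r := n + 1)
      (by simp)).const_mul ((2 * Real.pi) ^ (2 * s) * C ^ 2)
    refine tendsto_integral_of_dominated_convergence _ (fun k => ?_) hdom
      (fun k => Eventually.of_forall fun ξ => ?_) (Eventually.of_forall fun ξ => ?_)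
    · exact (integrable_energy hn (by linarith) _).aestronglyMeasurable
    · have h := hC (ε k) (hε0 k) (hε1 k) (F k) (hFf k) ξ
      have hr : 0 ≤ ‖ξ‖ := norm_nonneg ξ
      have h3 : ‖𝓕 (F k) ξ‖ ≤ C * (1 + ‖ξ‖) ^ (-((n : ℝ) + 4)) := by
        rw [Real.rpow_neg (by positivity), ← div_eq_mul_inv, le_div_iff₀ (by positivity), mul_comm]
        exact_mod_cast h
      rw [Real.norm_of_nonneg (by positivity)]
      calc (2 * Real.pi * ‖ξ‖) ^ (2 * s) * ‖𝓕 (F k) ξ‖ ^ 2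
          ≤ ((2 * Real.pi) ^ (2 * s) * (1 + ‖ξ‖) ^ (2 * s)) *
            (C * (1 + ‖ξ‖) ^ (-((n : ℝ) + 4))) ^ 2 := by
            rw [Real.mul_rpow (by positivity) hr]
            gcongr
            linarith
        _ = (2 * Real.pi) ^ (2 * s) * C ^ 2 * (1 + ‖ξ‖) ^ (2 * s - 2 * ((n : ℝ) + 4)) := by
            rw [sub_eq_add_neg, Real.rpow_add (by positivity), mul_pow, ← Real.rpow_natCast
              (_ ^ (-((n : ℝ) + 4))), ← Real.rpow_mul (by positivity)]
            ring_nf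
        _ ≤ _ := by
            gcongr
            · linarith
            · linarith
    · exact ((hFt ξ).norm.pow 2).const_mul _
  have hI : Tendsto (fun k => ∫ x : En n, ‖x‖ ^ (-(2 * s)) * V k ‖x‖ ^ 2) atTop
      (nhds (∫ x : En n, ‖x‖ ^ (-(2 * s)) * W ‖x‖ ^ 2)) := by
    have hfW : ∀ x, ‖f x‖ = |W ‖x‖| := fun x => by rw [hf, Complex.norm_real, Real.norm_eq_abs]
    have hdom := (integrable_norm_rpow_mul_norm_schwartz hn (q := -(2 * s)) (by linarith) f).mul_const
      (SchwartzMap.seminorm ℝ 0 0 f)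
    refine tendsto_integral_of_dominated_convergence _ (fun k => ?_) hdom
      (fun k => Eventually.of_forall fun x => ?_) (Eventually.of_forall fun x => ?_)
    · have hm := (hT k).1.continuous.measurable
      exact (((measurable_norm.pow_const _).mul (hm.pow_const 2))).aestronglyMeasurable
    · have h := SchwartzMap.norm_le_seminorm ℝ f x
      rw [hfW] at h ⊢
      rw [hVx, norm_mul, norm_pow, norm_mul, Real.norm_of_nonneg (by positivity), Real.norm_eq_abs,
        Real.norm_eq_abs, sq, ← mul_assoc]
      have h1 : |bumpProfile ‖ε k • x‖| * |W ‖x‖| ≤ |W ‖x‖| :=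
        mul_le_of_le_one_left (abs_nonneg _) (hb _)
      exact mul_le_mul (mul_le_mul_of_nonneg_left h1 (by positivity)) (h1.trans h)
        (by positivity) (by positivity)
    · refine tendsto_const_nhds.congr' ?_
      filter_upwards [hcut x] with k hk
      rw [hVx, hk, one_mul]
  refine le_of_tendsto_of_tendsto' (hI.const_mul B) hE fun k => ?_
  have h := H (V k) (hT k)
  rwa [integral_fracLap_sq hn h0 h2 (F k) (hF k)] at h

theorem exists_bound_one_add_pow_mul_exp {b : ℝ} (hb : 0 < b) (N : ℕ) :
    ∃ C : ℝ, ∀ r : ℝ, 0 ≤ r → (1 + r) ^ N * Real.exp (-(b * r ^ 2)) ≤ C := by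
  refine ⟨N.factorial * Real.exp (1 + 1 / (4 * b)), fun r hr => ?_⟩
  have h := Real.pow_div_factorial_le_exp (1 + r) (by linarith) N
  rw [div_le_iff₀ (by positivity)] at h
  calc (1 + r) ^ N * Real.exp (-(b * r ^ 2))
      ≤ (Real.exp (1 + r) * N.factorial) * Real.exp (-(b * r ^ 2)) := by gcongr
    _ = N.factorial * Real.exp (1 + r + -(b * r ^ 2)) := by rw [Real.exp_add _ (-_)]; ring
    _ ≤ _ := by
        gcongr ?_ * Real.exp ?_
        have : 1 / (4 * b) - r + b * r ^ 2 = (2 * b * r - 1) ^ 2 / (4 * b) := by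
          field_simp
          ring
        have : 0 ≤ (2 * b * r - 1) ^ 2 / (4 * b) := by positivity
        linarith

theorem exists_gaussian_schwartz {n : ℕ} {b : ℝ} (hb : 0 < b) :
    ∃ f : SchwartzMap (En n) ℂ, ∀ x, f x = ((Real.exp (-(b * ‖x‖ ^ 2)) : ℝ) : ℂ) := by
  set q : En n → ℝ := fun x => -(b * ‖x‖ ^ 2) with hq
  have hqs : ContDiff ℝ (⊤ : ℕ∞) q := (contDiff_const.mul (contDiff_norm_sq ℝ)).neg
  have hqt : Function.HasTemperateGrowth q :=
    ((Function.HasTemperateGrowth.const b).mul (Function.hasTemperateGrowth_norm_sq _)).neg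
  have hE : ContDiff ℝ (⊤ : ℕ∞) (Real.exp ∘ q) := Real.contDiff_exp.comp hqs
  refine ⟨⟨fun x => Complex.ofRealLI ((Real.exp ∘ q) x),
    Complex.ofRealCLM.contDiff.comp hE, fun k l => ?_⟩, fun x => rfl⟩
  obtain ⟨m, C, hC0, hC⟩ := hqt.norm_iteratedFDeriv_le_uniform l
  obtain ⟨M, hM⟩ := exists_bound_one_add_pow_mul_exp hb (k + m * l)
  refine ⟨l.factorial * (1 + C) ^ l * M, fun x => ?_⟩
  have hx := norm_nonneg x
  have h1 : 1 ≤ (1 + ‖x‖) ^ m := one_le_pow₀ (by linarith)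
  have hD : 1 ≤ (1 + C) * (1 + ‖x‖) ^ m := one_le_mul_of_one_le_of_one_le (by linarith) h1
  have h := norm_iteratedFDeriv_comp_le (𝕜 := ℝ) (n := l) Real.contDiff_exp hqs
    (by exact_mod_cast le_top) x (C := Real.exp (q x)) (D := (1 + C) * (1 + ‖x‖) ^ m)
    (fun i _ => by
      rw [norm_iteratedFDeriv_eq_norm_iteratedDeriv, iteratedDeriv_eq_iterate,
        Real.iter_deriv_exp, Real.norm_of_nonneg (Real.exp_nonneg _)])
    (fun i hi hil => by
      refine (hC i hil x).trans ((?_ : _ ≤ (1 + C) * (1 + ‖x‖) ^ m).trans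
        (le_self_pow₀ hD (by omega)))
      gcongr
      linarith)
  have h' := Complex.ofRealLI.norm_iteratedFDeriv_comp_left (f := Real.exp ∘ q) (x := x)
    (n := (⊤ : ℕ∞)) (i := l) hE.contDiffAt (by exact_mod_cast le_top)
  change ‖x‖ ^ k * ‖iteratedFDeriv ℝ l (Complex.ofRealLI ∘ (Real.exp ∘ q)) x‖ ≤ _
  rw [h']
  calc ‖x‖ ^ k * ‖iteratedFDeriv ℝ l (Real.exp ∘ q) x‖
      ≤ (1 + ‖x‖) ^ k * (l.factorial * Real.exp (q x) * ((1 + C) * (1 + ‖x‖) ^ m) ^ l) := by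
        gcongr
        linarith
    _ = l.factorial * (1 + C) ^ l * ((1 + ‖x‖) ^ (k + m * l) * Real.exp (-(b * ‖x‖ ^ 2))) := by
        rw [mul_pow, ← pow_mul, pow_add, hq]
        ring
    _ ≤ _ := by
        gcongr
        exact hM _ hx

theorem integral_norm_rpow_mul_gaussian_sum_sq {n : ℕ} (hn : 0 < n) {c q : ℝ} (hc : 0 < c)
    (hq : q = 4 * c - n) {N : ℕ} (v : Fin N → ℝ) :
    ∫ x : En n, ‖x‖ ^ q *
        (∑ i, Real.exp (c * v i) * Real.exp (-(Real.pi * Real.exp (v i) * ‖x‖ ^ 2))) ^ 2 =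
      halfSphere n * Real.Gamma (2 * c) * Real.pi ^ (-(2 * c)) *
        ∑ i, ∑ j, coshKernel c (v i - v j) := by
  have hπ := Real.pi_pos
  have hG := fun i j => integral_norm_rpow_mul_gaussian hn (p := q)
    (b := Real.pi * (Real.exp (v i) + Real.exp (v j))) (by linarith) (by positivity)
  have e : ∀ x : En n, ‖x‖ ^ q *
        (∑ i, Real.exp (c * v i) * Real.exp (-(Real.pi * Real.exp (v i) * ‖x‖ ^ 2))) ^ 2 =
      ∑ i, ∑ j, Real.exp (c * (v i + v j)) * (‖x‖ ^ q *
        Real.exp (-(Real.pi * (Real.exp (v i) + Real.exp (v j)) * ‖x‖ ^ 2))) := by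
    intro x
    rw [sq, Finset.sum_mul_sum, Finset.mul_sum]
    refine Finset.sum_congr rfl fun i _ => ?_
    rw [Finset.mul_sum]
    refine Finset.sum_congr rfl fun j _ => ?_
    rw [show -(Real.pi * (Real.exp (v i) + Real.exp (v j)) * ‖x‖ ^ 2) =
      -(Real.pi * Real.exp (v i) * ‖x‖ ^ 2) + -(Real.pi * Real.exp (v j) * ‖x‖ ^ 2) by ring,
      Real.exp_add, mul_add, Real.exp_add]
    ring
  simp_rw [e]
  rw [integral_finsetSum _ fun i _ => integrable_finsetSum _ fun j _ => (hG i j).1.const_mul _,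
    Finset.mul_sum]
  refine Finset.sum_congr rfl fun i _ => ?_
  rw [integral_finsetSum _ fun j _ => (hG i j).1.const_mul _, Finset.mul_sum]
  refine Finset.sum_congr rfl fun j _ => ?_
  have h1 : Real.exp (v i) + Real.exp (v j) = Real.exp ((v i + v j) / 2) *
      (Real.exp ((v i - v j) / 2) + Real.exp (-(v i - v j) / 2)) := by
    rw [mul_add, ← Real.exp_add, ← Real.exp_add]
    ring_nf
  rw [integral_const_mul, (hG i j).2, h1, coshKernel, show (n + q) / 2 = 2 * c by rw [hq]; ring,
    Real.mul_rpow hπ.le (by positivity), Real.mul_rpow (by positivity) (by positivity),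
    ← Real.exp_mul, neg_mul,
    show (v i + v j) / 2 * -(2 * c) = -(c * (v i + v j)) by ring, Real.exp_neg]
  field_simp

theorem integral_nonneg_of_forall_sum_nonneg {F : ℝ → ℝ} (hF : Continuous F) (hFi : Integrable F)
    {C : ℝ} (hC : ∀ x, |F x| ≤ C) (H : ∀ N (v : Fin N → ℝ), 0 ≤ ∑ i, ∑ j, F (v i - v j)) :
    0 ≤ ∫ x, F x := by
  have key : ∀ v : NNReal, 0 ≤ ∫ x, F x ∂(ProbabilityTheory.gaussianReal 0 (v + v)) := by
    intro v
    set I := ∫ x, F x ∂(ProbabilityTheory.gaussianReal 0 (v + v)) with hI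
    have hN : ∀ N : ℕ, 0 ≤ F 0 + N * I := by
      intro N
      set P : Measure (Fin (N + 1) → ℝ) :=
        Measure.pi fun _ => ProbabilityTheory.gaussianReal 0 v with hP
      have hlaw : ∀ i, P.map (fun w => w i) = ProbabilityTheory.gaussianReal 0 v := fun i =>
        (measurePreserving_eval (fun _ => ProbabilityTheory.gaussianReal 0 v) i).map_eq
      have hdiff : ∀ i j, i ≠ j → ∫ w, F (w i - w j) ∂P = I := by
        intro i j hij
        have hind := (ProbabilityTheory.iIndepFun_pi (X := fun _ : Fin (N + 1) => (id : ℝ → ℝ))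
          (μ := fun _ => ProbabilityTheory.gaussianReal 0 v) fun _ => aemeasurable_id).indepFun hij
        have hind' := hind.comp measurable_id (measurable_neg (G := ℝ))
        have hn : P.map ((fun x : ℝ => -x) ∘ fun w => w j) = ProbabilityTheory.gaussianReal 0 v := by
          rw [← Measure.map_map (g := fun x : ℝ => -x) measurable_neg (measurable_pi_apply j), hlaw,
            ProbabilityTheory.gaussianReal_map_neg, neg_zero]
        have h := ProbabilityTheory.gaussianReal_add_gaussianReal_of_indepFun hind' (hlaw i) hn
        rw [hI, ← add_zero (0 : ℝ), ← h, integral_map (by fun_prop) (by fun_prop)]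
        rfl
      have hInt : ∀ i j, Integrable (fun w : Fin (N + 1) → ℝ => F (w i - w j)) P := fun i j =>
        Integrable.of_bound (by fun_prop) C (Eventually.of_forall fun w => hC _)
      have h0 : 0 ≤ ∫ w, ∑ i, ∑ j, F (w i - w j) ∂P := integral_nonneg fun w => H _ w
      rw [integral_finsetSum _ fun i _ => integrable_finsetSum _ fun j _ => hInt i j] at h0
      have h1 : ∀ i : Fin (N + 1), ∫ w, ∑ j, F (w i - w j) ∂P = F 0 + N * I := by
        intro i
        rw [integral_finsetSum _ fun j _ => hInt i j, ← Finset.add_sum_erase _ _ (Finset.mem_univ i),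
          Finset.sum_congr rfl fun j hj => hdiff i j (Finset.ne_of_mem_erase hj).symm]
        simp
      simp_rw [h1] at h0
      simp only [Finset.sum_const, Finset.card_univ, Fintype.card_fin, nsmul_eq_mul] at h0
      exact nonneg_of_mul_nonneg_right h0 (by positivity)
    by_contra! hneg
    obtain ⟨N, hN'⟩ := exists_nat_gt (F 0 / -I)
    rw [div_lt_iff₀ (by linarith)] at hN'
    linarith [hN N]
  have hlim : Tendsto (fun k : ℕ => ∫ x, Real.exp (-x ^ 2 / (2 * (k + 1))) * F x) atTop
      (nhds (∫ x, F x)) := by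
    refine tendsto_integral_of_dominated_convergence (fun x => ‖F x‖)
      (fun k => Continuous.aestronglyMeasurable (by fun_prop)) hFi.norm
      (fun k => Eventually.of_forall fun x => ?_) (Eventually.of_forall fun x => ?_)
    · rw [norm_mul, Real.norm_of_nonneg (Real.exp_nonneg _)]
      refine mul_le_of_le_one_left (norm_nonneg _) (Real.exp_le_one_iff.2 ?_)
      rw [neg_div, neg_nonpos]
      positivity
    · have h := (tendsto_one_div_add_atTop_nhds_zero_nat (𝕜 := ℝ)).const_mul (-x ^ 2 / 2)
      rw [mul_zero] at h
      have h2 := ((Real.continuous_exp.tendsto 0).comp h).mul_const (F x)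
      rw [Real.exp_zero, one_mul] at h2
      refine h2.congr fun k => ?_
      simp only [Function.comp]
      congr 2
      field_simp
  refine ge_of_tendsto' hlim fun k => ?_
  have h := key ((k + 1) / 2)
  rw [add_halves, ProbabilityTheory.integral_gaussianReal_eq_integral_smul (by positivity)] at h
  simp only [ProbabilityTheory.gaussianPDFReal, smul_eq_mul, mul_assoc, sub_zero] at h
  rw [integral_const_mul] at h
  have h2 := nonneg_of_mul_nonneg_right h (by positivity)
  simpa using h2

theorem coshKernel_neg (c p : ℝ) : coshKernel c (-p) = coshKernel c p := by
  rw [coshKernel, coshKernel, neg_neg, add_comm]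

theorem continuous_coshKernel (c : ℝ) : Continuous (coshKernel c) :=
  Continuous.rpow_const (by fun_prop) fun p => Or.inl (by positivity)

theorem abs_coshKernel_le_one {c : ℝ} (hc : 0 < c) (p : ℝ) : |coshKernel c p| ≤ 1 := by
  rw [coshKernel, abs_of_nonneg (by positivity)]
  refine Real.rpow_le_one_of_one_le_of_nonpos ?_ (by linarith)
  have h1 := Real.add_one_le_exp (p / 2)
  have h2 := Real.add_one_le_exp (-p / 2)
  linarith

theorem fourier_gaussian_sum {n : ℕ} {α β : ℝ} (hαβ : α + β = n / 2) {N : ℕ} (v : Fin N → ℝ) :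
    ∃ f : SchwartzMap (En n) ℂ,
      (∀ x, f x = ((∑ i, Real.exp (α * v i) *
        Real.exp (-(Real.pi * Real.exp (v i) * ‖x‖ ^ 2)) : ℝ) : ℂ)) ∧
      ∀ ξ, 𝓕 f ξ = ((∑ i, Real.exp (β * -v i) *
        Real.exp (-(Real.pi * Real.exp (-v i) * ‖ξ‖ ^ 2)) : ℝ) : ℂ) := by
  have hπ := Real.pi_pos
  choose G hG using fun i => exists_gaussian_schwartz (n := n)
    (b := Real.pi * Real.exp (v i)) (by positivity)
  have hF : ∀ i ξ, 𝓕 (G i) ξ = ((Real.exp (-(n / 2 * v i)) *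
      Real.exp (-(Real.pi * Real.exp (-v i) * ‖ξ‖ ^ 2)) : ℝ) : ℂ) := by
    intro i ξ
    rw [SchwartzMap.fourier_coe, show (G i : En n → ℂ) = _ from funext (hG i),
      fourier_gaussian (by positivity)]
    congr 2
    · rw [div_mul_cancel_left₀ hπ.ne', ← Real.exp_neg, ← Real.exp_mul]
      ring_nf
    · rw [Real.exp_neg (v i)]
      field_simp
  refine ⟨∑ i, ((Real.exp (α * v i) : ℝ) : ℂ) • G i, fun x => ?_, fun ξ => ?_⟩
  · simp [hG]
  · have : 𝓕 (∑ i, ((Real.exp (α * v i) : ℝ) : ℂ) • G i) =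
        ∑ i, ((Real.exp (α * v i) : ℝ) : ℂ) • 𝓕 (G i) := by
      simp only [← FourierTransform.fourierCLM_apply (R := ℂ), map_sum, map_smul]
    rw [this, sum_apply, Complex.ofReal_sum]
    refine Finset.sum_congr rfl fun i _ => ?_
    rw [smul_apply, hF, smul_eq_mul, ← Complex.ofReal_mul, ← mul_assoc, ← Real.exp_add]
    congr 4
    linear_combination v i * hαβ

/-- The sharp fractional Hardy (Herbst) constant bounds any admissible constant. -/
theorem hardy_constant_le {n : ℕ} (hn : 0 < n) {s B : ℝ} (h0 : 0 < s) (h2 : s < 2)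
    (hsn : 2 * s < n)
    (H : ∀ W : ℝ → ℝ, TestOn n Set.univ (fun x => W ‖x‖) →
      B * ∫ x : En n, ‖x‖ ^ (-(2 * s)) * W ‖x‖ ^ 2 ≤
        ∫ x : En n, fracLap n (s / 2) (fun x => W ‖x‖) x ^ 2) :
    B ≤ 4 ^ s * (Real.Gamma ((n + 2 * s) / 4) ^ 2 / Real.Gamma ((n - 2 * s) / 4) ^ 2) := by
  have hπ := Real.pi_pos
  have hκ := halfSphere_pos hn
  obtain ⟨α, hα⟩ : ∃ α : ℝ, α = (n - 2 * s) / 4 := ⟨_, rfl⟩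
  obtain ⟨β, hβ⟩ : ∃ β : ℝ, β = (n + 2 * s) / 4 := ⟨_, rfl⟩
  have hα0 : 0 < α := by rw [hα]; linarith
  have hβ0 : 0 < β := by rw [hβ]; linarith
  have hΓα := Real.Gamma_pos_of_pos hα0
  have hΓβ := Real.Gamma_pos_of_pos hβ0
  have hΓ2α := Real.Gamma_pos_of_pos (mul_pos two_pos hα0)
  have hΓ2β := Real.Gamma_pos_of_pos (mul_pos two_pos hβ0)
  rw [← hα, ← hβ]
  set C1 := halfSphere n * Real.Gamma (2 * α) * Real.pi ^ (-(2 * α)) with hC1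
  set C2 := (2 * Real.pi) ^ (2 * s) *
    (halfSphere n * Real.Gamma (2 * β) * Real.pi ^ (-(2 * β))) with hC2
  have hsum : ∀ N (v : Fin N → ℝ), 0 ≤ ∑ i, ∑ j,
      (C2 * coshKernel β (v i - v j) - B * C1 * coshKernel α (v i - v j)) := by
    intro N v
    obtain ⟨f, hf, hf'⟩ := fourier_gaussian_sum (n := n) (α := α) (β := β)
      (by rw [hα, hβ]; ring) v
    have h := hardy_extend hn h0 h2 hsn H (W := fun r => ∑ i, Real.exp (α * v i) *
        Real.exp (-(Real.pi * Real.exp (v i) * r ^ 2))) f hf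
    rw [integral_norm_rpow_mul_gaussian_sum_sq hn hα0 (by rw [hα]; ring)] at h
    have hE : energy (2 * s) (𝓕 f) = C2 * ∑ i, ∑ j, coshKernel β (v i - v j) := by
      have h3 := integral_norm_rpow_mul_gaussian_sum_sq hn hβ0 (q := 2 * s) (by rw [hβ]; ring)
        (fun i => -v i)
      have h4 : ∀ i j, coshKernel β (-v i - -v j) = coshKernel β (v i - v j) := fun i j => by
        rw [← coshKernel_neg]
        ring_nf
      simp_rw [h4] at h3
      rw [hC2, mul_assoc, ← h3, energy, ← integral_const_mul]
      congr 1 with ξ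
      rw [hf', Complex.norm_real, Real.norm_eq_abs, sq_abs,
        Real.mul_rpow (by positivity) (norm_nonneg _), mul_assoc]
    rw [hE] at h
    simp_rw [Finset.sum_sub_distrib, ← Finset.mul_sum]
    rw [sub_nonneg, mul_assoc]
    exact h
  have hiα := coshKernel_integral hα0
  have hiβ := coshKernel_integral hβ0
  have hInt := integral_nonneg_of_forall_sum_nonneg
    (F := fun p => C2 * coshKernel β p - B * C1 * coshKernel α p)
    (((continuous_coshKernel β).const_mul C2).sub ((continuous_coshKernel α).const_mul (B * C1)))
    ((hiβ.1.const_mul C2).sub (hiα.1.const_mul (B * C1))) (C := |C2| + |B * C1|)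
    (fun p => by
      refine (abs_sub _ _).trans ?_
      rw [abs_mul, abs_mul (B * C1)]
      exact add_le_add (mul_le_of_le_one_right (abs_nonneg _) (abs_coshKernel_le_one hβ0 p))
        (mul_le_of_le_one_right (abs_nonneg _) (abs_coshKernel_le_one hα0 p))) hsum
  rw [integral_sub (hiβ.1.const_mul C2) (hiα.1.const_mul (B * C1)), integral_const_mul,
    integral_const_mul, hiα.2, hiβ.2, sub_nonneg] at hInt
  have hpow : (2 * Real.pi) ^ (2 * s) * Real.pi ^ (-(2 * β)) = 4 ^ s * Real.pi ^ (-(2 * α)) := by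
    rw [Real.mul_rpow two_pos.le hπ.le, mul_assoc, ← Real.rpow_add hπ, Real.rpow_mul two_pos.le,
      show 2 * s + -(2 * β) = -(2 * α) by rw [hα, hβ]; ring]
    norm_num
  have hl : B * C1 * (Real.Gamma α ^ 2 / Real.Gamma (2 * α)) =
      B * (halfSphere n * Real.pi ^ (-(2 * α)) * Real.Gamma α ^ 2) := by
    rw [hC1]
    field_simp
  have hr : C2 * (Real.Gamma β ^ 2 / Real.Gamma (2 * β)) =
      4 ^ s * Real.Gamma β ^ 2 * (halfSphere n * Real.pi ^ (-(2 * α))) := by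
    rw [hC2]
    calc _ = (2 * Real.pi) ^ (2 * s) * Real.pi ^ (-(2 * β)) * halfSphere n * Real.Gamma β ^ 2 := by
          field_simp
      _ = _ := by rw [hpow]; ring
  rw [hl, hr] at hInt
  rw [← mul_div_assoc, le_div_iff₀ (by positivity)]
  refine le_of_mul_le_mul_right ?_ (show 0 < halfSphere n * Real.pi ^ (-(2 * α)) by positivity)
  linarith

theorem ae_ne_zero {n : ℕ} (hn : 0 < n) : ∀ᵐ x : En n, x ≠ 0 := by
  have : Nonempty (Fin n) := ⟨⟨0, hn⟩⟩
  exact compl_mem_ae_iff.2 (measure_singleton 0)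

theorem integral_integral_mul_swap {n : ℕ} {h : En n → ℂ} (hh : AEStronglyMeasurable h volume)
    {K : En n → ℝ → ℝ} (hK : Measurable (Function.uncurry K))
    (hi : ∀ᵐ x, IntegrableOn (K x) (Ioi 0))
    (hN : Integrable fun x => ‖h x‖ * ∫ t in Ioi (0 : ℝ), |K x t|) :
    ∫ t in Ioi (0 : ℝ), ∫ x, h x * (K x t : ℂ) =
      ∫ x, h x * ((∫ t in Ioi (0 : ℝ), K x t : ℝ) : ℂ) := by
  have hInt : Integrable (Function.uncurry fun (x : En n) (t : ℝ) => h x * (K x t : ℂ))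
      (volume.prod (volume.restrict (Ioi (0 : ℝ)))) := by
    have hm : AEStronglyMeasurable (Function.uncurry fun (x : En n) (t : ℝ) => h x * (K x t : ℂ))
        (volume.prod (volume.restrict (Ioi (0 : ℝ)))) :=
      (hh.comp_fst).mul (Complex.measurable_ofReal.comp hK).aestronglyMeasurable
    refine (integrable_prod_iff hm).2 ⟨?_, ?_⟩
    · filter_upwards [hi] with x hx
      exact (Integrable.ofReal (𝕜 := ℂ) hx).const_mul (h x)
    · refine hN.congr (Eventually.of_forall fun x => ?_)
      simp only [Function.uncurry, norm_mul, Complex.norm_real, Real.norm_eq_abs]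
      rw [integral_const_mul]
  rw [← integral_integral_swap hInt]
  congr 1 with x
  rw [integral_const_mul, integral_complex_ofReal]

theorem fourierInv_gaussian {n : ℕ} {b : ℝ} (hb : 0 < b) (ξ : En n) :
    𝓕⁻ (fun x : En n => ((Real.exp (-(b * ‖x‖ ^ 2)) : ℝ) : ℂ)) ξ =
      (((Real.pi / b) ^ ((n : ℝ) / 2) * Real.exp (-(Real.pi ^ 2 * ‖ξ‖ ^ 2 / b)) : ℝ) : ℂ) := by
  rw [Real.fourierInv_eq_fourier_neg, fourier_gaussian hb, norm_neg]

theorem integral_fourierInv_mul_gaussian {n : ℕ} {h : En n → ℂ} (hh : Integrable h) {b : ℝ}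
    (hb : 0 < b) :
    ∫ x, 𝓕⁻ h x * ((Real.exp (-(b * ‖x‖ ^ 2)) : ℝ) : ℂ) =
      ∫ ξ, h ξ * (((Real.pi / b) ^ ((n : ℝ) / 2) *
        Real.exp (-(Real.pi ^ 2 * ‖ξ‖ ^ 2 / b)) : ℝ) : ℂ) := by
  refine (integral_fourierInv_mul_eq hh
    (Integrable.ofReal (𝕜 := ℂ) (integrable_gaussian hb))).trans ?_
  congr 1 with ξ
  rw [← fourierInv_gaussian hb]
  rfl

/-- The Fourier transform of a Riesz potential kernel, tested against a Schwartz function. -/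
theorem integral_fourier_mul_norm_rpow {n : ℕ} (hn : 0 < n) {s : ℝ} (hs : 0 < s)
    (hsn : 2 * s < n) (f : SchwartzMap (En n) ℂ) :
    ((Real.Gamma (n / 2 - s) * Real.pi ^ (2 * s - n / 2) : ℝ) : ℂ) *
        ∫ ξ, (𝓕 f : SchwartzMap (En n) ℂ) ξ * ((‖ξ‖ ^ (2 * s - n) : ℝ) : ℂ) =
      (Real.Gamma s : ℂ) * ∫ x, f x * ((‖x‖ ^ (-(2 * s)) : ℝ) : ℂ) := by
  have hπ := Real.pi_pos
  have hns : 0 < (n : ℝ) / 2 - s := by linarith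
  have hx : ∀ x : En n, x ≠ 0 →
      IntegrableOn (fun t : ℝ => t ^ (s - 1) * Real.exp (-(‖x‖ ^ 2 * t))) (Ioi 0) ∧
      ∫ t in Ioi (0 : ℝ), t ^ (s - 1) * Real.exp (-(‖x‖ ^ 2 * t)) =
        Real.Gamma s * ‖x‖ ^ (-(2 * s)) := fun x hx => by
    have hx' := norm_pos_iff.2 hx
    refine ⟨integrableOn_rpow_mul_exp_neg_mul hs (by positivity), ?_⟩
    rw [integral_rpow_mul_exp_neg_mul hs (by positivity), ← Real.rpow_natCast,
      ← Real.rpow_mul hx'.le]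
    congr 2
    push_cast
    ring
  have hξ : ∀ ξ : En n, ξ ≠ 0 →
      IntegrableOn (fun t : ℝ => Real.pi ^ ((n : ℝ) / 2) * (t ^ (-((n : ℝ) / 2 - s) - 1) *
        Real.exp (-(Real.pi ^ 2 * ‖ξ‖ ^ 2 / t)))) (Ioi 0) ∧
      ∫ t in Ioi (0 : ℝ), Real.pi ^ ((n : ℝ) / 2) * (t ^ (-((n : ℝ) / 2 - s) - 1) *
        Real.exp (-(Real.pi ^ 2 * ‖ξ‖ ^ 2 / t))) =
        (Real.Gamma (n / 2 - s) * Real.pi ^ (2 * s - n / 2)) * ‖ξ‖ ^ (2 * s - n) := fun ξ hξ => by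
    have hξ' := norm_pos_iff.2 hξ
    refine ⟨(integrableOn_rpow_mul_exp_neg_div hns (by positivity)).const_mul _, ?_⟩
    rw [integral_const_mul, integral_rpow_mul_exp_neg_div hns (by positivity), ← mul_pow,
      ← Real.rpow_natCast, ← Real.rpow_mul (by positivity), Real.mul_rpow hπ.le hξ'.le,
      show ((2 : ℕ) : ℝ) * -((n : ℝ) / 2 - s) = 2 * s - n by push_cast; ring,
      show 2 * s - (n : ℝ) / 2 = n / 2 + (2 * s - n) by ring, Real.rpow_add hπ]
    ring
  have e1 := integral_integral_mul_swap (h := f)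
    (K := fun x t => t ^ (s - 1) * Real.exp (-(‖x‖ ^ 2 * t)))
    f.continuous.aestronglyMeasurable (by fun_prop)
    ((ae_ne_zero hn).mono fun x hx0 => (hx x hx0).1) (by
      refine ((integrable_norm_rpow_mul_norm_schwartz hn (q := -(2 * s)) (by linarith) f).const_mul
        (Real.Gamma s)).congr ((ae_ne_zero hn).mono fun x hx0 => ?_)
      simp only
      rw [setIntegral_congr_fun measurableSet_Ioi (g := fun t => t ^ (s - 1) *
        Real.exp (-(‖x‖ ^ 2 * t))) fun t ht => abs_of_nonneg (by
          have : 0 < t := ht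
          positivity), (hx x hx0).2]
      ring)
  have e2 := integral_integral_mul_swap (h := fun ξ => (𝓕 f : SchwartzMap (En n) ℂ) ξ)
    (K := fun ξ t => Real.pi ^ ((n : ℝ) / 2) * (t ^ (-((n : ℝ) / 2 - s) - 1) *
        Real.exp (-(Real.pi ^ 2 * ‖ξ‖ ^ 2 / t))))
    (𝓕 f : SchwartzMap (En n) ℂ).continuous.aestronglyMeasurable (by fun_prop)
    ((ae_ne_zero hn).mono fun ξ hξ0 => (hξ ξ hξ0).1) (by
      refine ((integrable_norm_rpow_mul_norm_schwartz hn (q := 2 * s - n) (by linarith)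
        (𝓕 f)).const_mul (Real.Gamma (n / 2 - s) * Real.pi ^ (2 * s - n / 2))).congr
          ((ae_ne_zero hn).mono fun ξ hξ0 => ?_)
      simp only
      rw [setIntegral_congr_fun measurableSet_Ioi (g := fun t => Real.pi ^ ((n : ℝ) / 2) *
        (t ^ (-((n : ℝ) / 2 - s) - 1) * Real.exp (-(Real.pi ^ 2 * ‖ξ‖ ^ 2 / t))))
        fun t ht => abs_of_nonneg (by
          have : 0 < t := ht
          positivity), (hξ ξ hξ0).2]
      ring)
  have hl : ∫ x, f x * ((∫ t in Ioi (0 : ℝ), t ^ (s - 1) * Real.exp (-(‖x‖ ^ 2 * t)) : ℝ) : ℂ) =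
      (Real.Gamma s : ℂ) * ∫ x, f x * ((‖x‖ ^ (-(2 * s)) : ℝ) : ℂ) := by
    rw [← integral_const_mul]
    refine integral_congr_ae ((ae_ne_zero hn).mono fun x hx0 => ?_)
    simp only
    rw [(hx x hx0).2]
    push_cast
    ring
  have hr : ∫ ξ, (𝓕 f : SchwartzMap (En n) ℂ) ξ * ((∫ t in Ioi (0 : ℝ), Real.pi ^ ((n : ℝ) / 2) *
        (t ^ (-((n : ℝ) / 2 - s) - 1) * Real.exp (-(Real.pi ^ 2 * ‖ξ‖ ^ 2 / t))) : ℝ) : ℂ) =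
      ((Real.Gamma (n / 2 - s) * Real.pi ^ (2 * s - n / 2) : ℝ) : ℂ) *
        ∫ ξ, (𝓕 f : SchwartzMap (En n) ℂ) ξ * ((‖ξ‖ ^ (2 * s - n) : ℝ) : ℂ) := by
    rw [← integral_const_mul]
    refine integral_congr_ae ((ae_ne_zero hn).mono fun ξ hξ0 => ?_)
    simp only
    rw [(hξ ξ hξ0).2]
    push_cast
    ring
  rw [← hl, ← hr, ← e1, ← e2]
  refine setIntegral_congr_fun measurableSet_Ioi fun t ht => ?_
  have ht' : 0 < t := ht
  have hp := integral_fourierInv_mul_gaussian (h := fun ξ => (𝓕 f : SchwartzMap (En n) ℂ) ξ) (𝓕 f : SchwartzMap (En n) ℂ).integrable ht'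
  have hinv : ∀ x, 𝓕⁻ (fun ξ => (𝓕 f : SchwartzMap (En n) ℂ) ξ) x = f x := fun x => by
    rw [show (𝓕⁻ (fun ξ => (𝓕 f : SchwartzMap (En n) ℂ) ξ) : En n → ℂ) =
      (𝓕⁻ (𝓕 f : SchwartzMap (En n) ℂ) : SchwartzMap (En n) ℂ) from
      (SchwartzMap.fourierInv_coe _).symm,
      FourierTransform.fourierInv_fourier_eq (F := SchwartzMap (En n) ℂ) f]
  simp_rw [hinv] at hp
  have hL : ∀ x, f x * ((t ^ (s - 1) * Real.exp (-(‖x‖ ^ 2 * t)) : ℝ) : ℂ) =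
      ((t ^ (s - 1) : ℝ) : ℂ) * (f x * ((Real.exp (-(t * ‖x‖ ^ 2)) : ℝ) : ℂ)) := fun x => by
    rw [mul_comm (‖x‖ ^ 2)]
    push_cast
    ring
  simp_rw [hL]
  rw [integral_const_mul, hp, ← integral_const_mul]
  congr 1 with ξ
  have : t ^ (-((n : ℝ) / 2 - s) - 1) = t ^ (s - 1) * (t ^ ((n : ℝ) / 2))⁻¹ := by
    rw [← Real.rpow_neg ht'.le, ← Real.rpow_add ht']
    ring_nf
  rw [this, Real.div_rpow hπ.le ht'.le]
  push_cast
  ring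

/-- The Fourier transform of the logarithm, tested against a function of vanishing mean. -/
theorem integral_fourierInv_mul_log {n : ℕ} (hn : 0 < n) {h : En n → ℂ} (hh : Integrable h)
    (hh2 : Integrable fun ξ => ‖ξ‖ ^ (-(n : ℝ)) * ‖h ξ‖) (hg : Integrable (𝓕⁻ h))
    (hgl : Integrable fun x => ‖𝓕⁻ h x‖ * |Real.log ‖x‖|) (h0 : ∫ x, 𝓕⁻ h x = 0) :
    -2 * ∫ x, 𝓕⁻ h x * ((Real.log ‖x‖ : ℝ) : ℂ) =
      ((Real.pi ^ (-((n : ℝ) / 2)) * Real.Gamma (n / 2) : ℝ) : ℂ) *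
        ∫ ξ, h ξ * ((‖ξ‖ ^ (-(n : ℝ)) : ℝ) : ℂ) := by
  have hπ := Real.pi_pos
  have hn2 : 0 < (n : ℝ) / 2 := by positivity
  have hfr := fun (x : En n) (hx : x ≠ 0) =>
    frullani (a := ‖x‖ ^ 2) (b := 1) (by have := norm_pos_iff.2 hx; positivity) one_pos
  have hlog : ∀ x : En n, Real.log 1 - Real.log (‖x‖ ^ 2) = -2 * Real.log ‖x‖ := fun x => by
    rw [Real.log_one, Real.log_pow]
    push_cast
    ring
  have hξ : ∀ ξ : En n, ξ ≠ 0 →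
      IntegrableOn (fun t : ℝ => Real.pi ^ ((n : ℝ) / 2) * (t ^ ((n : ℝ) / 2 - 1) *
        Real.exp (-(Real.pi ^ 2 * ‖ξ‖ ^ 2 * t)))) (Ioi 0) ∧
      ∫ t in Ioi (0 : ℝ), Real.pi ^ ((n : ℝ) / 2) * (t ^ ((n : ℝ) / 2 - 1) *
        Real.exp (-(Real.pi ^ 2 * ‖ξ‖ ^ 2 * t))) =
        (Real.pi ^ (-((n : ℝ) / 2)) * Real.Gamma (n / 2)) * ‖ξ‖ ^ (-(n : ℝ)) := fun ξ hξ => by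
    have hξ' := norm_pos_iff.2 hξ
    refine ⟨(integrableOn_rpow_mul_exp_neg_mul hn2 (by positivity)).const_mul _, ?_⟩
    rw [integral_const_mul, integral_rpow_mul_exp_neg_mul hn2 (by positivity), ← mul_pow,
      ← Real.rpow_natCast, ← Real.rpow_mul (by positivity), Real.mul_rpow hπ.le hξ'.le,
      show ((2 : ℕ) : ℝ) * -((n : ℝ) / 2) = -n by push_cast; ring,
      show -((n : ℝ) / 2) = n / 2 + -n by ring, Real.rpow_add hπ]
    ring
  have e1 := integral_integral_mul_swap (h := 𝓕⁻ h)
    (K := fun x t => (Real.exp (-(‖x‖ ^ 2 / t)) - Real.exp (-(1 / t))) / t)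
    hg.aestronglyMeasurable (by fun_prop)
    ((ae_ne_zero hn).mono fun x hx0 => (hfr x hx0).1) (by
      refine (hgl.const_mul 2).congr ((ae_ne_zero hn).mono fun x hx0 => ?_)
      simp only
      rw [(hfr x hx0).2.2, hlog, abs_mul]
      norm_num
      ring)
  have e2 := integral_integral_mul_swap (h := h)
    (K := fun ξ t => Real.pi ^ ((n : ℝ) / 2) * (t ^ ((n : ℝ) / 2 - 1) *
        Real.exp (-(Real.pi ^ 2 * ‖ξ‖ ^ 2 * t))))
    hh.aestronglyMeasurable (by fun_prop)
    ((ae_ne_zero hn).mono fun ξ hξ0 => (hξ ξ hξ0).1) (by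
      refine (hh2.const_mul (Real.pi ^ (-((n : ℝ) / 2)) * Real.Gamma (n / 2))).congr
          ((ae_ne_zero hn).mono fun ξ hξ0 => ?_)
      simp only
      rw [setIntegral_congr_fun measurableSet_Ioi (g := fun t => Real.pi ^ ((n : ℝ) / 2) *
        (t ^ ((n : ℝ) / 2 - 1) * Real.exp (-(Real.pi ^ 2 * ‖ξ‖ ^ 2 * t))))
        fun t ht => abs_of_nonneg (by
          have : 0 < t := ht
          positivity), (hξ ξ hξ0).2]
      ring)
  have hl : ∫ x, 𝓕⁻ h x * ((∫ t in Ioi (0 : ℝ), (Real.exp (-(‖x‖ ^ 2 / t)) -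
      Real.exp (-(1 / t))) / t : ℝ) : ℂ) = -2 * ∫ x, 𝓕⁻ h x * ((Real.log ‖x‖ : ℝ) : ℂ) := by
    rw [← integral_const_mul]
    refine integral_congr_ae ((ae_ne_zero hn).mono fun x hx0 => ?_)
    simp only
    rw [(hfr x hx0).2.1, hlog]
    push_cast
    ring
  have hr : ∫ ξ, h ξ * ((∫ t in Ioi (0 : ℝ), Real.pi ^ ((n : ℝ) / 2) *
        (t ^ ((n : ℝ) / 2 - 1) * Real.exp (-(Real.pi ^ 2 * ‖ξ‖ ^ 2 * t))) : ℝ) : ℂ) =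
      ((Real.pi ^ (-((n : ℝ) / 2)) * Real.Gamma (n / 2) : ℝ) : ℂ) *
        ∫ ξ, h ξ * ((‖ξ‖ ^ (-(n : ℝ)) : ℝ) : ℂ) := by
    rw [← integral_const_mul]
    refine integral_congr_ae ((ae_ne_zero hn).mono fun ξ hξ0 => ?_)
    simp only
    rw [(hξ ξ hξ0).2]
    push_cast
    ring
  rw [← hl, ← hr, ← e1, ← e2]
  refine setIntegral_congr_fun measurableSet_Ioi fun t ht => ?_
  have ht' : 0 < t := ht
  have hp := integral_fourierInv_mul_gaussian hh (inv_pos.2 ht')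
  have hL : ∀ x, 𝓕⁻ h x * (((Real.exp (-(‖x‖ ^ 2 / t)) - Real.exp (-(1 / t))) / t : ℝ) : ℂ) =
      ((t⁻¹ : ℝ) : ℂ) * (𝓕⁻ h x * ((Real.exp (-(t⁻¹ * ‖x‖ ^ 2)) : ℝ) : ℂ)) -
        ((t⁻¹ * Real.exp (-(1 / t)) : ℝ) : ℂ) * 𝓕⁻ h x := fun x => by
    rw [show ‖x‖ ^ 2 / t = t⁻¹ * ‖x‖ ^ 2 by rw [div_eq_inv_mul]]
    push_cast
    ring
  simp_rw [hL]
  have hgg : Integrable fun x => 𝓕⁻ h x * ((Real.exp (-(t⁻¹ * ‖x‖ ^ 2)) : ℝ) : ℂ) := by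
    refine hg.mul_bdd (c := 1) (by fun_prop) (Eventually.of_forall fun x => ?_)
    rw [Complex.norm_real, Real.norm_of_nonneg (Real.exp_nonneg _), Real.exp_le_one_iff,
      neg_nonpos]
    positivity
  rw [integral_sub (hgg.const_mul _) (hg.const_mul _), integral_const_mul, integral_const_mul, h0,
    mul_zero, sub_zero, hp, ← integral_const_mul]
  congr 1 with ξ
  rw [Real.rpow_sub_one ht'.ne', div_inv_eq_mul, div_inv_eq_mul, Real.mul_rpow hπ.le ht'.le]
  push_cast
  ring

open scoped LineDeriv in
theorem lineDerivOp_apply_of_ofReal {n : ℕ} {w : En n → ℝ} (f : SchwartzMap (En n) ℂ)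
    (hf : ∀ x, f x = w x) (m x : En n) :
    (∂_{m} f : SchwartzMap (En n) ℂ) x = (fderiv ℝ w x m : ℂ) := by
  have hw : w = Complex.reCLM ∘ f := funext fun x => by simp [hf]
  have hwd : DifferentiableAt ℝ w x := by
    rw [hw]
    exact Complex.reCLM.differentiableAt.comp x f.differentiableAt
  have hfw : (f : En n → ℂ) = Complex.ofRealCLM ∘ w := funext fun x => by simp [hf]
  rw [SchwartzMap.lineDerivOp_apply_eq_fderiv, hfw, fderiv_comp x
    Complex.ofRealCLM.differentiableAt hwd]
  simp

open scoped LineDeriv in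
theorem exists_schwartz_neg_lap {n : ℕ} {w : En n → ℝ} (f : SchwartzMap (En n) ℂ)
    (hf : ∀ x, f x = w x) :
    ∃ F : SchwartzMap (En n) ℂ, (∀ x, F x = ((-(lap w x) : ℝ) : ℂ)) ∧
      ∀ ξ, (𝓕 F : SchwartzMap (En n) ℂ) ξ =
        (((2 * Real.pi * ‖ξ‖) ^ 2 : ℝ) : ℂ) * (𝓕 f : SchwartzMap (En n) ℂ) ξ := by
  set e : Fin n → En n := fun i => EuclideanSpace.single i 1 with he
  refine ⟨-∑ i, ∂_{e i} (∂_{e i} f), fun x => ?_, fun ξ => ?_⟩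
  · simp only [neg_apply, sum_apply, lap, Complex.ofReal_neg, Complex.ofReal_sum]
    congr 1
    refine Finset.sum_congr rfl fun i _ => ?_
    exact lineDerivOp_apply_of_ofReal _ (lineDerivOp_apply_of_ofReal f hf (e i)) (e i) x
  · have h1 : ∀ i, (𝓕 (∂_{e i} (∂_{e i} f)) : SchwartzMap (En n) ℂ) ξ =
        -(((2 * Real.pi) ^ 2 * (ξ i) ^ 2 : ℝ) : ℂ) * (𝓕 f : SchwartzMap (En n) ℂ) ξ := fun i => by
      have hg : (fun y : En n => inner ℝ y (e i)).HasTemperateGrowth :=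
        ((innerSL ℝ).flip (e i)).hasTemperateGrowth
      have hin : inner ℝ ξ (e i) = ξ i := by
        simp [he, EuclideanSpace.inner_single_right]
      rw [SchwartzMap.fourier_lineDerivOp_eq, SchwartzMap.fourier_lineDerivOp_eq]
      simp only [smul_apply, SchwartzMap.smulLeftCLM_apply_apply hg, hin]
      simp only [smul_eq_mul, Complex.real_smul]
      push_cast
      linear_combination (2 * (Real.pi : ℂ)) ^ 2 * (ξ i : ℂ) ^ 2 *
        (𝓕 f : SchwartzMap (En n) ℂ) ξ * Complex.I_sq
    have h2 : (𝓕 (-∑ i, ∂_{e i} (∂_{e i} f)) : SchwartzMap (En n) ℂ) =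
        -∑ i, (𝓕 (∂_{e i} (∂_{e i} f)) : SchwartzMap (En n) ℂ) := by
      simp_rw [← FourierTransform.fourierCLM_apply (R := ℂ), map_neg, map_sum]
    rw [h2, neg_apply, sum_apply, Finset.sum_congr rfl fun i _ => h1 i,
      ← Finset.sum_mul, mul_pow (2 * Real.pi) ‖ξ‖, EuclideanSpace.real_norm_sq_eq, Finset.mul_sum,
      Finset.sum_neg_distrib]
    push_cast
    ring

theorem continuous_symbolMul {n : ℕ} {p : ℝ} (hp : 0 < p) (f : SchwartzMap (En n) ℂ) :
    Continuous (symbolMul p f) := by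
  have := f.continuous
  have h : Continuous fun ξ : En n => (2 * Real.pi * ‖ξ‖) ^ p :=
    (Real.continuous_rpow_const hp.le).comp (by fun_prop)
  unfold symbolMul
  fun_prop

theorem ofReal_fracLap_neg_lap_eq {n : ℕ} (hn : 0 < n) {s : ℝ} (h1 : 1 < s) (h2 : s < 2)
    {w : En n → ℝ} (f : SchwartzMap (En n) ℂ) (hf : ∀ x, f x = w x) (x : En n) :
    ((fracLap n (s - 1) (fun z => -(lap w z)) x : ℝ) : ℂ) =
      𝓕⁻ (symbolMul (2 * s) (𝓕 f)) x := by
  obtain ⟨F, hF, hFF⟩ := exists_schwartz_neg_lap f hf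
  rw [ofReal_fracLap_eq hn (sub_pos.2 h1) (by linarith) F hF]
  suffices symbolMul (2 * (s - 1)) (𝓕 F) = symbolMul (2 * s) (𝓕 f) by rw [this]
  ext ξ
  rw [symbolMul, symbolMul, hFF, ← mul_assoc, ← Complex.ofReal_mul, ← Real.rpow_natCast,
    ← Real.rpow_add_of_nonneg (by have := Real.pi_pos; positivity) (by linarith) (by norm_num)]
  congr 3
  push_cast
  ring

theorem integral_fourierInv_eq_zero {n : ℕ} {h : En n → ℂ} (hc : Continuous h)
    (hh : Integrable h) (hg : Integrable (𝓕⁻ h)) (h0 : h 0 = 0) : ∫ x, 𝓕⁻ h x = 0 := by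
  have hF : Integrable (𝓕 h) :=
    hg.comp_neg.congr (Eventually.of_forall fun x => by
      simp only [Real.fourierInv_eq_fourier_neg, neg_neg])
  have := congrFun (hc.fourier_fourierInv_eq hh hF) 0
  rw [Real.fourier_eq, h0] at this
  simpa using this

/-- `(-Δ)^s` applied to `-2s log|x|` is an explicit multiple of `|x|^(-2s)`, in the sense of
distributions. -/
theorem integral_fracLap_neg_lap_mul_log {n : ℕ} (hn : 0 < n) {s : ℝ} (h1 : 1 < s) (h2 : s < 2)
    (hsn : 2 * s < n) {w : En n → ℝ} (f : SchwartzMap (En n) ℂ) (hf : ∀ x, f x = w x)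
    (hg : Integrable (fracLap n (s - 1) fun z => -(lap w z)))
    (hgl : Integrable fun x => fracLap n (s - 1) (fun z => -(lap w z)) x * Real.log ‖x‖) :
    ∫ x, fracLap n (s - 1) (fun z => -(lap w z)) x = 0 ∧
    -(2 * s) * ∫ x, fracLap n (s - 1) (fun z => -(lap w z)) x * Real.log ‖x‖ =
      4 ^ s * (Real.Gamma (n / 2) * Real.Gamma (1 + s) / Real.Gamma ((n - 2 * s) / 2)) *
        ∫ x : En n, w x * ‖x‖ ^ (-(2 * s)) := by
  have hπ := Real.pi_pos
  set g := fracLap n (s - 1) fun z => -(lap w z) with hgdef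
  set h := symbolMul (2 * s) (𝓕 f) with hhdef
  have hgh : ∀ x, (g x : ℂ) = 𝓕⁻ h x := ofReal_fracLap_neg_lap_eq hn h1 h2 f hf
  have hh : Integrable h := integrable_symbolMul hn (by linarith) _
  have hg' : Integrable (𝓕⁻ h) :=
    (Integrable.ofReal (𝕜 := ℂ) hg).congr (Eventually.of_forall hgh)
  have h0 : ∫ x, 𝓕⁻ h x = 0 := by
    refine integral_fourierInv_eq_zero (continuous_symbolMul (by linarith) _) hh hg' ?_
    rw [hhdef, symbolMul, norm_zero, mul_zero, Real.zero_rpow (by linarith)]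
    simp
  have hx : ∀ ξ : En n, ξ ≠ 0 → (2 * Real.pi * ‖ξ‖) ^ (2 * s) * ‖ξ‖ ^ (-(n : ℝ)) =
      (2 * Real.pi) ^ (2 * s) * ‖ξ‖ ^ (2 * s - n) := fun ξ hξ => by
    have hξ' := norm_pos_iff.2 hξ
    rw [Real.mul_rpow (by positivity) hξ'.le, mul_assoc, ← Real.rpow_add hξ', sub_eq_add_neg]
  refine ⟨?_, ?_⟩
  · simp_rw [← hgh, integral_complex_ofReal] at h0
    exact_mod_cast h0
  have hlog := integral_fourierInv_mul_log hn hh (by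
      refine ((integrable_norm_rpow_mul_norm_schwartz hn (q := 2 * s - n) (by linarith)
        (𝓕 f)).const_mul ((2 * Real.pi) ^ (2 * s))).congr ((ae_ne_zero hn).mono fun ξ hξ => ?_)
      simp only [hhdef, symbolMul]
      rw [norm_mul, Complex.norm_real, Real.norm_of_nonneg (by positivity), ← mul_assoc,
        ← mul_assoc, ← hx ξ hξ]
      ring) hg' (by
      refine hgl.norm.congr (Eventually.of_forall fun x => ?_)
      simp only
      rw [← hgh, norm_mul, Complex.norm_real, Real.norm_eq_abs (Real.log _)]) h0
  have hri := integral_fourier_mul_norm_rpow hn (by linarith) hsn f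
  have e1 : ∫ ξ, h ξ * ((‖ξ‖ ^ (-(n : ℝ)) : ℝ) : ℂ) = (((2 * Real.pi) ^ (2 * s) : ℝ) : ℂ) *
      ∫ ξ, (𝓕 f : SchwartzMap (En n) ℂ) ξ * ((‖ξ‖ ^ (2 * s - n) : ℝ) : ℂ) := by
    rw [← integral_const_mul]
    refine integral_congr_ae ((ae_ne_zero hn).mono fun ξ hξ => ?_)
    simp only [hhdef, symbolMul]
    rw [mul_right_comm, ← Complex.ofReal_mul, hx ξ hξ]
    push_cast
    ring
  have e2 : ∫ x, 𝓕⁻ h x * ((Real.log ‖x‖ : ℝ) : ℂ) = ((∫ x, g x * Real.log ‖x‖ : ℝ) : ℂ) := by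
    rw [← integral_complex_ofReal]
    simp_rw [← hgh, Complex.ofReal_mul]
  have e3 : ∫ x, f x * ((‖x‖ ^ (-(2 * s)) : ℝ) : ℂ) =
      ((∫ x, w x * ‖x‖ ^ (-(2 * s)) : ℝ) : ℂ) := by
    rw [← integral_complex_ofReal]
    simp_rw [hf, Complex.ofReal_mul]
  set J := ∫ ξ, (𝓕 f : SchwartzMap (En n) ℂ) ξ * ((‖ξ‖ ^ (2 * s - n) : ℝ) : ℂ)
  set L := ∫ x, g x * Real.log ‖x‖
  set I := ∫ x, w x * ‖x‖ ^ (-(2 * s))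
  rw [e1, e2] at hlog
  rw [e3] at hri
  have hG : 0 < Real.Gamma (n / 2 - s) := Real.Gamma_pos_of_pos (by linarith)
  have hp : (2 * Real.pi) ^ (2 * s) = 4 ^ s * Real.pi ^ (2 * s - n / 2) * Real.pi ^ ((n : ℝ) / 2) := by
    rw [mul_assoc, ← Real.rpow_add hπ, Real.mul_rpow two_pos.le hπ.le, Real.rpow_mul two_pos.le]
    norm_num
  have hpi : Real.pi ^ (-((n : ℝ) / 2)) * Real.pi ^ ((n : ℝ) / 2) = 1 := by
    rw [← Real.rpow_add hπ, neg_add_cancel, Real.rpow_zero]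
  have key : ((Real.Gamma (n / 2 - s) * (-2 * L) : ℝ) : ℂ) =
      ((4 ^ s * Real.Gamma (n / 2) * Real.Gamma s * I : ℝ) : ℂ) := by
    have hpi' := congrArg (fun r : ℝ => (r : ℂ)) hpi
    rw [hp] at hlog
    push_cast at hlog hri hpi' ⊢
    rw [hlog]
    linear_combination (((4 ^ s : ℝ) : ℂ) * Real.Gamma (n / 2)) * hri +
      (Real.Gamma (n / 2 - s) * Real.Gamma (n / 2) * ((4 ^ s : ℝ) : ℂ) *
        ((Real.pi ^ (2 * s - n / 2) : ℝ) : ℂ) * J) * hpi'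
  have key' : Real.Gamma (n / 2 - s) * (-2 * L) =
      4 ^ s * Real.Gamma (n / 2) * Real.Gamma s * I := by exact_mod_cast key
  rw [show ((n : ℝ) - 2 * s) / 2 = n / 2 - s by ring, add_comm 1 s,
    Real.Gamma_add_one (by linarith)]
  rw [mul_div_assoc', div_mul_eq_mul_div, eq_div_iff hG.ne']
  linear_combination s * key'

theorem exists_eq_comp_norm {n : ℕ} (hn : 0 < n) {X : Type*} {g : En n → X}
    (hg : ∀ (A : En n ≃ₗᵢ[ℝ] En n) x, g (A x) = g x) : ∃ G : ℝ → X, ∀ x, g x = G ‖x‖ := by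
  refine ⟨fun r => g (r • EuclideanSpace.single ⟨0, hn⟩ 1), fun x => ?_⟩
  have h : ‖x‖ = ‖‖x‖ • (EuclideanSpace.single ⟨0, hn⟩ 1 : En n)‖ := by
    rw [norm_smul, norm_norm, PiLp.norm_single, norm_one, mul_one]
  beta_reduce
  rw [← Submodule.reflection_sub h, hg]

theorem fracLap_neg_lap_radial {n : ℕ} (hn : 0 < n) {s : ℝ} (h1 : 1 < s) (h2 : s < 2)
    {W : ℝ → ℝ} (f : SchwartzMap (En n) ℂ) (hf : ∀ x, f x = (W ‖x‖ : ℝ)) :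
    ∃ G : ℝ → ℝ, ∀ x : En n, fracLap n (s - 1) (fun z => -(lap (fun y => W ‖y‖) z)) x = G ‖x‖ := by
  refine exists_eq_comp_norm hn fun A x => Complex.ofReal_injective ?_
  rw [ofReal_fracLap_neg_lap_eq hn h1 h2 f hf, ofReal_fracLap_neg_lap_eq hn h1 h2 f hf,
    ← Real.fourierInv_comp_linearIsometry]
  have hfA : (f : En n → ℂ) ∘ A = f := funext fun x => by simp [hf]
  suffices symbolMul (2 * s) (𝓕 f) ∘ A = symbolMul (2 * s) (𝓕 f) by rw [this]
  ext ξ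
  simp only [Function.comp, symbolMul, LinearIsometryEquiv.norm_map, SchwartzMap.fourier_coe]
  rw [← Real.fourier_comp_linearIsometry, hfA]

/-- The angular mean of `e^τ` is determined by the equation satisfied by `τ(x/|x|) - 2s log|x|`. -/
theorem average_exp_eq {n : ℕ} {s : ℝ} (h1 : 1 < s) (h2 : s < 2) (hsn : 2 * s < n)
    {τ : sphere (0 : En n) 1 → ℝ} (hτ : Continuous τ) {u : En n → ℝ}
    (hu : ∀ (x : En n) (_ : x ≠ 0) (h : ‖x‖⁻¹ • x ∈ sphere (0 : En n) 1),
      u x = τ ⟨‖x‖⁻¹ • x, h⟩ - 2 * s * Real.log ‖x‖)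
    {W : ℝ → ℝ} (f : SchwartzMap (En n) ℂ) (hf : ∀ x, f x = (W ‖x‖ : ℝ))
    (hW : 0 < ∫ x : En n, W ‖x‖ * ‖x‖ ^ (-(2 * s)))
    (heq : ∫ x, u x * fracLap n (s - 1) (fun z => -(lap (fun y : En n => W ‖y‖) z)) x =
      ∫ x, Real.exp (u x) * W ‖x‖) :
    ⨍ θ, Real.exp (τ θ) ∂(volume : Measure (En n)).toSphere =
      4 ^ s * (Real.Gamma (n / 2) * Real.Gamma (1 + s) / Real.Gamma ((n - 2 * s) / 2)) := by
  have hn : 0 < n := by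
    have : (0 : ℝ) < n := by linarith
    exact_mod_cast this
  set B := ⨍ θ, Real.exp (τ θ) ∂(volume : Measure (En n)).toSphere with hB
  set g := fracLap n (s - 1) fun z => -(lap (fun y : En n => W ‖y‖) z) with hgdef
  obtain ⟨G, hG⟩ := fracLap_neg_lap_radial hn h1 h2 f hf
  have hms : ∀ x : En n, x ≠ 0 → ‖x‖⁻¹ • x ∈ sphere (0 : En n) 1 := fun x hx => by
    rw [mem_sphere_zero_iff_norm, norm_smul, norm_inv, norm_norm,
      inv_mul_cancel₀ (norm_ne_zero_iff.2 hx)]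
  have hexp : ∫ x, Real.exp (u x) * W ‖x‖ = B * ∫ x : En n, W ‖x‖ * ‖x‖ ^ (-(2 * s)) := by
    rw [hB, ← integral_angular_mul_radial hn (fun θ => Real.exp (τ θ))
      (fun x => Real.exp (u x + 2 * s * Real.log ‖x‖)) (fun x hx h => by rw [hu x hx h]; simp)
      (fun r => W r * r ^ (-(2 * s)))]
    refine integral_congr_ae ((ae_ne_zero hn).mono fun x hx => ?_)
    simp only
    rw [Real.rpow_def_of_pos (norm_pos_iff.2 hx), Real.exp_add, mul_comm (W _), ← mul_assoc,
      mul_assoc (Real.exp (u x)), ← Real.exp_add]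
    ring_nf
    simp
  have hBpos : 0 < B := by
    have hτi : Integrable (fun θ => Real.exp (τ θ)) (volume : Measure (En n)).toSphere := by
      refine (Continuous.integrable_of_hasCompactSupport (by fun_prop) ?_)
      exact HasCompactSupport.of_compactSpace _
    obtain ⟨θ, hθ⟩ := exists_le_average (μ := (volume : Measure (En n)).toSphere) (by
      rw [Ne, Measure.toSphere_eq_zero_iff_finrank]
      simp [hn.ne']) hτi
    exact (Real.exp_pos _).trans_le hθ
  have hug : Integrable fun x => u x * g x := by
    refine Integrable.of_integral_ne_zero ?_
    rw [heq, hexp]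
    exact (mul_pos hBpos hW).ne'
  have hh : Integrable (symbolMul (2 * s) (𝓕 f)) := integrable_symbolMul hn (by linarith) _
  have hgh : ∀ x, (g x : ℂ) = 𝓕⁻ (symbolMul (2 * s) (𝓕 f)) x :=
    ofReal_fracLap_neg_lap_eq hn h1 h2 f hf
  have hgc : Continuous g := by
    have : g = fun x => (𝓕⁻ (symbolMul (2 * s) (𝓕 f)) x).re := funext fun x => by simp [← hgh]
    rw [this]
    exact Complex.continuous_re.comp (continuous_fourierInv hh)
  obtain ⟨K, hK⟩ : ∃ K, ∀ x, |g x| ≤ K := ⟨_, fun x => by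
    rw [← Real.norm_eq_abs, ← Complex.norm_real, hgh]
    exact norm_fourierInv_le _ x⟩
  obtain ⟨M, hM⟩ : ∃ M, ∀ θ, |τ θ| ≤ M := by
    obtain ⟨M, hM⟩ := isCompact_univ.exists_bound_of_continuousOn hτ.continuousOn
    exact ⟨M, fun θ => hM θ (mem_univ _)⟩
  have hlogu : ∀ x : En n, x ≠ 0 → 2 * s * |Real.log ‖x‖| ≤ |u x| + M := fun x hx => by
    have e : 2 * s * Real.log ‖x‖ = τ ⟨_, hms x hx⟩ - u x := by
      rw [hu x hx (hms x hx)]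
      ring
    calc 2 * s * |Real.log ‖x‖| = |2 * s * Real.log ‖x‖| := by
          rw [abs_mul, abs_of_pos (by linarith : 0 < 2 * s)]
      _ ≤ |τ ⟨_, hms x hx⟩| + |u x| := e ▸ abs_sub _ _
      _ ≤ |u x| + M := by linarith [hM ⟨_, hms x hx⟩]
  have hgi : Integrable g := by
    set R := Real.exp ((M + 1) / (2 * s)) with hR
    have hi : Integrable ((closedBall (0 : En n) R).indicator fun _ => K) :=
      (integrable_indicator_iff measurableSet_closedBall).2
        (integrableOn_const measure_closedBall_lt_top.ne)
    refine (hug.norm.add hi).mono' hgc.aestronglyMeasurable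
      ((ae_ne_zero hn).mono fun x hx => ?_)
    simp only [Pi.add_apply, Real.norm_eq_abs]
    by_cases hxR : x ∈ closedBall (0 : En n) R
    · rw [indicator_of_mem hxR]
      linarith [hK x, abs_nonneg (u x * g x)]
    · rw [indicator_of_notMem hxR, add_zero, abs_mul]
      refine le_mul_of_one_le_left (abs_nonneg _) ?_
      rw [mem_closedBall_zero_iff, not_le] at hxR
      have h3 : (M + 1) / (2 * s) < Real.log ‖x‖ := (Real.lt_log_iff_exp_lt (norm_pos_iff.2 hx)).2 hxR
      rw [div_lt_iff₀ (by linarith)] at h3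
      nlinarith [hlogu x hx, le_abs_self (Real.log ‖x‖)]
  have hgl : Integrable fun x => g x * Real.log ‖x‖ := by
    refine ((hug.norm.add (hgi.norm.const_mul M)).const_mul (2 * s)⁻¹).mono' (by
      have := hgc.measurable
      exact Measurable.aestronglyMeasurable (by fun_prop)) ((ae_ne_zero hn).mono fun x hx => ?_)
    simp only [Pi.add_apply, Real.norm_eq_abs, abs_mul]
    rw [inv_mul_eq_div, le_div_iff₀ (by linarith)]
    nlinarith [hlogu x hx, abs_nonneg (g x)]
  obtain ⟨hg0, hgL⟩ := integral_fracLap_neg_lap_mul_log hn h1 h2 hsn f hf hgi hgl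
  have hτg : ∫ x, (u x + 2 * s * Real.log ‖x‖) * g x = 0 := by
    have h := integral_angular_mul_radial hn τ (fun x => u x + 2 * s * Real.log ‖x‖)
      (fun x hx h => by rw [hu x hx h]; ring) G
    simp_rw [← hG] at h
    exact h.trans (by rw [hg0, mul_zero])
  have hsum : ∫ x, u x * g x = -(2 * s) * ∫ x, g x * Real.log ‖x‖ := by
    rw [← integral_const_mul, ← sub_eq_zero, ← integral_sub hug (hgl.const_mul _), ← hτg]
    congr 1 with x
    ring
  rw [hsum, hgL, hexp] at heq
  exact (mul_right_cancel₀ hW.ne' heq).symm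

/-- (Theorem 3.1 of the paper.) Let `1 < s < 2`, `n > 2s`, and assume the
strict inequality `Γ((n+2s)/4)²/Γ((n-2s)/4)² < Γ(n/2)Γ(1+s)/Γ((n-2s)/2)`.  Then there is no
continuous `τ : 𝕊^{n-1} → ℝ` such that `u(x) = τ(x/|x|) - 2s log|x|` is a distributional
solution of `(-Δ)^s u = e^u` (tested as `∫ u ·(-Δ)^{s-1}(-Δφ) = ∫ e^u φ`) which satisfies the
stability inequality `∫ e^u φ² ≤ ∫ |(-Δ)^{s/2}φ|²` for all `φ ∈ C_c^∞(ℝ^n)`. -/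
theorem no_stable_homogeneous_solution_fractional
    (n : ℕ) (s : ℝ) (hs1 : 1 < s) (hs2 : s < 2) (hn : 2 * s < (n : ℝ))
    (hcond : Real.Gamma (((n : ℝ) + 2 * s) / 4) ^ 2 / Real.Gamma (((n : ℝ) - 2 * s) / 4) ^ 2 <
      Real.Gamma ((n : ℝ) / 2) * Real.Gamma (1 + s) / Real.Gamma (((n : ℝ) - 2 * s) / 2)) :
    ¬ ∃ (τ : Metric.sphere (0 : En n) 1 → ℝ) (u : En n → ℝ), Continuous τ ∧
      (∀ (x : En n) (hx : x ≠ 0),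
        u x = τ ⟨‖x‖⁻¹ • x, by
          have hx' : ‖x‖ ≠ 0 := norm_ne_zero_iff.mpr hx
          simp [mem_sphere_zero_iff_norm, norm_smul, Real.norm_eq_abs,
            abs_of_nonneg (norm_nonneg x), inv_mul_cancel₀ hx']⟩ - 2 * s * Real.log ‖x‖) ∧
      (∀ φ : En n → ℝ, TestOn n Set.univ φ →
        ∫ x, u x * fracLap n (s - 1) (fun z => -(lap φ z)) x = ∫ x, Real.exp (u x) * φ x) ∧
      (∀ φ : En n → ℝ, TestOn n Set.univ φ →
        ∫ x, Real.exp (u x) * φ x ^ 2 ≤ ∫ x, (fracLap n (s / 2) φ x) ^ 2) := by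
  rintro ⟨τ, u, hτ, hu, heq, hstab⟩
  have hn0 : 0 < n := by
    have : (0 : ℝ) < n := by linarith
    exact_mod_cast this
  set B := ⨍ θ, Real.exp (τ θ) ∂(volume : Measure (En n)).toSphere with hB
  have hexp : ∀ x : En n, x ≠ 0 →
      Real.exp (u x) = Real.exp (u x + 2 * s * Real.log ‖x‖) * ‖x‖ ^ (-(2 * s)) := fun x hx => by
    rw [Real.rpow_def_of_pos (norm_pos_iff.2 hx), ← Real.exp_add]
    ring_nf
  have hT : TestOn n univ fun x => bumpProfile ‖x‖ :=
    ⟨contDiff_bumpProfile_norm, hasCompactSupport_bumpProfile_norm, subset_univ _⟩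
  have hg₁ : HasCompactSupport (Complex.ofRealCLM ∘ fun x : En n => bumpProfile ‖x‖) :=
    hT.2.1.comp_left rfl
  have hg₂ : ContDiff ℝ (⊤ : ℕ∞) (Complex.ofRealCLM ∘ fun x : En n => bumpProfile ‖x‖) :=
    Complex.ofRealCLM.contDiff.comp hT.1
  have hf : ∀ x, hg₁.toSchwartzMap hg₂ x = ((bumpProfile ‖x‖ : ℝ) : ℂ) := fun x => rfl
  have hpos : 0 < ∫ x : En n, bumpProfile ‖x‖ * ‖x‖ ^ (-(2 * s)) := by
    have hnn : ∀ x : En n, 0 ≤ bumpProfile ‖x‖ * ‖x‖ ^ (-(2 * s)) := fun x =>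
      mul_nonneg (bumpProfile_nonneg _) (by positivity)
    have hi : Integrable fun x : En n => bumpProfile ‖x‖ * ‖x‖ ^ (-(2 * s)) := by
      refine (integrable_norm_rpow_mul_norm_schwartz hn0 (q := -(2 * s)) (by linarith)
        (hg₁.toSchwartzMap hg₂)).congr (Eventually.of_forall fun x => ?_)
      simp only
      rw [hf, Complex.norm_real, Real.norm_of_nonneg (bumpProfile_nonneg _), mul_comm]
    rw [integral_pos_iff_support_of_nonneg hnn hi]
    refine (measure_ball_pos volume (0 : En n) one_pos).trans_le
      (measure_mono_ae ((ae_ne_zero hn0).mono fun x hx hx1 => ?_))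
    have hx1' : ‖x‖ < 1 := mem_ball_zero_iff.1 hx1
    have : bumpProfile ‖x‖ * ‖x‖ ^ (-(2 * s)) ≠ 0 := by
      rw [bumpProfile_eq_one (by rw [abs_norm]; exact hx1'.le), one_mul]
      exact (Real.rpow_pos_of_pos (norm_pos_iff.2 hx) _).ne'
    exact this
  have hA := average_exp_eq hs1 hs2 hn hτ (fun x hx _ => hu x hx) _ hf hpos (heq _ hT)
  have hle : B ≤ 4 ^ s * (Real.Gamma ((n + 2 * s) / 4) ^ 2 / Real.Gamma ((n - 2 * s) / 4) ^ 2) := by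
    refine hardy_constant_le hn0 (by linarith) hs2 hn fun W hW => ?_
    refine le_trans (le_of_eq ?_) (hstab _ hW)
    rw [hB, ← integral_angular_mul_radial hn0 (fun θ => Real.exp (τ θ))
      (fun x => Real.exp (u x + 2 * s * Real.log ‖x‖)) (fun x hx _ => by rw [hu x hx]; simp)
      (fun r => r ^ (-(2 * s)) * W r ^ 2)]
    refine integral_congr_ae ((ae_ne_zero hn0).mono fun x hx => ?_)
    simp only
    rw [hexp x hx, ← mul_assoc]
  rw [hB, hA] at hle
  exact absurd (le_of_mul_le_mul_left hle (by positivity)) hcond.not_ge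
end
end

section
/- Let $n>4$ and let $\omega:\mathbb{S}^{n-1}\to\mathbb{R}$ be continuous. Suppose the homogeneous function $u(x):=-4\log|x|+\omega(x/|x|)$ on $\mathbb{R}^n\setminus\{0\}$ satisfies: (i) $e^u\in L^1_{\mathrm{loc}}(\mathbb{R}^n\setminus\{0\})$; (ii) $\int_{\mathbb{R}^n} u\,\Delta^2\varphi\,dx = \int_{\mathbb{R}^n} e^u\varphi\,dx$ for every $\varphi\in C_c^\infty(\mathbb{R}^n\setminus\{0\})$ (weak solution of $\Delta^2 u = e^u$ in $\mathbb{R}^n\setminus\{0\}$); and (iii) the stability inequality $\int_{\mathbb{R}^n} e^{u}\phi^2\,dx \le \int_{\mathbb{R}^n}(\Delta\phi)^2\,dx$ for every $\phi\in C_c^\infty(\mathbb{R}^n\setminus\{0\})$. Then $\frac{n^2(n-4)^2}{16} \ge 8(n-2)(n-4)$. -/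
open MeasureTheory Metric Filter Set

noncomputable section

/-- `u` is stable outside the ball `B_R` in the fourth-order sense:
`∫ e^u φ² ≤ ∫ (Δφ)²` for all `φ ∈ C_c^∞(ℝ^n \ closure B_R)`. -/
def Stable4OutsideBall (n : ℕ) (u : En n → ℝ) (R : ℝ) : Prop :=
  ∀ φ : En n → ℝ, TestOn n (Metric.closedBall (0 : En n) R)ᶜ φ →
    ∫ x, Real.exp (u x) * φ x ^ 2 ≤ ∫ x, (lap φ x) ^ 2

/-- Smooth functions on `ℝ` with compact support in the open half-line `(0, ∞)`. -/
structure IsPosTest (g : ℝ → ℝ) : Prop where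
  smooth : ContDiff ℝ (⊤ : ℕ∞) g
  compact : HasCompactSupport g
  pos : tsupport g ⊆ Ioi 0

namespace IsPosTest

variable {g : ℝ → ℝ}

lemma eq_zero_of_nonpos (hg : IsPosTest g) {t : ℝ} (ht : t ≤ 0) : g t = 0 :=
  image_eq_zero_of_notMem_tsupport fun h => not_lt.mpr ht (hg.pos h)

protected lemma deriv (hg : IsPosTest g) : IsPosTest (deriv g) :=
  ⟨(contDiff_infty_iff_deriv.mp hg.smooth).2, hg.compact.deriv,
    (tsupport_deriv_subset).trans hg.pos⟩

lemma mul_left (hg : IsPosTest g) {f : ℝ → ℝ} (hf : ContDiff ℝ (⊤ : ℕ∞) f) :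
    IsPosTest (fun t => f t * g t) :=
  ⟨hf.mul hg.smooth, hg.compact.mul_left, tsupport_mul_subset_right.trans hg.pos⟩

lemma add (hg : IsPosTest g) {f : ℝ → ℝ} (hf : IsPosTest f) :
    IsPosTest (fun t => f t + g t) :=
  ⟨hf.smooth.add hg.smooth, hf.compact.add hg.compact,
    (tsupport_add f g).trans (union_subset hf.pos hg.pos)⟩

lemma comp_mul_left (hg : IsPosTest g) {c : ℝ} (hc : 0 < c) :
    IsPosTest (fun t => g (c * t)) := by
  refine ⟨hg.smooth.comp (contDiff_const.mul contDiff_id),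
    hg.compact.comp_homeomorph (Homeomorph.mulLeft₀ c hc.ne'), ?_⟩
  intro t ht
  have h := tsupport_comp_subset_preimage g (f := fun t => c * t) (by fun_prop) ht
  exact pos_of_mul_pos_right (hg.pos h) hc.le

lemma differentiable (hg : IsPosTest g) : Differentiable ℝ g :=
  hg.smooth.differentiable (by simp)

lemma continuous (hg : IsPosTest g) : Continuous g := hg.smooth.continuous

lemma hasDerivAt (hg : IsPosTest g) (t : ℝ) : HasDerivAt g (deriv g t) t :=
  (hg.differentiable t).hasDerivAt

lemma integrable (hg : IsPosTest g) : Integrable g :=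
  hg.continuous.integrable_of_hasCompactSupport hg.compact

lemma integral_deriv (hg : IsPosTest g) : ∫ t, deriv g t = 0 :=
  integral_eq_zero_of_hasDerivAt_of_integrable hg.hasDerivAt hg.deriv.integrable hg.integrable

lemma integral_id_mul_deriv (hg : IsPosTest g) : ∫ t, t * deriv g t = -∫ t, g t := by
  have h := integral_mul_deriv_eq_deriv_mul_of_integrable (u := fun t : ℝ => t) (v := g)
    (u' := fun _ => 1) (v' := deriv g) (fun x _ => hasDerivAt_id x) (fun x _ => hg.hasDerivAt x)
    (hg.deriv.mul_left contDiff_id).integrable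
    (hg.mul_left contDiff_const).integrable (hg.mul_left contDiff_id).integrable
  simpa using h

lemma eventuallyEq_zero {m : ℕ} (hg : IsPosTest g) :
    (fun y : En m => g (Real.log ‖y‖)) =ᶠ[nhds 0] fun _ => 0 := by
  filter_upwards [ball_mem_nhds (0 : En m) one_pos] with y hy
  exact hg.eq_zero_of_nonpos
    (Real.log_nonpos (norm_nonneg y) (mem_ball_zero_iff.mp hy).le)

lemma testOn {m : ℕ} (hg : IsPosTest g) :
    TestOn m {(0 : En m)}ᶜ (fun x => g (Real.log ‖x‖)) := by
  refine ⟨?_, ?_, ?_⟩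
  · refine contDiff_iff_contDiffAt.mpr fun x => ?_
    rcases eq_or_ne x 0 with rfl | hx
    · exact contDiffAt_const.congr_of_eventuallyEq hg.eventuallyEq_zero
    · exact hg.smooth.contDiffAt.comp x
        ((contDiffAt_norm ℝ hx).log (norm_ne_zero_iff.mpr hx))
  · obtain ⟨R, hR⟩ := hg.compact.isCompact.isBounded.subset_closedBall 0
    refine HasCompactSupport.intro (isCompact_closedBall (0 : En m) (Real.exp R)) fun x hx => ?_
    refine image_eq_zero_of_notMem_tsupport fun h => hx ?_
    have h1 : Real.log ‖x‖ ≤ R := (le_abs_self _).trans (by simpa using hR h)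
    have h0 : 0 < ‖x‖ := by
      rcases (norm_nonneg x).eq_or_lt with h0 | h0
      · have := hg.pos h
        simp [← h0] at this
      · exact h0
    simpa using (Real.log_le_iff_le_exp h0).mp h1
  · intro x hx
    rintro rfl
    exact notMem_tsupport_iff_eventuallyEq.mpr hg.eventuallyEq_zero hx

end IsPosTest

/-- The Laplacian on radial functions of `ℝ^m` in the logarithmic variable `t = log |x|`. -/
def logLap (m : ℕ) (g : ℝ → ℝ) (t : ℝ) : ℝ :=
  Real.exp (-2 * t) * (deriv (deriv g) t + ((m : ℝ) - 2) * deriv g t)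

lemma IsPosTest.logLap {g : ℝ → ℝ} (hg : IsPosTest g) (m : ℕ) : IsPosTest (logLap m g) :=
  ((hg.deriv.mul_left contDiff_const).add hg.deriv.deriv).mul_left (by fun_prop)

lemma hasFDerivAt_comp_log_norm {m : ℕ} {g : ℝ → ℝ} {x : En m} (hx : x ≠ 0)
    (hg : DifferentiableAt ℝ g (Real.log ‖x‖)) :
    HasFDerivAt (fun y : En m => g (Real.log ‖y‖))
      ((deriv g (Real.log ‖x‖) * (‖x‖ ^ 2)⁻¹) • innerSL ℝ x) x := by
  have hx2 : ‖x‖ ^ 2 ≠ 0 := by positivity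
  have h1 : HasFDerivAt (fun y : En m => Real.log ‖y‖) ((‖x‖ ^ 2)⁻¹ • innerSL ℝ x) x := by
    have h := ((hasStrictFDerivAt_norm_sq x).hasFDerivAt.log hx2).const_mul (1 / 2 : ℝ)
    have e : (fun y : En m => (1 / 2 : ℝ) * Real.log (‖y‖ ^ 2)) = fun y => Real.log ‖y‖ := by
      funext y
      rw [Real.log_pow]
      push_cast
      ring
    have e' : (1 / 2 : ℝ) • (‖x‖ ^ 2)⁻¹ • 2 • innerSL ℝ x = (‖x‖ ^ 2)⁻¹ • innerSL ℝ x := by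
      module
    rwa [e, e'] at h
  have := hg.hasDerivAt.comp_hasFDerivAt x h1
  rwa [smul_smul] at this

lemma lap_comp_log_norm {m : ℕ} {g : ℝ → ℝ} (hg : IsPosTest g) (x : En m) :
    lap (fun y : En m => g (Real.log ‖y‖)) x = logLap m g (Real.log ‖x‖) := by
  rcases eq_or_ne x 0 with rfl | hx
  · have h1 : ∀ v : En m, (fun y => fderiv ℝ (fun y : En m => g (Real.log ‖y‖)) y v)
        =ᶠ[nhds 0] fun _ => 0 := by
      intro v
      filter_upwards [hg.eventuallyEq_zero.eventuallyEq_nhds] with y hy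
      simp [hy.fderiv_eq]
    rw [norm_zero, Real.log_zero, (hg.logLap m).eq_zero_of_nonpos le_rfl]
    exact Finset.sum_eq_zero fun i _ => by simp [(h1 _).fderiv_eq]
  · have hx2 : ‖x‖ ^ 2 ≠ 0 := by positivity
    have key : ∀ v : En m,
        fderiv ℝ (fun y => fderiv ℝ (fun y : En m => g (Real.log ‖y‖)) y v) x v =
          deriv g (Real.log ‖x‖) * (‖x‖ ^ 2)⁻¹ * ‖v‖ ^ 2 +
          (deriv (deriv g) (Real.log ‖x‖) - 2 * deriv g (Real.log ‖x‖)) *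
            ((‖x‖ ^ 2)⁻¹) ^ 2 * (inner ℝ x v) ^ 2 := by
      intro v
      have e : (fun y => fderiv ℝ (fun y : En m => g (Real.log ‖y‖)) y v) =ᶠ[nhds x]
          fun y => deriv g (Real.log ‖y‖) * (‖y‖ ^ 2)⁻¹ * inner ℝ y v := by
        filter_upwards [isOpen_ne.mem_nhds hx] with y hy
        rw [(hasFDerivAt_comp_log_norm hy (hg.differentiable _)).fderiv]
        simp
      rw [e.fderiv_eq]
      have hi : HasFDerivAt (fun y : En m => inner ℝ y v) (innerSL ℝ v) x := by
        have := (innerSL ℝ v).hasFDerivAt (x := x)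
        convert this using 1
        funext y
        simp [real_inner_comm]
      have hn := (hasDerivAt_inv hx2).comp_hasFDerivAt x (hasStrictFDerivAt_norm_sq x).hasFDerivAt
      have := ((hasFDerivAt_comp_log_norm hx (hg.deriv.differentiable _)).mul hn).mul hi
      erw [this.fderiv]
      simp
      field_simp
      ring
    unfold lap
    simp_rw [key]
    rw [Finset.sum_add_distrib, ← Finset.mul_sum, ← Finset.mul_sum]
    have hs : ∑ i, (inner ℝ x (EuclideanSpace.single i (1 : ℝ))) ^ 2 = ‖x‖ ^ 2 := by
      rw [EuclideanSpace.real_norm_sq_eq]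
      simp [EuclideanSpace.inner_single_right]
    have he : Real.exp (-2 * Real.log ‖x‖) = (‖x‖ ^ 2)⁻¹ := by
      rw [show -2 * Real.log ‖x‖ = -(Real.log (‖x‖ ^ 2)) by rw [Real.log_pow]; push_cast; ring,
        Real.exp_neg, Real.exp_log (by positivity)]
    rw [hs, logLap, he]
    simp
    field_simp
    ring

/-- The direction `x / |x|` of a nonzero vector, as a point of the unit sphere. -/
def direction {n : ℕ} (x : En n) (hx : x ≠ 0) : sphere (0 : En n) 1 :=
  (homeomorphUnitSphereProd (En n) ⟨x, hx⟩).1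

/-- The surface measure on the unit sphere. -/
abbrev surface (n : ℕ) : Measure (sphere (0 : En n) 1) := (volume : Measure (En n)).toSphere

lemma integral_volumeIoiPow_comp_log {n : ℕ} (hn : 0 < n) (f : ℝ → ℝ) :
    ∫ r : Ioi (0 : ℝ), f (Real.log r) ∂(Measure.volumeIoiPow (n - 1)) =
      ∫ t, Real.exp (n * t) * f t := by
  have h1 : ∫ r : Ioi (0 : ℝ), f (Real.log r) ∂(Measure.volumeIoiPow (n - 1)) =
      ∫ r in Ioi (0 : ℝ), r ^ (n - 1) • f (Real.log r) := by
    simp only [Measure.volumeIoiPow, ENNReal.ofReal]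
    rw [integral_withDensity_eq_integral_smul,
      integral_subtype_comap measurableSet_Ioi
        fun a ↦ Real.toNNReal (a ^ (n - 1)) • f (Real.log a),
      setIntegral_congr_fun measurableSet_Ioi fun x hx ↦ ?_]
    · rw [NNReal.smul_def, Real.coe_toNNReal _ (pow_nonneg hx.out.le _)]
    · exact (measurable_subtype_coe.pow_const _).real_toNNReal
  have h2 := integral_image_eq_integral_abs_deriv_smul MeasurableSet.univ
    (fun x _ => (Real.hasDerivAt_exp x).hasDerivWithinAt) Real.exp_injective.injOn
    (fun r => r ^ (n - 1) • f (Real.log r))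
  rw [image_univ, Real.range_exp, setIntegral_univ] at h2
  rw [h1, h2]
  refine integral_congr_ae (Eventually.of_forall fun t => ?_)
  obtain ⟨k, rfl⟩ := Nat.exists_eq_succ_of_ne_zero hn.ne'
  simp only [Real.abs_exp, Real.log_exp, smul_eq_mul, ← Real.exp_nat_mul, Nat.succ_sub_one,
    ← mul_assoc, ← Real.exp_add]
  push_cast
  ring_nf

section Polar

variable {n : ℕ} {a : sphere (0 : En n) 1 → ℝ} {f : ℝ → ℝ} {F : En n → ℝ}

lemma integral_polar (hn : 0 < n)
    (hF : ∀ (x : En n) (hx : x ≠ 0), F x = a (direction x hx) * f (Real.log ‖x‖)) :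
    ∫ x, F x = (∫ θ, a θ ∂(surface n)) * ∫ t, Real.exp (n * t) * f t := by
  have : Nonempty (Fin n) := ⟨⟨0, hn⟩⟩
  have h := (volume : Measure (En n)).measurePreserving_homeomorphUnitSphereProd.integral_comp
    (Homeomorph.measurableEmbedding _) (fun p => a p.1 * f (Real.log p.2))
  calc
    ∫ x, F x = ∫ x : ({(0)}ᶜ : Set (En n)), F x.1 ∂(volume.comap Subtype.val) := by
      rw [integral_subtype_comap (measurableSet_singleton _).compl F, restrict_compl_singleton]
    _ = ∫ p, a p.1 * f (Real.log p.2) ∂((surface n).prod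
          (.volumeIoiPow (Module.finrank ℝ (En n) - 1))) := by
      rw [← h]
      refine integral_congr_ae (Eventually.of_forall fun x => ?_)
      simp only [homeomorphUnitSphereProd_apply_snd_coe]
      exact hF x x.2
    _ = _ := by
      rw [integral_prod_mul a (fun r : Ioi (0 : ℝ) => f (Real.log r)), finrank_euclideanSpace_fin,
        integral_volumeIoiPow_comp_log hn]

lemma integrable_polar (hn : 0 < n) (ha : Continuous a) (hf : IsPosTest f)
    (hF : ∀ (x : En n) (hx : x ≠ 0), F x = a (direction x hx) * f (Real.log ‖x‖)) :
    Integrable F := by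
  have : Nonempty (Fin n) := ⟨⟨0, hn⟩⟩
  have transfer : ∀ (b : sphere (0 : En n) 1 → ℝ) (G : En n → ℝ),
      (∀ (x : En n) (hx : x ≠ 0), G x = b (direction x hx) * f (Real.log ‖x‖)) →
      (Integrable G ↔ Integrable
        (fun p : sphere (0 : En n) 1 × Ioi (0 : ℝ) => b p.1 * f (Real.log p.2))
        ((surface n).prod (.volumeIoiPow (Module.finrank ℝ (En n) - 1)))) := by
    intro b G hG
    rw [← (volume : Measure (En n)).measurePreserving_homeomorphUnitSphereProd.integrable_comp_emb
        (g := fun p => b p.1 * f (Real.log p.2)) (Homeomorph.measurableEmbedding _)]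
    nth_rw 1 [← restrict_compl_singleton (μ := volume) (0 : En n)]
    rw [← IntegrableOn, integrableOn_iff_comap_subtypeVal (by measurability)]
    refine integrable_congr (Eventually.of_forall fun x => ?_)
    simp only [Function.comp_apply, homeomorphUnitSphereProd_apply_snd_coe]
    exact hG x x.2
  have h1 := (transfer (fun _ => 1) (fun x => f (Real.log ‖x‖)) (by simp)).mp
    (hf.testOn.1.continuous.integrable_of_hasCompactSupport hf.testOn.2.1)
  simp only [one_mul] at h1
  rw [Integrable.comp_snd_iff (β := Ioi (0 : ℝ)) (f := fun r => f (Real.log r))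
    (Measure.toSphere_ne_zero _)] at h1
  exact (transfer a F hF).mpr (Integrable.mul_prod
    (ha.integrable_of_hasCompactSupport (HasCompactSupport.of_compactSpace a)) h1)

end Polar

lemma logLap_exp_mul {ψ : ℝ → ℝ} (hψ : IsPosTest ψ) (n : ℕ) (b : ℝ) :
    logLap n (fun t => Real.exp (b * t) * ψ t) = fun t => Real.exp ((b - 2) * t) *
      (deriv (deriv ψ) t + (2 * b + n - 2) * deriv ψ t + b * (b + n - 2) * ψ t) := by
  have hexp : ∀ t, HasDerivAt (fun t => Real.exp (b * t)) (Real.exp (b * t) * b) t := fun t => by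
    simpa using ((hasDerivAt_id t).const_mul b).exp
  have h1 : deriv (fun t => Real.exp (b * t) * ψ t) =
      fun t => Real.exp (b * t) * b * ψ t + Real.exp (b * t) * deriv ψ t :=
    funext fun t => ((hexp t).mul (hψ.hasDerivAt t)).deriv
  have h2 : deriv (deriv (fun t => Real.exp (b * t) * ψ t)) = fun t =>
      (Real.exp (b * t) * b * b * ψ t + Real.exp (b * t) * b * deriv ψ t) +
        (Real.exp (b * t) * b * deriv ψ t + Real.exp (b * t) * deriv (deriv ψ) t) := by
    rw [h1]
    exact funext fun t => ((((hexp t).mul_const b).mul (hψ.hasDerivAt t)).add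
      ((hexp t).mul (hψ.deriv.hasDerivAt t))).deriv
  funext t
  rw [logLap, h2, h1, show (b - 2) * t = -2 * t + b * t by ring, Real.exp_add]
  ring

lemma continuous_integral_test_quadratic {ψ : ℝ → ℝ} (hψ : IsPosTest ψ) (c : ℝ) :
    Continuous fun ε : ℝ =>
      ∫ t, (ε ^ 2 * deriv (deriv ψ) t + 2 * ε * deriv ψ t + c * ψ t) ^ 2 := by
  rw [← continuousOn_univ]
  refine continuousOn_integral_of_compact_support hψ.compact.isCompact ?_ ?_
  · have h0 := hψ.continuous
    have h1 := hψ.deriv.continuous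
    have h2 := hψ.deriv.deriv.continuous
    apply Continuous.continuousOn
    unfold Function.uncurry
    fun_prop
  · intro ε t _ ht
    have h1 : t ∉ tsupport (deriv ψ) := fun h => ht (tsupport_deriv_subset h)
    have h2 : t ∉ tsupport (deriv (deriv ψ)) := fun h => h1 (tsupport_deriv_subset h)
    simp [image_eq_zero_of_notMem_tsupport ht, image_eq_zero_of_notMem_tsupport h1,
      image_eq_zero_of_notMem_tsupport h2]

section Homogeneous

variable {n : ℕ} {ω : sphere (0 : En n) 1 → ℝ} {u : En n → ℝ} {ψ : ℝ → ℝ}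

/-- Testing the weak equation with `|x|^(4-n) ψ(log |x|)` determines the total mass of `e^ω`. -/
lemma integral_exp_of_weak (hn : 0 < n) (hω : Continuous ω)
    (hu : ∀ (x : En n) (hx : x ≠ 0), u x = -4 * Real.log ‖x‖ + ω (direction x hx))
    (hweak : ∀ φ : En n → ℝ, TestOn n {(0 : En n)}ᶜ φ →
      ∫ x, u x * lap (fun y => lap φ y) x = ∫ x, Real.exp (u x) * φ x)
    (hψ : IsPosTest ψ) (hψ0 : ∫ t, ψ t ≠ 0) :
    ∫ θ, Real.exp (ω θ) ∂(surface n) =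
      8 * ((n : ℝ) - 2) * ((n : ℝ) - 4) * (surface n).real univ := by
  set g : ℝ → ℝ := fun t => Real.exp ((4 - n : ℝ) * t) * ψ t with hg_def
  have hg : IsPosTest g := hψ.mul_left (by fun_prop)
  set χ : ℝ → ℝ := fun t => deriv (deriv ψ) t + ((6 - n) * deriv ψ t + -2 * (n - 4) * ψ t)
    with hχ_def
  have hχ : IsPosTest χ :=
    ((hψ.mul_left contDiff_const).add (hψ.deriv.mul_left contDiff_const)).add hψ.deriv.deriv
  have hg1 : logLap n g = fun t => Real.exp ((2 - n : ℝ) * t) * χ t := by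
    rw [hg_def, logLap_exp_mul hψ]
    funext t
    rw [hχ_def]
    ring_nf
  set η : ℝ → ℝ := fun t => deriv (deriv χ) t + (2 - n) * deriv χ t with hη_def
  have hη : IsPosTest η := (hχ.deriv.mul_left contDiff_const).add hχ.deriv.deriv
  set h : ℝ → ℝ := fun t => Real.exp (-n * t) * η t with hh_def
  have hh : IsPosTest h := hη.mul_left (by fun_prop)
  have hg2 : logLap n (logLap n g) = h := by
    rw [hg1, logLap_exp_mul hχ]
    funext t
    rw [hh_def, hη_def]
    ring_nf
  have hlap : lap (fun y => lap (fun x : En n => g (Real.log ‖x‖)) y) =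
      fun x => h (Real.log ‖x‖) := by
    simp_rw [lap_comp_log_norm hg]
    funext x
    rw [lap_comp_log_norm (hg.logLap n), hg2]
  have iχ : ∫ t, χ t = -2 * (n - 4) * ∫ t, ψ t := by
    simp only [hχ_def]
    rw [integral_add hψ.deriv.deriv.integrable
      ((hψ.mul_left contDiff_const).add (hψ.deriv.mul_left contDiff_const)).integrable,
      integral_add (hψ.deriv.integrable.const_mul _) (hψ.integrable.const_mul _),
      integral_const_mul, integral_const_mul, hψ.integral_deriv, hψ.deriv.integral_deriv]
    ring
  have iη : ∫ t, η t = 0 := by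
    rw [hη_def, integral_add hχ.deriv.deriv.integrable (hχ.deriv.integrable.const_mul _),
      integral_const_mul, hχ.integral_deriv, hχ.deriv.integral_deriv]
    ring
  have itη : ∫ t, t * η t = (n - 2) * ∫ t, χ t := by
    have e : (fun t => t * η t) =
        fun t => t * deriv (deriv χ) t + (2 - n) * (t * deriv χ t) := by
      funext t
      rw [hη_def]
      ring
    rw [e, integral_add (hχ.deriv.deriv.mul_left (f := fun t => t) contDiff_id).integrable
      ((hχ.deriv.mul_left (f := fun t => t) contDiff_id).integrable.const_mul _), integral_const_mul,
      hχ.integral_id_mul_deriv, hχ.deriv.integral_id_mul_deriv, hχ.integral_deriv]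
    ring
  have hexp : ∀ t, Real.exp (n * t) * h t = η t := fun t => by
    rw [hh_def]
    simp only []
    rw [← mul_assoc, ← Real.exp_add, show n * t + -n * t = 0 by ring, Real.exp_zero, one_mul]
  have h1 := hweak _ hg.testOn
  rw [hlap] at h1
  have hlog : ∀ (x : En n) (hx : x ≠ 0), -4 * Real.log ‖x‖ * h (Real.log ‖x‖) =
      (fun _ => 1 : sphere (0 : En n) 1 → ℝ) (direction x hx) *
        (fun t => -4 * t * h t) (Real.log ‖x‖) := by
    intro x hx
    simp
  have hang : ∀ (x : En n) (hx : x ≠ 0),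
      (u x + 4 * Real.log ‖x‖) * h (Real.log ‖x‖) = ω (direction x hx) * h (Real.log ‖x‖) := by
    intro x hx
    rw [hu x hx]
    ring
  have left : ∫ x, u x * h (Real.log ‖x‖) =
      8 * ((n : ℝ) - 2) * ((n : ℝ) - 4) * (surface n).real univ * ∫ t, ψ t := by
    have split : (fun x => u x * h (Real.log ‖x‖)) = fun x =>
        -4 * Real.log ‖x‖ * h (Real.log ‖x‖) + (u x + 4 * Real.log ‖x‖) * h (Real.log ‖x‖) := by
      funext x
      ring
    rw [split, integral_add
      (integrable_polar hn continuous_const (hh.mul_left (by fun_prop)) hlog)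
      (integrable_polar hn hω hh hang), integral_polar hn (a := fun _ => 1) (f := fun t => -4 * t * h t) hlog,
      integral_polar hn hang]
    have e : (fun t => Real.exp (n * t) * (-4 * t * h t)) = fun t => -4 * (t * η t) := by
      funext t
      rw [← hexp]
      ring
    simp_rw [e, hexp, integral_const_mul, iη, itη, iχ]
    simp
    ring
  have right : ∫ x, Real.exp (u x) * g (Real.log ‖x‖) =
      (∫ θ, Real.exp (ω θ) ∂(surface n)) * ∫ t, ψ t := by
    rw [integral_polar hn (a := fun θ => Real.exp (ω θ)) (f := fun t => Real.exp (-4 * t) * g t)]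
    · congr 2
      funext t
      rw [hg_def]
      simp only []
      rw [← mul_assoc, ← mul_assoc, ← Real.exp_add, ← Real.exp_add,
        show n * t + -4 * t + (4 - n) * t = 0 by ring, Real.exp_zero, one_mul]
    · intro x hx
      rw [hu x hx, Real.exp_add]
      ring
  rw [left, right] at h1
  exact (mul_right_cancel₀ hψ0 h1).symm

/-- Stability tested with `|x|^((4-n)/2) ψ(log |x|)`. -/
lemma integral_exp_mul_le_of_stable (hn : 0 < n)
    (hu : ∀ (x : En n) (hx : x ≠ 0), u x = -4 * Real.log ‖x‖ + ω (direction x hx))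
    (hstable : ∀ φ : En n → ℝ, TestOn n {(0 : En n)}ᶜ φ →
      ∫ x, Real.exp (u x) * φ x ^ 2 ≤ ∫ x, (lap φ x) ^ 2)
    (hψ : IsPosTest ψ) :
    (∫ θ, Real.exp (ω θ) ∂(surface n)) * ∫ t, ψ t ^ 2 ≤ (surface n).real univ *
      ∫ t, (deriv (deriv ψ) t + 2 * deriv ψ t + -(n * (n - 4) / 4 : ℝ) * ψ t) ^ 2 := by
  have hg : IsPosTest (fun t => Real.exp ((4 - n : ℝ) / 2 * t) * ψ t) := hψ.mul_left (by fun_prop)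
  have h1 := hstable _ hg.testOn
  simp_rw [lap_comp_log_norm hg] at h1
  have hexp : ∀ t, Real.exp (n * t) * Real.exp (((4 - n : ℝ) / 2 - 2) * t) ^ 2 = 1 := fun t => by
    rw [← Real.exp_nat_mul, ← Real.exp_add, ← Real.exp_zero]
    congr 1
    push_cast
    ring
  have hexp' : ∀ t, Real.exp (n * t) * Real.exp (-4 * t) *
      Real.exp ((4 - n : ℝ) / 2 * t) ^ 2 = 1 := fun t => by
    rw [← Real.exp_nat_mul, ← Real.exp_add, ← Real.exp_add, ← Real.exp_zero]
    congr 1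
    push_cast
    ring
  rw [integral_polar hn (a := fun θ => Real.exp (ω θ))
      (f := fun t => Real.exp (-4 * t) * (Real.exp ((4 - n : ℝ) / 2 * t) * ψ t) ^ 2),
    integral_polar hn (a := fun _ => 1)
      (f := fun t => logLap n (fun t => Real.exp ((4 - n : ℝ) / 2 * t) * ψ t) t ^ 2)] at h1
  · have e1 : (fun t => Real.exp (n * t) * (Real.exp (-4 * t) *
        (Real.exp ((4 - n : ℝ) / 2 * t) * ψ t) ^ 2)) = fun t => ψ t ^ 2 := by
      funext t
      linear_combination (ψ t ^ 2) * hexp' t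
    rw [e1, logLap_exp_mul hψ] at h1
    convert h1 using 2
    · simp
    · congr 1
      funext t
      linear_combination (-(deriv (deriv ψ) t + 2 * deriv ψ t +
        -(n * (n - 4) / 4 : ℝ) * ψ t) ^ 2) * hexp t
  · intro x hx
    simp
  · intro x hx
    rw [hu x hx, Real.exp_add]
    ring

/-- Letting the test function spread out in `log |x|` gives the Hardy–Rellich constant. -/
lemma integral_exp_le_of_stable (hn : 0 < n)
    (hu : ∀ (x : En n) (hx : x ≠ 0), u x = -4 * Real.log ‖x‖ + ω (direction x hx))
    (hstable : ∀ φ : En n → ℝ, TestOn n {(0 : En n)}ᶜ φ →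
      ∫ x, Real.exp (u x) * φ x ^ 2 ≤ ∫ x, (lap φ x) ^ 2)
    (hψ : IsPosTest ψ) (hψ0 : 0 < ∫ t, ψ t ^ 2) :
    ∫ θ, Real.exp (ω θ) ∂(surface n) ≤
      (surface n).real univ * ((n : ℝ) ^ 2 * ((n : ℝ) - 4) ^ 2 / 16) := by
  have scaled : ∀ ε : ℝ, 0 < ε →
      (∫ θ, Real.exp (ω θ) ∂(surface n)) * ∫ t, ψ t ^ 2 ≤ (surface n).real univ *
        ∫ t, (ε ^ 2 * deriv (deriv ψ) t + 2 * ε * deriv ψ t +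
          -(n * (n - 4) / 4 : ℝ) * ψ t) ^ 2 := by
    intro ε hε
    have h1 := integral_exp_mul_le_of_stable hn hu hstable (hψ.comp_mul_left hε)
    have d1 : deriv (fun t => ψ (ε * t)) = fun t => ε * deriv ψ (ε * t) :=
      funext fun t => by simpa using deriv_comp_mul_left ε ψ t
    have d2 : deriv (deriv (fun t => ψ (ε * t))) = fun t => ε ^ 2 * deriv (deriv ψ) (ε * t) := by
      rw [d1]
      funext t
      rw [deriv_const_mul_field, deriv_comp_mul_left]
      simp
      ring
    rw [d2, d1] at h1
    have e : (fun t => (ε ^ 2 * deriv (deriv ψ) (ε * t) + 2 * (ε * deriv ψ (ε * t)) +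
        -(n * (n - 4) / 4 : ℝ) * ψ (ε * t)) ^ 2) = fun t => (fun s =>
          (ε ^ 2 * deriv (deriv ψ) s + 2 * ε * deriv ψ s +
            -(n * (n - 4) / 4 : ℝ) * ψ s) ^ 2) (ε * t) := by
      funext t
      ring
    rw [e, Measure.integral_comp_mul_left (fun s => (ε ^ 2 * deriv (deriv ψ) s +
        2 * ε * deriv ψ s + -(n * (n - 4) / 4 : ℝ) * ψ s) ^ 2),
      Measure.integral_comp_mul_left (fun s => ψ s ^ 2),
      abs_of_pos (inv_pos.mpr hε), smul_eq_mul, smul_eq_mul, mul_left_comm,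
      mul_left_comm ((surface n).real univ)] at h1
    exact le_of_mul_le_mul_left h1 (inv_pos.mpr hε)
  have lim := ((continuous_integral_test_quadratic hψ (-(n * (n - 4) / 4 : ℝ))).tendsto
    0).const_mul ((surface n).real univ)
  have h0 := ge_of_tendsto (lim.mono_left nhdsWithin_le_nhds)
    (eventually_nhdsWithin_of_forall (s := Ioi 0) scaled)
  have e : (fun t => ((0 : ℝ) ^ 2 * deriv (deriv ψ) t + 2 * 0 * deriv ψ t +
      -(n * (n - 4) / 4 : ℝ) * ψ t) ^ 2) =
        fun t => ((n : ℝ) ^ 2 * ((n : ℝ) - 4) ^ 2 / 16) * ψ t ^ 2 := by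
    funext t
    ring
  rw [e, integral_const_mul, ← mul_assoc] at h0
  exact le_of_mul_le_mul_right h0 hψ0

end Homogeneous

lemma exists_isPosTest :
    ∃ ψ : ℝ → ℝ, IsPosTest ψ ∧ ∫ t, ψ t ≠ 0 ∧ 0 < ∫ t, ψ t ^ 2 := by
  let ψ : ContDiffBump (2 : ℝ) := ⟨1 / 2, 1, by norm_num, by norm_num⟩
  have hψ : IsPosTest ψ := by
    refine ⟨ψ.contDiff, ψ.hasCompactSupport, ?_⟩
    rw [ψ.tsupport_eq, Real.closedBall_eq_Icc]
    intro t ht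
    have : (2 : ℝ) - 1 ≤ t := ht.1
    exact lt_of_lt_of_le (by norm_num) this
  refine ⟨ψ, hψ, ψ.integral_pos.ne', ?_⟩
  refine Continuous.integral_pos_of_hasCompactSupport_nonneg_nonzero (x := 2)
    (hψ.continuous.pow 2) ?_ (fun t => sq_nonneg _) ?_
  · simpa only [sq, Pi.pow_apply] using (hψ.mul_left hψ.smooth).compact
  · simp [ψ.one_of_mem_closedBall (mem_closedBall_self ψ.rIn_pos.le)]

/-- (Theorem 5.3 of the paper.) Let `n > 4` and `ω : 𝕊^{n-1} → ℝ` be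
continuous.  If `u(x) = -4 log|x| + ω(x/|x|)` satisfies `e^u ∈ L¹_loc(ℝ^n \ {0})`, is a weak
solution of `Δ²u = e^u` in `ℝ^n \ {0}` (tested against `φ ∈ C_c^∞(ℝ^n \ {0})`), and is
stable in `ℝ^n \ {0}`, then `n²(n-4)²/16 ≥ 8(n-2)(n-4)`. -/
theorem stable_homogeneous_fourth_order_dimension_bound
    (n : ℕ) (hn : 4 < n)
    (ω : Metric.sphere (0 : En n) 1 → ℝ) (u : En n → ℝ)
    (hω : Continuous ω)
    (hu : ∀ (x : En n) (hx : x ≠ 0),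
      u x = -4 * Real.log ‖x‖ + ω ⟨‖x‖⁻¹ • x, by
        have hx' : ‖x‖ ≠ 0 := norm_ne_zero_iff.mpr hx
        simp [mem_sphere_zero_iff_norm, norm_smul, Real.norm_eq_abs,
          abs_of_nonneg (norm_nonneg x), inv_mul_cancel₀ hx']⟩)
    (hloc : MeasureTheory.LocallyIntegrableOn (fun x => Real.exp (u x)) {(0 : En n)}ᶜ volume)
    (hweak : ∀ φ : En n → ℝ, TestOn n {(0 : En n)}ᶜ φ →
      ∫ x, u x * lap (fun y => lap φ y) x = ∫ x, Real.exp (u x) * φ x)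
    (hstable : ∀ φ : En n → ℝ, TestOn n {(0 : En n)}ᶜ φ →
      ∫ x, Real.exp (u x) * φ x ^ 2 ≤ ∫ x, (lap φ x) ^ 2) :
    (n : ℝ) ^ 2 * ((n : ℝ) - 4) ^ 2 / 16 ≥ 8 * ((n : ℝ) - 2) * ((n : ℝ) - 4) := by
  have hn0 : 0 < n := by omega
  replace hu : ∀ (x : En n) (hx : x ≠ 0), u x = -4 * Real.log ‖x‖ + ω (direction x hx) := by
    intro x hx
    rw [hu x hx]
    congr 2
    exact Subtype.ext (homeomorphUnitSphereProd_apply_fst_coe _ ⟨x, hx⟩).symm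
  obtain ⟨ψ, hψ, hψ1, hψ2⟩ := exists_isPosTest
  have mass := integral_exp_of_weak hn0 hω hu hweak hψ hψ1
  have bound := integral_exp_le_of_stable hn0 hu hstable hψ hψ2
  have : Nonempty (Fin n) := ⟨⟨0, hn0⟩⟩
  have hS : 0 < (surface n).real univ :=
    ENNReal.toReal_pos (Measure.measure_univ_ne_zero.mpr (Measure.toSphere_ne_zero _))
      (measure_ne_top _ _)
  rw [mass, mul_comm] at bound
  exact le_of_mul_le_mul_left bound hS
end
end

section
/- Let $1<s<2$ and $n>2s$. Let $u:\mathbb{R}^n\to\mathbb{R}$ be continuous and stable outside a compact set. Then there exists a constant $C>0$ such that $\int_{B_r} e^{u}\,dx \le C r^{n-2s}$ for every $r\ge 1$. -/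
open MeasureTheory Metric Filter Set

noncomputable section

lemma integrable_norm_rpow_piecewise {n : ℕ} (hn0 : n ≠ 0) (σ : ℝ) (h0 : 0 < σ) (h1 : σ < 1)
    (A B : ℝ) :
    Integrable (fun y : En n => if ‖y‖ ≤ 1 then A * ‖y‖ ^ (2 - ((n : ℝ) + 2 * σ))
      else B * ‖y‖ ^ (-((n : ℝ) + 2 * σ))) := by
  have : Nonempty (Fin n) := ⟨⟨0, Nat.pos_of_ne_zero hn0⟩⟩
  have hpow : ∀ (y q : ℝ), 0 < y → y ^ (n - 1) * y ^ q = y ^ ((n : ℝ) - 1 + q) := by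
    intro y q hy
    rw [← Real.rpow_natCast, ← Real.rpow_add hy, Nat.cast_sub (Nat.pos_of_ne_zero hn0)]
    simp
  refine (integrable_fun_norm_addHaar (volume : Measure (En n))
    (f := fun t : ℝ => if t ≤ 1 then A * t ^ (2 - ((n : ℝ) + 2 * σ))
      else B * t ^ (-((n : ℝ) + 2 * σ)))).2 ?_
  rw [finrank_euclideanSpace_fin, ← Ioc_union_Ioi_eq_Ioi (zero_le_one (α := ℝ))]
  refine IntegrableOn.union ?_ ?_
  · have h : IntegrableOn (fun t : ℝ => A * t ^ (1 - 2 * σ)) (Ioc 0 1) := by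
      refine Integrable.const_mul ?_ A
      exact (intervalIntegrable_iff_integrableOn_Ioc_of_le zero_le_one).1
        (intervalIntegral.intervalIntegrable_rpow' (by linarith))
    refine h.congr_fun (fun t ht => ?_) measurableSet_Ioc
    have := hpow t (2 - ((n : ℝ) + 2 * σ)) ht.1
    simp only [smul_eq_mul, if_pos ht.2]
    rw [mul_left_comm, this]
    ring_nf
  · have h : IntegrableOn (fun t : ℝ => B * t ^ (-1 - 2 * σ)) (Ioi 1) :=
      Integrable.const_mul (integrableOn_Ioi_rpow_of_lt (by linarith) zero_lt_one) B
    refine h.congr_fun (fun t ht => ?_) measurableSet_Ioi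
    have ht : (1 : ℝ) < t := ht
    have := hpow t (-((n : ℝ) + 2 * σ)) (by linarith)
    simp only [smul_eq_mul, if_neg (not_le.2 ht)]
    rw [mul_left_comm, this]
    ring_nf

lemma exists_abs_second_difference_le {n : ℕ} {w : En n → ℝ} (hw : ContDiff ℝ (⊤ : ℕ∞) w)
    (hc : HasCompactSupport w) :
    ∃ K : ℝ, ∀ x y : En n, |(w x - w (x + y)) + (w x - w (x - y))| ≤ K * ‖y‖ ^ 2 := by
  obtain ⟨C, hC⟩ := ContDiff.lipschitzWith_of_hasCompactSupport (𝕂 := ℝ) (n := 1) (hc.fderiv ℝ)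
    (hw.fderiv_right (m := 1) (by norm_cast)) one_ne_zero
  have key : ∀ x y : En n, ‖w (x + y) - w x - fderiv ℝ w x y‖ ≤ C * ‖y‖ ^ 2 := by
    intro x y
    have h := (convex_closedBall x ‖y‖).norm_image_sub_le_of_norm_fderiv_le' (𝕜 := ℝ) (f := w)
      (C := C * ‖y‖) (φ := fderiv ℝ w x) (x := x) (y := x + y)
      (fun z _ => hw.differentiable (by simp) z) (fun z hz => ?_) (by simp) (by simp)
    · simpa [pow_two, mul_assoc] using h
    · rw [← dist_eq_norm]
      exact (hC.dist_le_mul z x).trans (by gcongr; exact hz)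
  refine ⟨2 * C, fun x y => ?_⟩
  have h1 := key x y
  have h2 := key x (-y)
  rw [norm_neg, map_neg, ← sub_eq_add_neg] at h2
  rw [Real.norm_eq_abs, abs_le] at h1 h2
  rw [abs_le]
  constructor <;> linarith [h1.1, h1.2, h2.1, h2.2]

lemma truncInt_eq_integral_indicator {n : ℕ} (σ : ℝ) (w : En n → ℝ) (x : En n) (ε : ℝ) :
    truncInt n σ w x ε = ∫ y, indicator {y : En n | ε ≤ ‖y‖}
      (fun y => (w x - w (x + y)) / ‖y‖ ^ ((n : ℝ) + 2 * σ)) y := by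
  have hm : MeasurableSet {z : En n | ε ≤ dist x z} :=
    measurableSet_le measurable_const (continuous_const.dist continuous_id).measurable
  rw [truncInt, ← integral_indicator hm, ← integral_add_left_eq_self _ x]
  refine integral_congr_ae (Eventually.of_forall fun y => ?_)
  simp [indicator, dist_eq_norm]

lemma integrable_truncated_difference {n : ℕ} {σ : ℝ} (h0 : 0 < σ) {w : En n → ℝ}
    (hw : Continuous w) {M : ℝ} (hM : ∀ x, |w x| ≤ M) (x : En n) {ε : ℝ} (hε : 0 < ε) :
    Integrable (indicator {y : En n | ε ≤ ‖y‖}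
      (fun y => (w x - w (x + y)) / ‖y‖ ^ ((n : ℝ) + 2 * σ))) := by
  have hm : MeasurableSet {y : En n | ε ≤ ‖y‖} := measurableSet_le measurable_const measurable_norm
  have hp : 0 < (n : ℝ) + 2 * σ := by positivity
  have hM0 : 0 ≤ M := (abs_nonneg _).trans (hM x)
  have hi := (integrable_one_add_norm (E := En n) (μ := volume) (r := (n : ℝ) + 2 * σ)
    (by rw [finrank_euclideanSpace_fin]; linarith)).const_mul
      (2 * M * (1 + ε⁻¹) ^ ((n : ℝ) + 2 * σ))
  refine hi.mono' ?_ (Eventually.of_forall fun y => ?_)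
  · refine (Measurable.indicator ?_ hm).aestronglyMeasurable
    exact (measurable_const.sub (hw.measurable.comp (measurable_const_add x))).div
      (measurable_norm.pow_const _)
  · by_cases hy : ε ≤ ‖y‖
    · have hy0 : 0 < ‖y‖ := hε.trans_le hy
      rw [indicator_of_mem (by exact hy), norm_div, Real.norm_eq_abs, Real.norm_eq_abs,
        abs_of_nonneg (Real.rpow_nonneg (norm_nonneg y) _), Real.rpow_neg (by positivity),
        div_eq_mul_inv, mul_assoc (2 * M)]
      refine mul_le_mul ?_ ?_ (by positivity) (by positivity)
      · exact (abs_sub _ _).trans (by linarith [hM x, hM (x + y)])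
      · rw [← div_eq_mul_inv, ← Real.div_rpow (by positivity) (by positivity),
          ← Real.inv_rpow (norm_nonneg y)]
        refine Real.rpow_le_rpow (by positivity) ?_ hp.le
        rw [le_div_iff₀ (by positivity), inv_mul_le_iff₀ hy0]
        have : 1 ≤ ‖y‖ * ε⁻¹ := by rwa [← div_eq_mul_inv, one_le_div hε]
        nlinarith
    · rw [indicator_of_notMem (by exact hy), norm_zero]
      positivity

lemma exists_tendsto_truncInt {n : ℕ} (hn0 : n ≠ 0) {σ : ℝ} (h0 : 0 < σ) (h1 : σ < 1)
    {w : En n → ℝ} (hw : ContDiff ℝ (⊤ : ℕ∞) w) (hc : HasCompactSupport w) (x : En n) :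
    ∃ L, Tendsto (truncInt n σ w x) (nhdsWithin 0 (Ioi 0)) (nhds L) := by
  obtain ⟨M, hM⟩ := hc.exists_bound_of_continuous hw.continuous
  simp only [Real.norm_eq_abs] at hM
  obtain ⟨K, hK⟩ := exists_abs_second_difference_le hw hc
  set F : ℝ → En n → ℝ := fun ε => indicator {y : En n | ε ≤ ‖y‖}
      (fun y => (w x - w (x + y)) / ‖y‖ ^ ((n : ℝ) + 2 * σ)) with hF
  set H : En n → ℝ := fun y =>
    ((w x - w (x + y)) + (w x - w (x - y))) / ‖y‖ ^ ((n : ℝ) + 2 * σ) with hH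
  have hFint : ∀ ε > 0, Integrable (F ε) := fun ε hε =>
    integrable_truncated_difference h0 hw.continuous hM x hε
  have hsym : ∀ ε > 0, truncInt n σ w x ε = 2⁻¹ * ∫ y, (F ε y + F ε (-y)) := by
    intro ε hε
    rw [integral_add (hFint ε hε) (hFint ε hε).comp_neg, integral_neg_eq_self (F ε),
      truncInt_eq_integral_indicator]
    ring
  have hsum : ∀ ε y, F ε y + F ε (-y) = if ε ≤ ‖y‖ then H y else 0 := by
    intro ε y
    by_cases hy : ε ≤ ‖y‖
    · simp [hF, hH, hy, add_div, sub_eq_add_neg]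
    · simp [hF, hy]
  refine ⟨2⁻¹ * ∫ y, (if 0 < ‖y‖ then H y else 0), ?_⟩
  have hlim : Tendsto (fun ε => ∫ y, (F ε y + F ε (-y))) (nhdsWithin 0 (Ioi 0))
      (nhds (∫ y, (if 0 < ‖y‖ then H y else 0))) := by
    refine tendsto_integral_filter_of_dominated_convergence _ ?_ ?_
      (integrable_norm_rpow_piecewise hn0 σ h0 h1 K (4 * M)) ?_
    · filter_upwards [self_mem_nhdsWithin] with ε hε
      exact ((hFint ε hε).add (hFint ε hε).comp_neg).aestronglyMeasurable
    · filter_upwards [self_mem_nhdsWithin] with ε hε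
      refine Eventually.of_forall fun y => ?_
      have hε : 0 < ε := hε
      rw [hsum]
      rcases (norm_nonneg y).eq_or_lt with hy0 | hy0
      · rw [if_neg (by linarith), norm_zero]
        rw [← hy0, if_pos zero_le_one]
        have hK' : 0 ≤ K := by
          have : Nonempty (Fin n) := ⟨⟨0, Nat.pos_of_ne_zero hn0⟩⟩
          obtain ⟨z, hz⟩ : ∃ z : En n, z ≠ 0 := exists_ne 0
          exact nonneg_of_mul_nonneg_left ((abs_nonneg _).trans (hK x z)) (by positivity)
        exact mul_nonneg hK' (Real.rpow_nonneg le_rfl _)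
      · have hHb : ‖H y‖ ≤ if ‖y‖ ≤ 1 then K * ‖y‖ ^ (2 - ((n : ℝ) + 2 * σ))
            else 4 * M * ‖y‖ ^ (-((n : ℝ) + 2 * σ)) := by
          rw [hH]
          simp only [norm_div, Real.norm_eq_abs]
          rw [abs_of_nonneg (Real.rpow_nonneg hy0.le _)]
          split_ifs
          · rw [Real.rpow_sub hy0, Real.rpow_two, ← mul_div_assoc]
            gcongr
            exact hK x y
          · rw [Real.rpow_neg hy0.le, ← div_eq_mul_inv]
            gcongr
            have a1 := abs_le.1 (hM x)
            have a2 := abs_le.1 (hM (x + y))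
            have a3 := abs_le.1 (hM (x - y))
            rw [abs_le]
            constructor <;> linarith [a1.1, a1.2, a2.1, a2.2, a3.1, a3.2]
        by_cases hy : ε ≤ ‖y‖
        · rw [if_pos hy]; exact hHb
        · rw [if_neg hy, norm_zero]; exact (norm_nonneg _).trans hHb
    · refine Eventually.of_forall fun y => ?_
      simp only [hsum]
      rcases (norm_nonneg y).eq_or_lt with hy0 | hy0
      · rw [if_neg (by linarith)]
        refine tendsto_const_nhds.congr' ?_
        filter_upwards [self_mem_nhdsWithin] with ε hε
        have hε : 0 < ε := hε
        rw [if_neg (by linarith)]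
      · rw [if_pos hy0]
        refine tendsto_const_nhds.congr' ?_
        filter_upwards [mem_nhdsWithin_of_mem_nhds (Iio_mem_nhds hy0)] with ε hε
        rw [if_pos (le_of_lt hε)]
  refine (hlim.const_mul 2⁻¹).congr' ?_
  filter_upwards [self_mem_nhdsWithin] with ε hε
  exact (hsym ε hε).symm

lemma truncInt_comp_inv_smul {n : ℕ} (σ : ℝ) (w : En n → ℝ) (x : En n) (ε : ℝ) {ρ : ℝ}
    (hρ : 0 < ρ) :
    truncInt n σ (fun y => w (ρ⁻¹ • y)) x ε
      = ρ ^ (-(2 * σ)) * truncInt n σ w (ρ⁻¹ • x) (ε / ρ) := by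
  rw [truncInt_eq_integral_indicator, truncInt_eq_integral_indicator]
  set g : En n → ℝ := indicator {y : En n | ε / ρ ≤ ‖y‖}
      (fun y => (w (ρ⁻¹ • x) - w (ρ⁻¹ • x + y)) / ‖y‖ ^ ((n : ℝ) + 2 * σ)) with hg
  have hρn : ρ ^ (-(2 * σ)) = ρ ^ (-((n : ℝ) + 2 * σ)) * ρ ^ n := by
    rw [← Real.rpow_natCast, ← Real.rpow_add hρ]
    congr 1; ring
  have h := Measure.integral_comp_inv_smul_of_nonneg (volume : Measure (En n)) g hρ.le
  rw [finrank_euclideanSpace_fin, smul_eq_mul] at h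
  rw [hρn, mul_assoc, ← h, ← integral_const_mul]
  refine integral_congr_ae (Eventually.of_forall fun y => ?_)
  have hiff : ε / ρ ≤ ‖ρ⁻¹ • y‖ ↔ ε ≤ ‖y‖ := by
    rw [norm_smul, norm_inv, Real.norm_of_nonneg hρ.le, inv_mul_eq_div,
      div_le_div_iff_of_pos_right hρ]
  by_cases hy : ε ≤ ‖y‖
  · have hy' := hiff.2 hy
    simp only [hg]
    rw [indicator_of_mem (by exact hy), indicator_of_mem (by exact hy'), smul_add, norm_smul,
      norm_inv, Real.norm_of_nonneg hρ.le, Real.mul_rpow (by positivity) (norm_nonneg y),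
      Real.inv_rpow hρ.le, Real.rpow_neg hρ.le]
    have : ρ ^ ((n : ℝ) + 2 * σ) ≠ 0 := (Real.rpow_pos_of_pos hρ _).ne'
    rw [mul_div_assoc', mul_div_mul_left _ _ (inv_ne_zero this)]
  · have hy' := fun h => hy (hiff.1 h)
    simp only [hg]
    rw [indicator_of_notMem (by exact hy), indicator_of_notMem (by exact hy'), mul_zero]

lemma fracLap_comp_inv_smul {n : ℕ} (hn0 : n ≠ 0) {σ : ℝ} (h0 : 0 < σ) (h1 : σ < 1)
    {w : En n → ℝ} (hw : ContDiff ℝ (⊤ : ℕ∞) w) (hc : HasCompactSupport w) {ρ : ℝ} (hρ : 0 < ρ)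
    (x : En n) :
    fracLap n σ (fun y => w (ρ⁻¹ • y)) x = ρ ^ (-(2 * σ)) * fracLap n σ w (ρ⁻¹ • x) := by
  obtain ⟨L, hL⟩ := exists_tendsto_truncInt hn0 h0 h1 hw hc (ρ⁻¹ • x)
  have hdiv : Tendsto (fun ε : ℝ => ε / ρ) (nhdsWithin 0 (Ioi 0)) (nhdsWithin 0 (Ioi 0)) := by
    refine tendsto_nhdsWithin_iff.2 ⟨?_, ?_⟩
    · have : Tendsto (fun ε : ℝ => ε / ρ) (nhds 0) (nhds (0 / ρ)) :=
        (continuous_id.div_const ρ).tendsto 0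
      rw [zero_div] at this
      exact this.mono_left nhdsWithin_le_nhds
    · filter_upwards [self_mem_nhdsWithin] with ε hε
      exact div_pos hε hρ
  have hlim : Tendsto (truncInt n σ (fun y => w (ρ⁻¹ • y)) x) (nhdsWithin 0 (Ioi 0))
      (nhds (ρ ^ (-(2 * σ)) * L)) :=
    ((hL.comp hdiv).const_mul _).congr fun ε => (truncInt_comp_inv_smul σ w x ε hρ).symm
  rw [fracLap, fracLap, hlim.limUnder_eq, hL.limUnder_eq]
  ring

lemma integral_fracLap_sq_comp_inv_smul {n : ℕ} (hn0 : n ≠ 0) {σ : ℝ} (h0 : 0 < σ) (h1 : σ < 1)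
    {w : En n → ℝ} (hw : ContDiff ℝ (⊤ : ℕ∞) w) (hc : HasCompactSupport w) {ρ : ℝ}
    (hρ : 0 < ρ) :
    ∫ x, fracLap n σ (fun y => w (ρ⁻¹ • y)) x ^ 2
      = ρ ^ ((n : ℝ) - 4 * σ) * ∫ x, fracLap n σ w x ^ 2 := by
  have h := Measure.integral_comp_inv_smul_of_nonneg (volume : Measure (En n))
    (fun x => fracLap n σ w x ^ 2) hρ.le
  rw [finrank_euclideanSpace_fin, smul_eq_mul] at h
  have hρn : ρ ^ ((n : ℝ) - 4 * σ) = (ρ ^ (-(2 * σ))) ^ 2 * ρ ^ n := by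
    rw [← Real.rpow_natCast, ← Real.rpow_natCast, ← Real.rpow_mul hρ.le, ← Real.rpow_add hρ]
    congr 1; push_cast; ring
  simp only [fracLap_comp_inv_smul hn0 h0 h1 hw hc hρ, mul_pow]
  rw [integral_const_mul, h, hρn, mul_assoc]

lemma exists_annular_cutoff (n : ℕ) :
    ∃ ψ : En n → ℝ, TestOn n (closedBall (0 : En n) (1 / 2))ᶜ ψ ∧
      ∀ x, 1 ≤ ‖x‖ → ‖x‖ ≤ 2 → ψ x = 1 := by
  let f : ContDiffBump (0 : En n) := ⟨2, 3, by norm_num, by norm_num⟩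
  let g : ContDiffBump (0 : En n) := ⟨3 / 4, 1, by norm_num, by norm_num⟩
  refine ⟨fun x => f x - g x, ⟨f.contDiff.sub g.contDiff,
    f.hasCompactSupport.sub g.hasCompactSupport, ?_⟩, fun x h1 h2 => ?_⟩
  · have hsub : tsupport (fun x => f x - g x) ⊆ (ball (0 : En n) (3 / 4))ᶜ := by
      refine closure_minimal (fun x hx hxb => hx ?_) isOpen_ball.isClosed_compl
      have hx' : ‖x‖ < 3 / 4 := by simpa using hxb
      have hf : f x = 1 := f.one_of_mem_closedBall (by
        rw [mem_closedBall_zero_iff]; show ‖x‖ ≤ 2; linarith)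
      have hg : g x = 1 := g.one_of_mem_closedBall (by
        rw [mem_closedBall_zero_iff]; show ‖x‖ ≤ 3 / 4; linarith)
      simp [hf, hg]
    exact hsub.trans (compl_subset_compl.2 (closedBall_subset_ball (by norm_num)))
  · have hf : f x = 1 := f.one_of_mem_closedBall (by
      rw [mem_closedBall_zero_iff]; exact h2)
    have hg : g x = 0 := g.zero_of_le_dist (by rw [dist_zero_right]; exact h1)
    simp [hf, hg]

lemma TestOn.comp_inv_smul {n : ℕ} {ψ : En n → ℝ} {a : ℝ}
    (hψ : TestOn n (closedBall (0 : En n) a)ᶜ ψ) {ρ R : ℝ} (hρ : 0 < ρ) (hR : R ≤ ρ * a) :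
    TestOn n (closedBall (0 : En n) R)ᶜ (fun y => ψ (ρ⁻¹ • y)) := by
  obtain ⟨h1, h2, h3⟩ := hψ
  refine ⟨h1.comp (contDiff_const_smul _),
    h2.comp_homeomorph (Homeomorph.smulOfNeZero ρ⁻¹ (inv_ne_zero hρ.ne')), fun x hx hxR => ?_⟩
  have hx' : ρ⁻¹ • x ∈ tsupport ψ :=
    tsupport_comp_subset_preimage ψ (continuous_const_smul ρ⁻¹) hx
  refine h3 hx' ?_
  rw [mem_closedBall_zero_iff] at hxR ⊢
  rw [norm_smul, norm_inv, Real.norm_of_nonneg hρ.le, inv_mul_le_iff₀ hρ]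
  exact hxR.trans hR

lemma setIntegral_exp_le_of_eq_one {n : ℕ} {u φ : En n → ℝ} (hu : Continuous u)
    (hφ : Continuous φ) (hc : HasCompactSupport φ) {S : Set (En n)} (hS : MeasurableSet S)
    (h1 : ∀ x ∈ S, φ x = 1) :
    ∫ x in S, Real.exp (u x) ≤ ∫ x, Real.exp (u x) * φ x ^ 2 := by
  have hint : Integrable (fun x => Real.exp (u x) * φ x ^ 2) := by
    refine Continuous.integrable_of_hasCompactSupport (by fun_prop) ?_
    refine HasCompactSupport.mul_left (hc.comp_left (g := fun t : ℝ => t ^ 2) (by simp))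
  calc ∫ x in S, Real.exp (u x) = ∫ x in S, Real.exp (u x) * φ x ^ 2 :=
        setIntegral_congr_fun hS fun x hx => by simp [h1 x hx]
    _ ≤ _ := setIntegral_le_integral hint (Eventually.of_forall fun x => by positivity)

lemma exists_annulus_bound {n : ℕ} (hn0 : n ≠ 0) {s : ℝ} (h0 : 0 < s) (h2 : s < 2)
    {u : En n → ℝ} (hu : Continuous u) {R : ℝ} (hR : 0 < R) (hst : StableOutsideBall n s u R) :
    ∃ A ≥ 0, ∀ r, 2 * R ≤ r →
      ∫ x in ball (0 : En n) (2 * r) \ ball 0 r, Real.exp (u x) ≤ A * r ^ ((n : ℝ) - 2 * s) := by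
  obtain ⟨ψ, hψ, hψ1⟩ := exists_annular_cutoff n
  refine ⟨∫ x, fracLap n (s / 2) ψ x ^ 2, integral_nonneg fun x => by positivity, fun r hr => ?_⟩
  have hr0 : 0 < r := by linarith
  have hφ := hψ.comp_inv_smul hr0 (R := R) (by linarith)
  calc _ ≤ ∫ x, Real.exp (u x) * ψ (r⁻¹ • x) ^ 2 := by
        refine setIntegral_exp_le_of_eq_one hu hφ.1.continuous hφ.2.1
          (measurableSet_ball.diff measurableSet_ball) fun x hx => ?_
        have hx1 : r ≤ ‖x‖ := by simpa using hx.2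
        have hx2 : ‖x‖ < 2 * r := by simpa using hx.1
        refine hψ1 _ ?_ ?_ <;> rw [norm_smul, norm_inv, Real.norm_of_nonneg hr0.le]
        · rwa [le_inv_mul_iff₀ hr0, mul_one]
        · rw [inv_mul_le_iff₀ hr0]; linarith
    _ ≤ ∫ x, fracLap n (s / 2) (fun y => ψ (r⁻¹ • y)) x ^ 2 := hst _ hφ
    _ = _ := by
        rw [integral_fracLap_sq_comp_inv_smul hn0 (by linarith) (by linarith) hψ.1 hψ.2.1 hr0,
          mul_comm]
        congr 3; ring

/-- A monotone function whose dyadic increments are `O(r ^ a)`, `a > 0`, is itself `O(r ^ a)`. -/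
lemma exists_le_rpow_of_dyadic_increment {I : ℝ → ℝ} (hI : Monotone I) {a A r₀ : ℝ} (ha : 0 < a)
    (hA : 0 ≤ A) (hr₀ : 2 ≤ r₀)
    (hstep : ∀ r, r₀ / 2 ≤ r → I (2 * r) ≤ I r + A * r ^ a) :
    ∃ C > 0, ∀ r, 1 ≤ r → I r ≤ C * r ^ a := by
  have h2a : 0 < (2 : ℝ) ^ a - 1 := sub_pos.2 (Real.one_lt_rpow one_lt_two ha)
  set C : ℝ := max 1 (I r₀) + A / (2 ^ a - 1) with hCdef
  have hq : 0 ≤ A / ((2 : ℝ) ^ a - 1) := div_nonneg hA h2a.le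
  have hC0 : 0 < C := by have := le_max_left 1 (I r₀); linarith
  have hC1 : I r₀ ≤ C := by have := le_max_right 1 (I r₀); linarith
  have hC2 : A ≤ C * (2 ^ a - 1) := by
    rw [← div_le_iff₀ h2a]; have := le_max_left 1 (I r₀); linarith
  have hsmall : ∀ r, 1 ≤ r → r ≤ r₀ → I r ≤ C * r ^ a := fun r h1 hr =>
    (hI hr).trans <| hC1.trans <| le_mul_of_one_le_right hC0.le (Real.one_le_rpow h1 ha.le)
  refine ⟨C, hC0, fun r hr => ?_⟩
  have key : ∀ k : ℕ, ∀ r, 1 ≤ r → r ≤ 2 ^ k * r₀ → I r ≤ C * r ^ a := by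
    intro k
    induction k with
    | zero => intro r h1 hr; exact hsmall r h1 (by simpa using hr)
    | succ k ih =>
      intro r h1 hr
      rcases le_total r r₀ with h | h
      · exact hsmall r h1 h
      · have e := ih (r / 2) (by linarith) (by rw [pow_succ] at hr; linarith)
        have f := hstep (r / 2) (by linarith)
        rw [mul_div_cancel₀ r two_ne_zero] at f
        have hra : r ^ a = 2 ^ a * (r / 2) ^ a := by
          rw [← Real.mul_rpow (by norm_num) (by linarith), mul_div_cancel₀ r two_ne_zero]
        have hp : 0 ≤ (r / 2) ^ a := Real.rpow_nonneg (by linarith) _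
        have := mul_le_mul_of_nonneg_right hC2 hp
        rw [hra]
        linarith
  obtain ⟨k, hk⟩ := pow_unbounded_of_one_lt r one_lt_two
  refine key k r hr (hk.le.trans ?_)
  have : (0 : ℝ) < 2 ^ k := by positivity
  nlinarith

/-- (Lemma 4.1 of the paper.) Let `1 < s < 2` and `n > 2s`.  If
`u : ℝ^n → ℝ` is continuous and stable outside a compact set, then there is a constant
`C > 0` such that `∫_{B_r} e^u ≤ C r^{n-2s}` for every `r ≥ 1`. -/
theorem energy_bound_on_balls_fractional
    (n : ℕ) (s : ℝ) (hs1 : 1 < s) (hs2 : s < 2) (hn : 2 * s < (n : ℝ))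
    (u : En n → ℝ) (hu : Continuous u)
    (hstable : ∃ R > 0, StableOutsideBall n s u R) :
    ∃ C > 0, ∀ r : ℝ, 1 ≤ r →
      ∫ x in Metric.ball (0 : En n) r, Real.exp (u x) ≤ C * r ^ ((n : ℝ) - 2 * s) := by
  obtain ⟨R, hR, hst⟩ := hstable
  have hn0 : n ≠ 0 := by
    rintro rfl
    norm_num at hn
    linarith
  obtain ⟨A, hA, hann⟩ := exists_annulus_bound hn0 (by linarith) hs2 hu hR hst
  have hint : ∀ r, IntegrableOn (fun x => Real.exp (u x)) (ball (0 : En n) r) := fun r =>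
    ((hu.rexp.locallyIntegrable.integrableOn_isCompact
      (isCompact_closedBall (0 : En n) r))).mono_set ball_subset_closedBall
  refine exists_le_rpow_of_dyadic_increment
    (I := fun r => ∫ x in ball (0 : En n) r, Real.exp (u x)) (r₀ := 4 * R + 2) (fun r r' h => ?_)
    (by linarith) hA (by linarith) fun r hr => ?_
  · exact setIntegral_mono_set (hint r') (Eventually.of_forall fun x => (Real.exp_pos _).le)
      (ball_subset_ball h).eventuallyLE
  · have hr0 : 0 < r := by linarith
    have h := setIntegral_sdiff (measurableSet_ball (x := (0 : En n)) (ε := r)) (hint (2 * r))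
      (ball_subset_ball (by linarith))
    have := hann r (by linarith)
    linarith
end
end
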